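/- Let u_i ∈ W^{1,p_i}(D_2(0),S^1) be a sequence of stationary p_i-harmonic maps on the Euclidean disk D_2(0) ⊂ ℝ², with p_i ↑ 2 and E_{p_i}(u_i,D_2) ≤ Λ/(2−p_i), such that the normalized energy measures μ_i = (2−p_i)|du_i|^{p_i}(z) dz converge weakly in (C^0(D_2(0)))^* to θ·δ_0, a multiple of the Dirac mass at the origin. Then θ ∈ 2πℕ. -/

import Mathlib

open MeasureTheory Metric Filter Topology Set
open scoped ENNReal NNReal

noncomputable section

/-- The Hilbert–Schmidt norm of an `ℝ`-linear map `ℂ → ℂ`: for the differential `du` of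
a map on the plane `ℝ² ≃ ℂ` this is the pointwise energy density norm `|du|`. -/
def hsNorm (T : ℂ →L[ℝ] ℂ) : ℝ := Real.sqrt (‖T 1‖ ^ 2 + ‖T Complex.I‖ ^ 2)

/-- The real inner product on `ℂ ≃ ℝ²`. -/
def rinner (a b : ℂ) : ℝ := ((starRingEnd ℂ) a * b).re

/-- The one-form `ju = u¹du² - u²du¹`, evaluated at `z` on the vector `w`. -/
def jform (u : ℂ → ℂ) (du : ℂ → ℂ →L[ℝ] ℂ) (z w : ℂ) : ℝ :=
  ((starRingEnd ℂ) (u z) * du z w).im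

/-- A smooth real-valued test function compactly supported in `Ω`. -/
def IsTest (Ω : Set ℂ) (φ : ℂ → ℝ) : Prop :=
  ContDiff ℝ (⊤ : ℕ∞) φ ∧ HasCompactSupport φ ∧ tsupport φ ⊆ Ω

/-- A smooth vector field compactly supported in `Ω`. -/
def IsTestVF (Ω : Set ℂ) (X : ℂ → ℂ) : Prop :=
  ContDiff ℝ (⊤ : ℕ∞) X ∧ HasCompactSupport X ∧ tsupport X ⊆ Ω

/-- `du` is the weak (distributional) differential of `u` on `Ω`. -/
def IsWeakDeriv (Ω : Set ℂ) (u : ℂ → ℂ) (du : ℂ → ℂ →L[ℝ] ℂ) : Prop :=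
  ∀ φ : ℂ → ℝ, IsTest Ω φ → ∀ w : ℂ,
    (∫ z in Ω, fderiv ℝ φ z w • u z) = -∫ z in Ω, φ z • du z w

/-- `u ∈ W^{1,p}(Ω,S¹)`, with weak differential `du`: `u` is an `S¹`-valued map
(`|u| = 1` a.e.) with `|du| ∈ L^p(Ω)`. -/
def MemW1pS1 (p : ℝ) (Ω : Set ℂ) (u : ℂ → ℂ) (du : ℂ → ℂ →L[ℝ] ℂ) : Prop :=
  (∀ᵐ z ∂(volume.restrict Ω), ‖u z‖ = 1) ∧
  AEStronglyMeasurable u (volume.restrict Ω) ∧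
  AEStronglyMeasurable du (volume.restrict Ω) ∧
  Integrable (fun z => hsNorm (du z) ^ p) (volume.restrict Ω) ∧
  IsWeakDeriv Ω u du

/-- The basis `(1, i)` of `ℂ` over `ℝ`. -/
def cb : Fin 2 → ℂ := ![1, Complex.I]

/-- `u` is weakly `p`-harmonic on `Ω`: `div(|du|^{p-2} ju) = 0` distributionally. -/
def WeaklyPHarm (p : ℝ) (Ω : Set ℂ) (u : ℂ → ℂ) (du : ℂ → ℂ →L[ℝ] ℂ) : Prop :=
  ∀ ψ : ℂ → ℝ, IsTest Ω ψ →
    (∫ z in Ω, hsNorm (du z) ^ (p - 2) *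
      ∑ i : Fin 2, jform u du z (cb i) * fderiv ℝ ψ z (cb i)) = 0

/-- `u` is stationary `p`-harmonic on `Ω`: weakly `p`-harmonic and critical for inner
variations, `∫ |du|^p div X - p |du|^{p-2} ⟨du^* du, ∇X⟩ = 0` for every smooth
compactly supported vector field `X`. -/
def StatPHarm (p : ℝ) (Ω : Set ℂ) (u : ℂ → ℂ) (du : ℂ → ℂ →L[ℝ] ℂ) : Prop :=
  WeaklyPHarm p Ω u du ∧
  ∀ X : ℂ → ℂ, IsTestVF Ω X →
    (∫ z in Ω,
      (hsNorm (du z) ^ p * ∑ i : Fin 2, rinner (cb i) (fderiv ℝ X z (cb i)) -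
        p * hsNorm (du z) ^ (p - 2) *
          ∑ i : Fin 2, ∑ j : Fin 2,
            rinner (du z (cb i)) (du z (cb j)) * rinner (cb j) (fderiv ℝ X z (cb i)))) = 0

/-- The singular set of `u` in `Ω`: the set of points of `Ω` near which `u` fails
to be `C¹`. -/
def SingSet (Ω : Set ℂ) (u : ℂ → ℂ) : Set ℂ :=
  {x ∈ Ω | ¬∃ V ∈ 𝓝 x, ContDiffOn ℝ 1 u V}

end
open scoped Real
notation:max "nb" a:max b:max => ‖a - b‖
notation:max "na" a:max b:max => ‖a b‖
notation:max "sp" a:max => (2 - a)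
notation:max "lN" => (by linarith)
notation:max "pV" => (by positivity)
notation:max "nU" => (by norm_num)
notation:max "zR" => (0 : ℝ)
notation:max "zC" => (0 : ℂ)
notation:max "nN" => (norm_nonneg _)
notation:max "fP" => (by fun_prop)
notation:max "pc" a:max => (a / (a - 1))
notation:max "pm" a:max => (a - 2)
notation:max "cR" a:max => (a : ℝ)
notation:max "eF" => Eventually.of_forall
lemma mL {a b c : ℝ} (h : b ≤ c) (ha : 0 ≤ a) : a * b ≤ a * c := mul_le_mul_of_nonneg_left h ha


notation "⟪" a ", " b "⟫" => inner ℝ a b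

noncomputable section

lemma inC (a b : ℂ) : ⟪a, b⟫ = a.re * b.re + a.im * b.im := by
  rw [Complex.inner]; simp [Complex.mul_re]; ring

def eta (s : ℝ) : ℝ := Real.smoothTransition ((4 - s) / 3)
def pe (s : ℝ) : ℝ := -deriv eta s

lemma eta_smooth : ContDiff ℝ (⊤ : ℕ∞) eta :=
  Real.smoothTransition.contDiff.comp fP
lemma eta_one {s : ℝ} (h : s ≤ 1) : eta s = 1 := Real.smoothTransition.one_of_one_le lN
lemma eta_zero {s : ℝ} (h : 4 ≤ s) : eta s = 0 := Real.smoothTransition.zero_of_nonpos lN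
lemma eta_nonneg (s : ℝ) : 0 ≤ eta s := Real.smoothTransition.nonneg _
lemma eta_le_one (s : ℝ) : eta s ≤ 1 := Real.smoothTransition.le_one _
lemma eta_anti : Antitone eta := fun a b h => Real.smoothTransition.monotone lN
lemma eta_diff : Differentiable ℝ eta := eta_smooth.differentiable (by simp)
lemma eta_hd (s : ℝ) : HasDerivAt eta (-pe s) s := by
  simpa [pe] using (eta_diff s).hasDerivAt
lemma pe_nonneg (s : ℝ) : 0 ≤ pe s := by
  have := eta_anti.deriv_nonpos (x := s); simp only [pe]; linarith
lemma pe_left {s : ℝ} (h : s ≤ 1) : pe s = 0 := by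
  have : IsLocalMax eta s := eF fun t => by rw [eta_one h]; exact eta_le_one t
  simp [pe, this.deriv_eq_zero]
lemma pe_right {s : ℝ} (h : 4 ≤ s) : pe s = 0 := by
  have : IsLocalMin eta s := eF fun t => by rw [eta_zero h]; exact eta_nonneg t
  simp [pe, this.deriv_eq_zero]
lemma pe_cont : Continuous pe := (eta_smooth.continuous_deriv (by simp)).neg
lemma pe_cs : HasCompactSupport pe :=
  HasCompactSupport.intro (isCompact_Icc (a := (1 : ℝ)) (b := 4)) fun x hx => by
    by_cases h : x ≤ 1
    · exact pe_left h
    · exact pe_right (by by_contra h'; exact hx ⟨by linarith, by linarith⟩)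
lemma pe_bdd : ∃ C : ℝ, 1 ≤ C ∧ ∀ s, pe s ≤ C := by
  obtain ⟨C, hC⟩ := pe_cs.exists_bound_of_continuous pe_cont
  exact ⟨max C 1, le_max_right _ _, fun s => ((le_abs_self _).trans (hC s)).trans (le_max_left _ _)⟩
def Ck : ℝ := 8 * pe_bdd.choose
lemma Ck_ge : 8 ≤ Ck := by have := pe_bdd.choose_spec.1; unfold Ck; linarith
lemma pe_le (s : ℝ) : 8 * pe s ≤ Ck := by have := pe_bdd.choose_spec.2 s; unfold Ck; linarith
lemma Ck_pos : 0 < Ck := by linarith [Ck_ge]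

def Hc (y : ℂ) (r : ℝ) (z : ℂ) : ℝ := eta (nb z y ^ 2 / r ^ 2)
def Pc (y : ℂ) (r : ℝ) (z : ℂ) : ℝ := 2 / r ^ 2 * pe (nb z y ^ 2 / r ^ 2)

variable {y z : ℂ} {r : ℝ}
lemma Hc_smooth : ContDiff ℝ (⊤ : ℕ∞) (Hc y r) :=
  eta_smooth.comp (((contDiff_id.sub contDiff_const).norm_sq ℝ).div_const _)
lemma Hc_cont : Continuous (Hc y r) := Hc_smooth.continuous
lemma Hc_nonneg : 0 ≤ Hc y r z := eta_nonneg _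
lemma Hc_le : Hc y r z ≤ 1 := eta_le_one _
lemma Hc_one (hr : 0 < r) (h : nb z y ≤ r) : Hc y r z = 1 :=
  eta_one (by rw [div_le_one pV]; gcongr)
lemma Hc_zero (hr : 0 < r) (h : 2 * r ≤ nb z y) : Hc y r z = 0 :=
  eta_zero (by rw [le_div_iff₀ pV]; nlinarith)
lemma Hc_lt (hr : 0 < r) (h : Hc y r z ≠ 0) : nb z y < 2 * r := by
  by_contra h'; exact h (Hc_zero hr lN)
lemma Hc_ts (hr : 0 < r) : tsupport (Hc y r) ⊆ closedBall y (2 * r) :=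
  closure_minimal (fun z hz => by
    rw [mem_closedBall, dist_eq_norm]; exact (Hc_lt hr hz).le) isClosed_closedBall
lemma Hc_cs (hr : 0 < r) : HasCompactSupport (Hc y r) :=
  (isCompact_closedBall y (2 * r)).of_isClosed_subset (isClosed_tsupport _) (Hc_ts hr)
lemma Hc_anti {s : ℝ} (hr : 0 < r) (h : r ≤ s) : Hc y r z ≤ Hc y s z :=
  eta_anti (by gcongr)

lemma Pc_cont : Continuous (Pc y r) := by
  unfold Pc; exact continuous_const.mul (pe_cont.comp fP)
lemma Pc_nonneg : 0 ≤ Pc y r z := mul_nonneg pV (pe_nonneg _)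
lemma Pc_supp (hr : 0 < r) (h : Pc y r z ≠ 0) : r < nb z y ∧ nb z y < 2 * r := by
  constructor
  · by_contra h'
    exact h (by rw [Pc, pe_left, mul_zero]; rw [div_le_one pV]; push Not at h'; gcongr)
  · by_contra h'
    exact h (by
      rw [Pc, pe_right, mul_zero]; rw [le_div_iff₀ pV]; push Not at h'; nlinarith)
lemma Pc_ts (hr : 0 < r) : tsupport (Pc y r) ⊆ {z | r ≤ nb z y ∧ nb z y ≤ 2 * r} :=
  closure_minimal (fun z hz => ⟨(Pc_supp hr hz).1.le, (Pc_supp hr hz).2.le⟩)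
    (IsClosed.inter (s₂ := {z | nb z y ≤ 2 * r}) (s₁ := {z | r ≤ nb z y})
      (isClosed_le fP fP) (isClosed_le fP fP))
lemma Pc_cs (hr : 0 < r) : HasCompactSupport (Pc y r) :=
  (isCompact_closedBall y (2 * r)).of_isClosed_subset (isClosed_tsupport _) fun z hz => by
    rw [mem_closedBall, dist_eq_norm]; exact (Pc_ts hr hz).2
lemma Pc_le (hr : 0 < r) : Pc y r z ≤ Ck / r ^ 2 := by
  rw [Pc, div_mul_eq_mul_div]; gcongr; linarith [pe_le (nb z y ^ 2 / r ^ 2), pe_nonneg (nb z y ^ 2 / r ^ 2)]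
notation:70 "Pq" y:max r:max z:max => Pc y r z * ‖z - y‖ ^ 2
notation:max "Hd" y:max r:max s:max z:max => (Hc y r z - Hc y s z)
notation:max "jt" J:max z:max w:max y:max => ⟪J z, Complex.I * (w - y)⟫
lemma Pc_mul_le (hr : 0 < r) : Pq y r z ≤ Ck := by
  by_cases h : Pc y r z = 0
  · rw [h, zero_mul]; exact Ck_pos.le
  have h1 := (Pc_supp hr h).2
  have h2 : nb z y ^ 2 ≤ 4 * r ^ 2 := by nlinarith [norm_nonneg (z - y)]
  calc Pq y r z ≤ Pc y r z * (4 * r ^ 2) := by gcongr; exact Pc_nonneg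
    _ = 8 * pe (nb z y ^ 2 / r ^ 2) := by rw [Pc]; field_simp; ring
    _ ≤ _ := pe_le _
lemma Hc_fd (hr : 0 < r) : HasFDerivAt (Hc y r) (-(Pc y r z) • innerSL ℝ (z - y)) z := by
  have h1 : HasFDerivAt (fun z => nb z y ^ 2) (2 • innerSL ℝ (z - y)) z := by
    exact (hasStrictFDerivAt_norm_sq (z - y)).hasFDerivAt.comp z ((hasFDerivAt_id z).sub_const y)
  have h2 : HasFDerivAt (fun z => nb z y ^ 2 / r ^ 2) ((r ^ 2)⁻¹ • (2 • innerSL ℝ (z - y))) z := by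
    simpa only [div_eq_mul_inv] using h1.mul_const _
  have := (eta_hd (nb z y ^ 2 / r ^ 2)).comp_hasFDerivAt z h2
  refine this.congr_fderiv ?_
  ext v; simp [Pc]; ring
lemma Hc_fderiv (hr : 0 < r) (v : ℂ) : fderiv ℝ (Hc y r) z v = -(Pc y r z) * ⟪z - y, v⟫ := by
  rw [(Hc_fd hr).fderiv]; rfl
lemma Hc_dr (hr : 0 < r) : HasDerivAt (fun r => Hc y r z) (Pc y r z * nb z y ^ 2 / r) r := by
  have h2 : HasDerivAt (fun r => nb z y ^ 2 / r ^ 2) (-(2 * nb z y ^ 2 / r ^ 3)) r := by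
    have := (hasDerivAt_const r (nb z y ^ 2)).div (hasDerivAt_pow 2 r) pV
    refine this.congr_deriv ?_
    simp; field_simp
  refine ((eta_hd (nb z y ^ 2 / r ^ 2)).comp r h2).congr_deriv ?_
  rw [Pc]; field_simp
lemma integral_radial (f : ℝ → ℝ) : ∫ z : ℂ, f nb z y = 2 * π * ∫ t in Ioi zR, t * f t := by
  rw [integral_sub_right_eq_self (fun z => f ‖z‖) y, integral_fun_norm_addHaar volume f]
  simp [Measure.real, Complex.volume_ball, mul_assoc]
lemma Pc_int (hr : 0 < r) : ∫ z, Pc y r z = 2 * π := by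
  have := integral_radial (y := y) (fun t => 2 / r ^ 2 * pe (t ^ 2 / r ^ 2))
  simp only [Pc]; rw [this]
  have h2 (t : ℝ) : HasDerivAt (fun t => -eta (t ^ 2 / r ^ 2)) (t * (2 / r ^ 2 * pe (t ^ 2 / r ^ 2))) t := by
    have := ((eta_hd (t ^ 2 / r ^ 2)).comp t ((hasDerivAt_pow 2 t).div_const _)).neg
    refine this.congr_deriv ?_
    simp; ring
  have h0 : ∀ t, 2 * r ≤ t → 4 ≤ t ^ 2 / r ^ 2 := fun t ht => by
    rw [le_div_iff₀ pV]; nlinarith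
  rw [integral_Ioi_of_hasDerivAt_of_tendsto (h2 0).continuousAt.continuousWithinAt (fun t _ => h2 t)
    (m := 0)]
  · simp [eta_one]
  · have hc : Continuous fun t : ℝ => t * (2 / r ^ 2 * pe (t ^ 2 / r ^ 2)) :=
      continuous_id.mul (continuous_const.mul (pe_cont.comp fP))
    refine Integrable.integrableOn (hc.integrable_of_hasCompactSupport ?_)
    refine HasCompactSupport.intro (isCompact_Icc (a := -(2 * r)) (b := 2 * r)) fun t ht => ?_
    rw [pe_right]; · simp
    rw [le_div_iff₀ pV]
    by_contra h'
    have := abs_lt_of_sq_lt_sq (a := t) (b := 2 * r) lN lN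
    exact ht ⟨(abs_lt.1 this).1.le, (abs_lt.1 this).2.le⟩
  · refine tendsto_const_nhds.congr' ?_
    filter_upwards [eventually_ge_atTop (2 * r)] with t ht
    rw [eta_zero (h0 t ht), neg_zero]

/-- continuous compactly supported weight times integrable -/
lemma icc {E : Type*} [NormedAddCommGroup E] [NormedSpace ℝ E] {c : ℂ → ℝ} {f : ℂ → E} (hf : Integrable f) (hc : Continuous c)
    (hs : HasCompactSupport c) : Integrable (fun z => c z • f z) := by
  obtain ⟨C, hC⟩ := hs.exists_bound_of_continuous hc
  exact hf.bdd_smul C hc.aestronglyMeasurable (eF hC)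
lemma icm {c f : ℂ → ℝ} (hf : Integrable f) (hc : Continuous c)
    (hs : HasCompactSupport c) : Integrable (fun z => c z * f z) := icc hf hc hs

/-- derivative in the radius -/
lemma dI {k : ℂ → ℝ} (hk : Integrable k) (hr : 0 < r) :
    HasDerivAt (fun r => ∫ z, Hc y r z * k z) ((∫ z, Pq y r z * k z) / r) r := by
  have hP : ∀ x : ℝ, 0 < x → Integrable (fun z => Pq y x z * k z) := fun x hx =>
    icm hk (Pc_cont.mul fP) (Pc_cs hx).mul_right
  have := (hasDerivAt_integral_of_dominated_loc_of_deriv_le (μ := volume) (s := Ioi (r / 2))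
    (F := fun r z => Hc y r z * k z) (x₀ := r) (F' := fun r z => Pc y r z * nb z y ^ 2 / r * k z)
    (bound := fun z => 2 * Ck / r * |k z|) (Ioi_mem_nhds lN)
    (eF fun x => Hc_cont.aestronglyMeasurable.mul hk.1) (icm hk Hc_cont (Hc_cs hr))
    (((hP r hr).div_const r).1.congr (eF fun z => by ring))
    (eF fun z x hx => ?_) (hk.abs.const_mul _)
    (eF fun z x hx => (Hc_dr (by simp at hx; linarith)).mul_const _)).2
  · refine this.congr_deriv ?_
    rw [← integral_div]; congr 1; ext z; ring
  · simp only [mem_Ioi] at hx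
    have hx0 : 0 < x := by linarith
    rw [norm_mul, Real.norm_eq_abs, Real.norm_eq_abs]
    gcongr
    rw [abs_of_nonneg (div_nonneg (mul_nonneg Pc_nonneg pV) hx0.le), div_le_div_iff₀ hx0 hr]
    have := Pc_mul_le (y := y) (z := z) hx0
    nlinarith [Ck_pos]
end

open MeasureTheory Metric Filter Topology Set
open scoped ENNReal NNReal Convolution
noncomputable section

def rho (n : ℕ) : ContDiffBump zC where
  rIn := 1 / (2 * (cR n + 1))
  rOut := 1 / (cR n + 1)
  rIn_pos := by positivity
  rIn_lt_rOut := by apply one_div_lt_one_div_of_lt <;> linarith [n.cast_nonneg (α := ℝ)]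
def rn (n : ℕ) : ℂ → ℝ := (rho n).normed volume
def en (n : ℕ) : ℝ := 1 / (cR n + 1)
def mol {E : Type*} [NormedAddCommGroup E] [NormedSpace ℝ E] (n : ℕ) (f : ℂ → E) : ℂ → E :=
  rn n ⋆[ContinuousLinearMap.lsmul ℝ ℝ, volume] f

lemma en_pos (n : ℕ) : 0 < en n := by unfold en; positivity
lemma en_tend : Tendsto en atTop (𝓝 0) := tendsto_one_div_add_atTop_nhds_zero_nat
lemma en_ev {a : ℝ} (h : 0 < a) : ∀ᶠ n in atTop, en n < a := en_tend.eventually_lt_const h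
lemma rn_smooth (n) : ContDiff ℝ (⊤ : ℕ∞) (rn n) := (rho n).contDiff_normed
lemma rn_cont (n) : Continuous (rn n) := (rn_smooth n).continuous
lemma rn_cs (n) : HasCompactSupport (rn n) := (rho n).hasCompactSupport_normed
lemma rn_nonneg (n z) : 0 ≤ rn n z := (rho n).nonneg_normed z
lemma rn_int (n) : ∫ z, rn n z = 1 := (rho n).integral_normed
lemma rn_ts (n) : tsupport (rn n) = closedBall 0 (en n) := (rho n).tsupport_normed_eq
lemma rn_zero {n z} (h : en n < ‖z‖) : rn n z = 0 :=
  image_eq_zero_of_notMem_tsupport (by rw [rn_ts]; simpa using h)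
lemma rn_le (n z) : rn n z ≤ 2 * (en n ^ 2)⁻¹ := by
  refine ((rho n).normed_le_div_measure_closedBall_rIn volume z).trans ?_
  have h : (rho n).rIn = en n / 2 := by simp [rho, en]; ring
  have e := en_pos n
  rw [h, Measure.real, Complex.volume_closedBall]
  simp only [ENNReal.toReal_mul, ENNReal.toReal_pow, ENNReal.toReal_ofReal (by positivity : 0 ≤ en n / 2)]
  simp only [ENNReal.coe_toReal, NNReal.coe_real_pi]
  rw [div_le_iff₀ pV]
  field_simp
  linarith [Real.pi_gt_three]

section
variable {E : Type*} [NormedAddCommGroup E] [NormedSpace ℝ E]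
lemma mol_eq (n) (f : ℂ → E) (z) : mol n f z = ∫ t, rn n (z - t) • f t := by
  simp only [mol]; rw [convolution_eq_swap]; rfl
lemma rz_cs (n) (z : ℂ) : HasCompactSupport fun t => rn n (z - t) :=
  (rn_cs n).comp_homeomorph (Homeomorph.subLeft z)
lemma rz_cont (n) (z : ℂ) : Continuous fun t => rn n (z - t) := (rn_cont n).comp fP
lemma mol_i {f : ℂ → E} (hf : Integrable f) (n z) : Integrable fun t => rn n (z - t) • f t :=
  icc hf (rz_cont n z) (rz_cs n z)
lemma rz_int (n) (z : ℂ) : ∫ t, rn n (z - t) = 1 := by rw [integral_sub_left_eq_self (rn n) _ z, rn_int]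
lemma rn_i (n) : Integrable (rn n) := (rn_cont n).integrable_of_hasCompactSupport (rn_cs n)
lemma mol_integrable {f : ℂ → E} (hf : Integrable f) (n) : Integrable (mol n f) :=
  (rn_i n).integrable_convolution _ hf
lemma mol_int [CompleteSpace E] {f : ℂ → E} (hf : Integrable f) (n) : ∫ z, mol n f z = ∫ z, f z := by
  rw [mol, integral_convolution _ (rn_i n) hf, rn_int]; simp
lemma mol_smooth {f : ℂ → E} (hf : Integrable f) (n) : ContDiff ℝ (⊤ : ℕ∞) (mol n f) :=
  (rn_cs n).contDiff_convolution_left _ (rn_smooth n) hf.locallyIntegrable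
lemma mol_fd [CompleteSpace E] {f : ℂ → E} (hf : Integrable f) (n z v) :
    fderiv ℝ (mol n f) z v = ∫ t, fderiv ℝ (rn n) (z - t) v • f t := by
  have h := (rn_cs n).hasFDerivAt_convolution_left (ContinuousLinearMap.lsmul ℝ ℝ)
    ((rn_smooth n).of_le (by simp)) hf.locallyIntegrable z
  have e : fderiv ℝ (mol n f) z = _ := h.fderiv
  have hc : Continuous (fderiv ℝ (rn n)) := (rn_smooth n).continuous_fderiv (by simp)
  have hi := (((rn_cs n).fderiv ℝ).convolutionExists_left
    ((ContinuousLinearMap.lsmul ℝ ℝ).precompL ℂ : _ →L[ℝ] E →L[ℝ] _) hc hf.locallyIntegrable z).integrable_swap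
  rw [e, convolution_eq_swap, ContinuousLinearMap.integral_apply hi]
  rfl
lemma mol_ae [CompleteSpace E] {f : ℂ → E} (hf : Integrable f) : ∀ᵐ z, Tendsto (fun n => mol n f z) atTop (𝓝 (f z)) :=
  ContDiffBump.ae_convolution_tendsto_right_of_locallyIntegrable (φ := rho) (K := 2) en_tend
    (eF fun n => by simp only [rho]; field_simp; norm_num) hf.locallyIntegrable
lemma mol_norm {f : ℂ → E} (hf : Integrable f) (n z) : ‖mol n f z‖ ≤ mol n (fun t => na f t) z := by
  rw [mol_eq, mol_eq]
  refine (norm_integral_le_integral_norm _).trans (le_of_eq (integral_congr_ae (eF fun t => ?_)))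
  simp [norm_smul, abs_of_nonneg (rn_nonneg n _)]
end

lemma tangent {m x r : ℝ} (hm : 0 < m) (hx : 0 ≤ x) (hr : 1 ≤ r) :
    m ^ r + r * m ^ (r - 1) * (x - m) ≤ x ^ r := by
  have h := one_add_mul_self_le_rpow_one_add (s := x / m - 1) (by have : 0 ≤ x / m := by positivity
                                                                  linarith) hr
  have h2 : (1 + (x / m - 1)) = x / m := by ring
  rw [h2, Real.div_rpow hx hm.le, le_div_iff₀ pV] at h
  rw [Real.rpow_sub_one hm.ne']
  calc _ = _ := by field_simp
    _ ≤ _ := h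

lemma mol_jensen {f : ℂ → ℝ} (h0 : ∀ z, 0 ≤ f z) (hf : Integrable f) {r : ℝ} (hr : 1 ≤ r)
    (hfr : Integrable fun z => f z ^ r) (n z) : (mol n f z) ^ r ≤ mol n (fun t => f t ^ r) z := by
  set m := mol n f z with hm
  rw [mol_eq] at hm
  have hm0 : 0 ≤ m := by rw [hm]; exact integral_nonneg fun t => mul_nonneg (rn_nonneg _ _) (h0 t)
  have hR : 0 ≤ mol n (fun t => f t ^ r) z := by
    rw [mol_eq]; exact integral_nonneg fun t => mul_nonneg (rn_nonneg _ _) (by have := h0 t; positivity)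
  rcases hm0.eq_or_lt with h | h
  · rw [← h, Real.zero_rpow lN]; exact hR
  rw [mol_eq]
  have hi : Integrable (fun t => rn n (z - t)) := (rz_cont n z).integrable_of_hasCompactSupport (rz_cs n z)
  have this : ∀ t, rn n (z - t) * (m ^ r + r * m ^ (r - 1) * (f t - m))
      = (m ^ r - r * m ^ (r - 1) * m) * rn n (z - t) + r * m ^ (r - 1) * (rn n (z - t) • f t) := fun t => by
        simp only [smul_eq_mul]; ring
  have e : ∫ t, rn n (z - t) * (m ^ r + r * m ^ (r - 1) * (f t - m)) = m ^ r := by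
    simp_rw [this]
    rw [integral_add (hi.const_mul _) ((mol_i hf n z).const_mul _), integral_const_mul, integral_const_mul,
      rz_int, ← hm]; ring
  rw [← e]
  refine integral_mono ?_ (mol_i hfr n z) fun t => ?_
  · simp_rw [this]; exact (hi.const_mul _).add ((mol_i hf n z).const_mul _)
  · exact mL (tangent h (h0 t) hr) (rn_nonneg _ _)

/-- generalized dominated convergence -/
lemma pratt {f h : ℕ → ℂ → ℝ} {k : ℂ → ℝ} (h0 : ∀ n, ∀ᵐ z, 0 ≤ f n z) (hfh : ∀ n, ∀ᵐ z, f n z ≤ h n z)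
    (hf : ∀ n, Integrable (f n)) (hh : ∀ n, Integrable (h n)) (hk : Integrable k)
    (hft : ∀ᵐ z, Tendsto (f · z) atTop (𝓝 0)) (hht : ∀ᵐ z, Tendsto (h · z) atTop (𝓝 (k z)))
    (hi : ∀ n, ∫ z, h n z = ∫ z, k z) : Tendsto (fun n => ∫ z, f n z) atTop (𝓝 0) := by
  have hk0 : ∀ᵐ z, 0 ≤ k z := by
    filter_upwards [hht, ae_all_iff.2 h0, ae_all_iff.2 hfh] with z a b c
    exact ge_of_tendsto' a fun n => (b n).trans (c n)
  have i1 : ∀ n, Integrable fun z => max (k z - h n z) 0 := fun n => (hk.sub (hh n)).pos_part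
  have i2 : ∀ n, Integrable fun z => min (f n z) (k z) := fun n => (hf n).inf hk
  have t1 : Tendsto (fun n => ∫ z, max (k z - h n z) 0) atTop (𝓝 (∫ _ : ℂ, zR)) := by
    refine tendsto_integral_of_dominated_convergence k (fun n => (i1 n).1) hk (fun n => ?_) ?_
    · filter_upwards [hk0, h0 n, hfh n] with z a b c
      rw [Real.norm_eq_abs, abs_of_nonneg (le_max_right _ _)]; exact max_le lN a
    · filter_upwards [hht] with z a
      simpa using (tendsto_const_nhds (x := k z)).sub a |>.max (tendsto_const_nhds (x := zR))
  have t2 : Tendsto (fun n => ∫ z, min (f n z) (k z)) atTop (𝓝 (∫ _ : ℂ, zR)) := by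
    refine tendsto_integral_of_dominated_convergence k (fun n => (i2 n).1) hk (fun n => ?_) ?_
    · filter_upwards [hk0, h0 n] with z a b
      rw [Real.norm_eq_abs, abs_of_nonneg (le_min b a)]; exact min_le_right _ _
    · filter_upwards [hft, hk0] with z a b
      simpa [b] using a.min (tendsto_const_nhds (x := k z))
  have t3 := (t1.const_mul 1).add t2
  simp only [integral_zero, mul_zero, add_zero] at t3
  refine squeeze_zero (fun n => integral_nonneg_of_ae (h0 n)) (fun n => ?_) t3
  have : ∫ z, f n z ≤ ∫ z, ((h n z - k z) + max (k z - h n z) 0 + min (f n z) (k z)) := by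
    refine integral_mono_ae (hf n) ((((hh n).sub hk).add (i1 n)).add (i2 n)) ?_
    filter_upwards [h0 n, hfh n] with z a b
    rcases le_total (f n z) (k z) with c | c
    · rw [min_eq_left c]; linarith [le_max_left (k z - h n z) 0]
    · rw [min_eq_right c]; linarith [le_max_right (k z - h n z) 0]
  refine this.trans (le_of_eq ?_)
  have i3 : Integrable fun z => h n z - k z := (hh n).sub hk
  have i4 : Integrable fun z => h n z - k z + max (k z - h n z) 0 := i3.add (i1 n)
  rw [integral_add i4 (i2 n), integral_add i3 (i1 n),
    integral_sub (hh n) hk, hi n]; ring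

lemma rpow_add_le {a b r : ℝ} (ha : 0 ≤ a) (hb : 0 ≤ b) (hr : 0 ≤ r) : (a + b) ^ r ≤ 2 ^ r * (a ^ r + b ^ r) := by
  wlog h : a ≤ b generalizing a b
  · rw [add_comm, add_comm (a ^ r)]; exact this hb ha lN
  calc (a + b) ^ r ≤ (2 * b) ^ r := by gcongr; linarith
    _ = 2 ^ r * b ^ r := Real.mul_rpow nU hb
    _ ≤ _ := by have : 0 ≤ a ^ r := by positivity
                gcongr; linarith

lemma mol_conv {f : ℂ → ℂ} (hf : Integrable f) {r : ℝ} (hr : 1 ≤ r)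
    (hfr : Integrable fun z => na f z ^ r) :
    (∀ n, Integrable fun z => ‖mol n f z - f z‖ ^ r) ∧
    Tendsto (fun n => ∫ z, ‖mol n f z - f z‖ ^ r) atTop (𝓝 0) := by
  have hd : ∀ n z, ‖mol n f z - f z‖ ^ r ≤ 2 ^ r * (mol n (fun z => na f z ^ r) z + na f z ^ r) := fun n z => by
    have h1 : ‖mol n f z‖ ^ r ≤ mol n (fun z => na f z ^ r) z :=
      (Real.rpow_le_rpow nN (mol_norm hf n z) lN).trans
        (mol_jensen (fun z => norm_nonneg _) hf.norm hr hfr n z)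
    calc _ ≤ (‖mol n f z‖ + na f z) ^ r := by gcongr; exact norm_sub_le _ _
      _ ≤ 2 ^ r * (‖mol n f z‖ ^ r + na f z ^ r) := rpow_add_le nN nN lN
      _ ≤ _ := by gcongr
  have hH : ∀ n, Integrable fun z => 2 ^ r * (mol n (fun z => na f z ^ r) z + na f z ^ r) :=
    fun n => ((mol_integrable hfr n).add hfr).const_mul _
  have hI : ∀ n, Integrable fun z => ‖mol n f z - f z‖ ^ r := fun n =>
    (hH n).mono' (((mol_integrable hf n).sub hf).1.norm.aemeasurable.pow_const r).aestronglyMeasurable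
      (eF fun z => by
        rw [Real.norm_eq_abs, abs_of_nonneg pV]; exact hd n z)
  refine ⟨hI, pratt (k := fun z => 2 ^ r * (na f z ^ r + na f z ^ r))
    (fun n => eF fun z => by positivity) (fun n => eF (hd n)) hI hH
    ((hfr.add hfr).const_mul _) ?_ ?_ fun n => ?_⟩
  · filter_upwards [mol_ae hf] with z hz
    have := (tendsto_iff_norm_sub_tendsto_zero.1 hz).rpow_const (p := r) (Or.inr lN)
    rwa [Real.zero_rpow lN] at this
  · filter_upwards [mol_ae hfr] with z hz
    exact (hz.add_const _).const_mul _
  · rw [integral_const_mul, integral_const_mul, integral_add (mol_integrable hfr n) hfr, mol_int hfr,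
      integral_add hfr hfr]
lemma mol_conv1 {f : ℂ → ℂ} (hf : Integrable f) : Tendsto (fun n => ∫ z, ‖mol n f z - f z‖) atTop (𝓝 0) := by
  have := (mol_conv hf le_rfl (by simpa using hf.norm)).2
  simpa using this
end

open MeasureTheory Metric Filter Topology Set
open scoped ENNReal NNReal Convolution
noncomputable section

lemma L1lim {K : Type*} [RCLike K] {f : ℕ → ℂ → K} {g a : ℂ → K} {C : ℝ} (hf : ∀ n, Integrable (f n)) (hg : Integrable g)
    (h : Tendsto (fun n => ∫ z, ‖f n z - g z‖) atTop (𝓝 0)) (ha : AEStronglyMeasurable a)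
    (hC : ∀ᵐ z, na a z ≤ C) : Tendsto (fun n => ∫ z, a z * f n z) atTop (𝓝 (∫ z, a z * g z)) := by
  rw [tendsto_iff_norm_sub_tendsto_zero]
  have h' := h.const_mul C
  rw [mul_zero] at h'
  refine squeeze_zero (fun n => norm_nonneg _) (fun n => ?_) h'
  have i1 := (hf n).bdd_mul ha hC
  have i2 := hg.bdd_mul ha hC
  rw [← integral_sub i1 i2, ← integral_const_mul]
  refine norm_integral_le_of_norm_le (((hf n).sub hg).norm.const_mul C) ?_
  filter_upwards [hC] with z hz
  rw [← mul_sub, norm_mul]; gcongr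

lemma mol_le_one {U : ℂ → ℂ} (hU : Integrable U) (h1 : ∀ᵐ z, na U z ≤ 1) (n z) : ‖mol n U z‖ ≤ 1 := by
  refine (mol_norm hU n z).trans ?_
  rw [mol_eq, ← rz_int n z]
  refine integral_mono_ae (mol_i hU.norm n z) ((rz_cont n z).integrable_of_hasCompactSupport (rz_cs n z)) ?_
  filter_upwards [h1] with t ht
  exact mul_le_of_le_one_right (rn_nonneg _ _) ht

lemma rz_test {n : ℕ} {z : ℂ} (hz : ‖z‖ + en n < 2) : IsTest (ball 0 2) fun t => rn n (z - t) := by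
  refine ⟨(rn_smooth n).comp fP, rz_cs n z, ?_⟩
  refine (closure_minimal (t := closedBall z (en n)) (fun t ht => ?_) isClosed_closedBall).trans fun t ht => ?_
  · rw [mem_closedBall, dist_comm, dist_eq_norm]
    by_contra h; exact ht (rn_zero lN)
  · simp only [mem_closedBall, mem_ball, dist_zero_right] at ht ⊢
    have := norm_le_norm_add_norm_sub' t z
    rw [dist_eq_norm, ] at ht; linarith
lemma rz_fd (n : ℕ) (z t v : ℂ) : fderiv ℝ (fun t => rn n (z - t)) t v = -fderiv ℝ (rn n) (z - t) v := by
  have h := ((((rn_smooth n).differentiable (by simp)) (z - t)).hasFDerivAt).comp t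
    ((hasFDerivAt_id t).const_sub z)
  have e : fderiv ℝ (fun t => rn n (z - t)) t = _ := h.fderiv
  rw [e]; simp

lemma weak_mol {U V : ℂ → ℂ} {w : ℂ} (hU : Integrable U)
    (hw : ∀ φ, IsTest (ball 0 2) φ → ∫ z, fderiv ℝ φ z w • U z = -∫ z, φ z • V z) {n : ℕ} {z : ℂ}
    (hz : ‖z‖ + en n < 2) : fderiv ℝ (mol n U) z w = mol n V z := by
  have := hw _ (rz_test hz)
  simp_rw [rz_fd, neg_smul] at this
  rw [integral_neg, neg_inj] at this
  rw [mol_fd hU, mol_eq, this]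

lemma test_ev {φ : ℂ → ℝ} (h : IsTest (ball 0 2) φ) : ∀ᶠ n in atTop, ∀ z ∈ tsupport φ, ‖z‖ + en n < 2 := by
  rcases (tsupport φ).eq_empty_or_nonempty with h0 | h0
  · simp [h0]
  obtain ⟨z0, hz0, hm⟩ := IsCompact.exists_isMaxOn h.2.1 h0 continuous_norm.continuousOn
  have h2 : ‖z0‖ < 2 := by simpa using h.2.2 hz0
  filter_upwards [en_ev (a := 2 - ‖z0‖) lN] with n hn z hz
  have : ‖z‖ ≤ ‖z0‖ := hm hz
  linarith

lemma int_fd_zero {φ : ℂ → ℝ} (h : IsTest (ball 0 2) φ) (w : ℂ) : ∫ z, fderiv ℝ φ z w = 0 := by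
  have hc : Continuous fun z => fderiv ℝ φ z w := (h.1.continuous_fderiv (by simp)).clm_apply continuous_const
  have hi : Integrable fun z => fderiv ℝ φ z w := hc.integrable_of_hasCompactSupport (h.2.1.fderiv_apply ℝ w)
  have := integral_mul_fderiv_eq_neg_fderiv_mul_of_integrable (μ := volume) (f := fun _ : ℂ => (1 : ℝ)) (g := φ) (v := w)
    (by simp) (by simpa using hi) (by simpa using h.1.continuous.integrable_of_hasCompactSupport h.2.1)
    (fun x _ => by fun_prop) (fun x _ => h.1.differentiable (by simp) x)
  simpa using this

lemma ortho {U V : ℂ → ℂ} {w : ℂ} (hU : Integrable U) (hV : Integrable V) (h1 : ∀ᵐ z, na U z ≤ 1)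
    (h2 : ∀ᵐ z, z ∈ ball zC 2 → na U z = 1)
    (hw : ∀ φ, IsTest (ball 0 2) φ → ∫ z, fderiv ℝ φ z w • U z = -∫ z, φ z • V z) :
    ∀ᵐ z, z ∈ ball zC 2 → ⟪U z, V z⟫ = 0 := by
  have iv : Integrable fun z => ⟪U z, V z⟫ := by
    refine hV.norm.mono' (hU.1.inner hV.1) ?_
    filter_upwards [h1] with z hz
    exact (norm_inner_le_norm _ _).trans (mul_le_of_le_one_left nN hz)
  refine isOpen_ball.ae_eq_zero_of_integral_contDiff_smul_eq_zero (iv.locallyIntegrable.locallyIntegrableOn _)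
    fun φ hφ hφc hφs => ?_
  have hT : IsTest (ball 0 2) φ := ⟨hφ, hφc, hφs⟩
  have hdc : Continuous fun z => fderiv ℝ φ z w := (hφ.continuous_fderiv (by simp)).clm_apply continuous_const
  have hdi : Integrable fun z => fderiv ℝ φ z w := hdc.integrable_of_hasCompactSupport (hφc.fderiv_apply ℝ w)
  have key (L : ℂ →L[ℝ] ℝ) (hL : ∀ z, na L z ≤ ‖z‖) : 2 * (∫ z, φ z * (L (U z) * L (V z))) =
      -∫ z, fderiv ℝ φ z w * (L (U z)) ^ 2 := by
    have lU := hU.1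
    have lV := hV.1
    have mU : AEStronglyMeasurable fun z => L (U z) := L.continuous.comp_aestronglyMeasurable lU
    have iV : Integrable fun z => L (V z) := L.integrable_comp hV
    have iU : Integrable fun z => L (U z) := L.integrable_comp hU
    have bU : ∀ᵐ z, ‖L (U z)‖ ≤ 1 := h1.mono fun z hz => (hL _).trans hz
    have real : ∀ᶠ n in atTop, ∫ z, (φ z * L (U z)) * L (mol n V z) + L (mol n U z) * (fderiv ℝ φ z w * L (U z))
        = -∫ z, L (mol n U z) * (φ z * L (V z)) := by
      filter_upwards [test_ev hT] with n hn
      have hs := mol_smooth hU n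
      have hd := hs.differentiable (by simp)
      have hψ : IsTest (ball 0 2) fun z => φ z * L (mol n U z) :=
        ⟨hφ.mul (L.contDiff.comp hs), hφc.mul_right, (tsupport_mul_subset_left).trans hφs⟩
      have h' := congrArg L (hw _ hψ)
      have j1 : Integrable fun z => fderiv ℝ (fun z => φ z * L (mol n U z)) z w • U z :=
        icc hU ((hψ.1.continuous_fderiv (by simp)).clm_apply continuous_const) (hψ.2.1.fderiv_apply ℝ w)
      have j2 : Integrable fun z => (φ z * L (mol n U z)) • V z := icc hV hψ.1.continuous hψ.2.1
      rw [← L.integral_comp_comm j1, map_neg, ← L.integral_comp_comm j2] at h'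
      simp only [map_smul, smul_eq_mul] at h'
      have h3 : ∫ z, L (mol n U z) * (φ z * L (V z)) = ∫ z, φ z * L (mol n U z) * L (V z) := by
        congr 1; ext z; ring
      rw [h3, ← h']
      congr 1; ext z
      have e : HasFDerivAt (fun z => φ z * L (mol n U z)) _ z :=
        ((hφ.differentiable (by simp)) z).hasFDerivAt.mul (L.hasFDerivAt.comp z (hd z).hasFDerivAt)
      rw [e.fderiv]
      by_cases hz : z ∈ tsupport φ
      · simp [weak_mol hU hw (hn z hz)]; ring
      · simp [image_eq_zero_of_notMem_tsupport hz]; ring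
    obtain ⟨C, hC⟩ := hφc.exists_bound_of_continuous hφ.continuous
    have iVn := fun n => L.integrable_comp (mol_integrable hV n)
    have mUn := fun n => L.continuous.comp_aestronglyMeasurable (mol_integrable hU n).1
    have bUn : ∀ n z, ‖L (mol n U z)‖ ≤ 1 := fun n z => (hL _).trans (mol_le_one hU h1 n z)
    have tL : Tendsto (fun n => ∫ z, ‖L (mol n V z) - L (V z)‖) atTop (𝓝 0) := by
      refine squeeze_zero (fun n => integral_nonneg fun z => norm_nonneg _) (fun n => ?_) (mol_conv1 hV)
      refine integral_mono ((iVn n).sub iV).norm ((mol_integrable hV n).sub hV).norm fun z => ?_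
      simpa using hL (mol n V z - V z)
    have bφ : ∀ᵐ z, ‖φ z * L (U z)‖ ≤ C := bU.mono fun z hz => by
      rw [norm_mul]; exact (mul_le_of_le_one_right nN hz).trans (hC z)
    have mφ : AEStronglyMeasurable fun z => φ z * L (U z) := hφ.continuous.aestronglyMeasurable.mul mU
    have T1 := L1lim iVn iV tL mφ bφ
    have dct {g : ℂ → ℝ} (hg : Integrable g) :
        Tendsto (fun n => ∫ z, L (mol n U z) * g z) atTop (𝓝 (∫ z, L (U z) * g z)) := by
      refine tendsto_integral_of_dominated_convergence (fun z => na g z) (fun n => (mUn n).mul hg.1) hg.norm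
        (fun n => eF fun z => ?_) ?_
      · rw [norm_mul]; exact mul_le_of_le_one_left nN (bUn n z)
      · filter_upwards [mol_ae hU] with z hz
        exact ((L.continuous.tendsto _).comp hz).mul_const _
    have i2 : Integrable fun z => fderiv ℝ φ z w * L (U z) := icm iU hdc (hφc.fderiv_apply ℝ w)
    have i3 : Integrable fun z => φ z * L (V z) := icm iV hφ.continuous hφc
    have T2 := dct i2
    have T3 := dct i3
    have := tendsto_nhds_unique ((T1.add T2).congr' ?_) T3.neg
    · have e1 : ∫ z, φ z * (L (U z) * L (V z)) = ∫ z, φ z * L (U z) * L (V z) := by congr 1; ext z; ring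
      have e2 : ∫ z, L (U z) * (φ z * L (V z)) = ∫ z, φ z * L (U z) * L (V z) := by congr 1; ext z; ring
      have e3 : ∫ z, fderiv ℝ φ z w * L (U z) ^ 2 = ∫ z, L (U z) * (fderiv ℝ φ z w * L (U z)) := by
        congr 1; ext z; ring
      rw [e1, e3]; rw [e2] at this; linarith
    · filter_upwards [real] with n hn
      rw [← hn, integral_add]
      · exact (iVn n).bdd_mul mφ bφ
      · exact i2.bdd_mul (mUn n) (eF (bUn n))
  have k1 := key Complex.reCLM fun z => Complex.abs_re_le_norm z
  have k2 := key Complex.imCLM fun z => Complex.abs_im_le_norm z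
  simp only [Complex.reCLM_apply, Complex.imCLM_apply] at k1 k2
  have b1 : ∀ᵐ z, ‖(U z).re‖ ≤ 1 := h1.mono fun z hz => (Complex.abs_re_le_norm _).trans hz
  have b2 : ∀ᵐ z, ‖(U z).im‖ ≤ 1 := h1.mono fun z hz => (Complex.abs_im_le_norm _).trans hz
  have s1 : ∀ {a : ℂ → ℝ} {L : ℂ → ℝ}, Continuous a → HasCompactSupport a → Integrable L → 
      Integrable (fun z => a z * ((U z).re * L z)) ∧ Integrable (fun z => a z * ((U z).im * L z)) := 
    fun ha hc hl => ⟨icm (hl.bdd_mul hU.re.1 b1) ha hc, icm (hl.bdd_mul hU.im.1 b2) ha hc⟩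
  have z0 : ∫ z, fderiv ℝ φ z w * ((U z).re * (U z).re) + fderiv ℝ φ z w * ((U z).im * (U z).im) = 0 := by
    rw [← int_fd_zero hT w]
    refine integral_congr_ae ?_
    filter_upwards [h2] with z hz
    by_cases h : z ∈ tsupport φ
    · have e := hz (hφs h)
      have : (U z).re * (U z).re + (U z).im * (U z).im = 1 := by
        rw [← Complex.normSq_apply, ← Complex.sq_norm, e]; norm_num
      rw [← mul_add, this, mul_one]
    · have : fderiv ℝ φ z = 0 := by
        have := mt (fun h => tsupport_fderiv_subset ℝ (f := φ) (subset_tsupport _ h)) h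
        simpa using this
      simp [this]
  have ure : Integrable fun z => (U z).re := hU.re
  have uim : Integrable fun z => (U z).im := hU.im
  have vre : Integrable fun z => (V z).re := hV.re
  have vim : Integrable fun z => (V z).im := hV.im
  rw [integral_add (s1 hdc (hφc.fderiv_apply ℝ w) ure).1 (s1 hdc (hφc.fderiv_apply ℝ w) uim).2] at z0
  simp only [pow_two] at k1 k2
  simp only [inC, smul_eq_mul, mul_add]
  rw [integral_add (s1 hφ.continuous hφc vre).1 (s1 hφ.continuous hφc vim).2]
  linarith
end

open MeasureTheory Metric Filter Topology Set
open scoped ENNReal NNReal Convolution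
noncomputable section

structure Dat (p : ℝ) (U J : ℂ → ℂ) : Prop where
  p1 : 3 / 2 < p
  p2 : p < 2
  mU : AEStronglyMeasurable U
  mJ : AEStronglyMeasurable J
  u1 : ∀ᵐ z, z ∈ ball zC 2 → na U z = 1
  u0 : ∀ z, z ∉ ball zC 2 → U z = 0
  j0 : ∀ z, z ∉ ball zC 2 → J z = 0
  iE : Integrable fun z => na J z ^ p
  weak : ∀ φ, IsTest (ball 0 2) φ → ∀ w : ℂ, ∫ z, fderiv ℝ φ z w • U z =
    -∫ z, φ z • (Complex.I * U z * ((⟪J z, w⟫ : ℝ) : ℂ))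
  pharm : ∀ ψ, IsTest (ball 0 2) ψ → ∫ z, na J z ^ pm p * fderiv ℝ ψ z (J z) = 0
  stat : ∀ X, IsTestVF (ball 0 2) X →
    ∫ z, (na J z ^ p * (⟪(1 : ℂ), fderiv ℝ X z 1⟫ + ⟪Complex.I, fderiv ℝ X z Complex.I⟫)
      - p * na J z ^ pm p * ⟪J z, fderiv ℝ X z (J z)⟫) = 0

def Fl (p : ℝ) (J : ℂ → ℂ) (z : ℂ) : ℂ := (na J z ^ pm p : ℝ) • J z
def Ie (p : ℝ) (J : ℂ → ℂ) (y : ℂ) (r : ℝ) : ℝ := ∫ z, Hc y r z * na J z ^ p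
def De (p : ℝ) (J : ℂ → ℂ) (y : ℂ) (r : ℝ) : ℝ := ∫ z, Pq y r z * na J z ^ p
def Rr (p : ℝ) (J : ℂ → ℂ) (y : ℂ) (r : ℝ) : ℝ := ∫ z, Pc y r z * (na J z ^ pm p * ⟪z - y, J z⟫ ^ 2)
def Th (p : ℝ) (J : ℂ → ℂ) (y : ℂ) (r : ℝ) : ℝ := r ^ pm p * Ie p J y r

lemma rp2 {p x : ℝ} (h : 0 < p) (hx : 0 ≤ x) : x ^ pm p * x ^ 2 = x ^ p := by
  rcases hx.eq_or_lt with h0 | h0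
  · subst h0; simp [Real.zero_rpow h.ne']
  · rw [← Real.rpow_natCast, ← Real.rpow_add h0]; congr 1; push_cast; ring
lemma rp1 {p x : ℝ} (h : 1 < p) (hx : 0 ≤ x) : x ^ pm p * x = x ^ (p - 1) := by
  rcases hx.eq_or_lt with h0 | h0
  · subst h0; simp [Real.zero_rpow (sub_ne_zero.2 h.ne')]
  · rw [← Real.rpow_add_one h0.ne']; congr 1; ring
lemma lin1 {x p : ℝ} (h : 1 ≤ p) (hx : 0 ≤ x) : x ≤ 1 + x ^ p := by
  rcases le_total x 1 with h1 | h1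
  · linarith [Real.rpow_nonneg hx p]
  · have := Real.rpow_le_rpow_of_exponent_le h1 h; rw [Real.rpow_one] at this; linarith

namespace Dat
variable {p : ℝ} {U J : ℂ → ℂ} (d : Dat p U J) {y : ℂ} {r : ℝ}
include d
omit d in
lemma iB : Integrable ((ball zC 2).indicator fun _ => (1 : ℝ)) := by
  rw [integrable_indicator_iff measurableSet_ball]; exact integrableOn_const measure_ball_lt_top.ne
lemma u2 : ∀ᵐ z, na U z ≤ 1 := d.u1.mono fun z hz => by
  by_cases h : z ∈ ball zC 2
  · exact (hz h).le
  · simp [d.u0 z h]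
lemma iU : Integrable U := iB.mono' d.mU <| d.u2.mono fun z hz => by
  by_cases h : z ∈ ball zC 2
  · simpa [indicator_of_mem h] using hz
  · simp [d.u0 z h, indicator_of_notMem h]
lemma iJ : Integrable J := (iB.add d.iE).mono' d.mJ <| eF fun z => by
  by_cases h : z ∈ ball zC 2
  · simpa [indicator_of_mem h] using lin1 (by linarith [d.p1]) (norm_nonneg (J z))
  · have : p ≠ 0 := by linarith [d.p1]
    simp [d.j0 z h, indicator_of_notMem h, Real.zero_rpow this]
lemma nF (z) : ‖Fl p J z‖ = na J z ^ (p - 1) := by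
  rw [Fl, norm_smul, Real.norm_of_nonneg pV, rp1 (by linarith [d.p1]) nN]
lemma mF : AEStronglyMeasurable (Fl p J) := by
  have : AEMeasurable fun z => na J z ^ pm p := d.mJ.norm.aemeasurable.pow_const _
  exact this.aestronglyMeasurable.smul d.mJ
lemma iF : Integrable (Fl p J) := (iB.add d.iE).mono' d.mF <| eF fun z => by
  have hp := d.p1
  rw [d.nF]
  by_cases h : z ∈ ball zC 2
  · simp only [Pi.add_apply, indicator_of_mem h]
    have := lin1 (x := na J z ^ (p - 1)) (p := p / (p - 1)) (by rw [le_div_iff₀] <;> linarith) pV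
    rwa [← Real.rpow_mul nN, mul_div_cancel₀ _ lN] at this
  · simp [d.j0 z h, indicator_of_notMem h, Real.zero_rpow (show p ≠ 0 by linarith), Real.zero_rpow (show p - 1 ≠ 0 by linarith)]
lemma nFq (z) : ‖Fl p J z‖ ^ pc p = na J z ^ p := by
  have hp := d.p1
  rw [d.nF, ← Real.rpow_mul nN, mul_div_cancel₀ _ lN]
lemma iFq : Integrable fun z => ‖Fl p J z‖ ^ pc p := by simp_rw [d.nFq]; exact d.iE
lemma mR : AEStronglyMeasurable fun z => na J z ^ pm p * ⟪z - y, J z⟫ ^ 2 := by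
  refine (AEMeasurable.aestronglyMeasurable (d.mJ.norm.aemeasurable.pow_const _)).mul ?_
  exact ((by fun_prop : Continuous fun z : ℂ => z - y).aestronglyMeasurable.inner d.mJ).pow 2
lemma Rle (z) : na J z ^ pm p * ⟪z - y, J z⟫ ^ 2 ≤ nb z y ^ 2 * na J z ^ p := by
  rw [← rp2 (p := p) (by linarith [d.p1]) (norm_nonneg (J z))]
  have h := abs_real_inner_le_norm (z - y) (J z)
  have h2 : ⟪z - y, J z⟫ ^ 2 ≤ (nb z y * na J z) ^ 2 := sq_le_sq' (by linarith [neg_abs_le ⟪z - y, J z⟫]) ((le_abs_self _).trans h)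
  calc _ ≤ na J z ^ pm p * (nb z y * na J z) ^ 2 := by gcongr
    _ = _ := by ring
lemma iH : Integrable fun z => Hc y r z * na J z ^ p :=
  d.iE.bdd_mul (c := 1) Hc_cont.aestronglyMeasurable (eF fun z => by
    rw [Real.norm_of_nonneg Hc_nonneg]; exact Hc_le)
lemma iP (hr : 0 < r) : Integrable fun z => Pq y r z * na J z ^ p :=
  icm d.iE (Pc_cont.mul fP) ((Pc_cs hr).mul_right)
lemma iR (hr : 0 < r) : Integrable fun z => Pc y r z * (na J z ^ pm p * ⟪z - y, J z⟫ ^ 2) :=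
  (d.iP (y := y) hr).mono' (Pc_cont.aestronglyMeasurable.mul d.mR) <| eF fun z => by
    rw [Real.norm_of_nonneg (mul_nonneg Pc_nonneg pV), mul_assoc]
    exact mL (d.Rle z) Pc_nonneg
omit d in
lemma Rr_nonneg : 0 ≤ Rr p J y r := integral_nonneg fun z => mul_nonneg Pc_nonneg pV
omit d in
lemma De_nonneg : 0 ≤ De p J y r := integral_nonneg fun z => mul_nonneg (mul_nonneg Pc_nonneg pV) pV
omit d in
lemma Ie_nonneg : 0 ≤ Ie p J y r := integral_nonneg fun z => mul_nonneg Hc_nonneg pV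
lemma Ie_le : Ie p J y r ≤ ∫ z, na J z ^ p :=
  integral_mono d.iH d.iE fun z => mul_le_of_le_one_left pV Hc_le
lemma R_le_D (hr : 0 < r) : Rr p J y r ≤ De p J y r := integral_mono (d.iR hr) (d.iP hr) fun z => by
  simp only; rw [mul_assoc]; exact mL (d.Rle z) Pc_nonneg

lemma stat1 (hr : 0 < r) (h : ‖y‖ + 2 * r < 2) : sp p * Ie p J y r = De p J y r - p * Rr p J y r := by
  have hX : IsTestVF (ball 0 2) fun z => Hc y r z • (z - y) := by
    refine ⟨Hc_smooth.smul fP, (Hc_cs hr).smul_right, ?_⟩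
    refine (closure_mono (Function.support_smul_subset_left _ _)).trans ((Hc_ts hr).trans fun z hz => ?_)
    simp only [mem_closedBall, mem_ball, dist_zero_right, dist_eq_norm] at hz ⊢
    rw [sub_zero]; linarith [norm_le_norm_add_norm_sub' z y]
  have e : ∀ z v, fderiv ℝ (fun z => Hc y r z • (z - y)) z v = Hc y r z • v - (Pc y r z * ⟪z - y, v⟫) • (z - y) := by
    intro z v
    have h1 : HasFDerivAt (fun z => Hc y r z • (z - y)) _ z := (Hc_fd hr).smul ((hasFDerivAt_id z).sub_const y)
    rw [h1.fderiv]; simp; ring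
  have h0 := d.stat _ hX
  simp_rw [e] at h0
  have e2 : ∀ z, (na J z ^ p * (⟪(1 : ℂ), Hc y r z • (1 : ℂ) - (Pc y r z * ⟪z - y, 1⟫) • (z - y)⟫ +
      ⟪Complex.I, Hc y r z • Complex.I - (Pc y r z * ⟪z - y, Complex.I⟫) • (z - y)⟫) -
      p * na J z ^ pm p * ⟪J z, Hc y r z • J z - (Pc y r z * ⟪z - y, J z⟫) • (z - y)⟫) =
      sp p * (Hc y r z * na J z ^ p) - (Pq y r z * na J z ^ p)
       + p * (Pc y r z * (na J z ^ pm p * ⟪z - y, J z⟫ ^ 2)) := by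
    intro z
    have a1 : ⟪J z, J z⟫ = na J z ^ 2 := real_inner_self_eq_norm_sq _
    have a2 : nb z y ^ 2 = (z - y).re * (z - y).re + (z - y).im * (z - y).im := by
      rw [← real_inner_self_eq_norm_sq, inC]
    simp only [inner_sub_right, inner_smul_right, a1, real_inner_comm (z - y) (J z)]
    rw [← rp2 (p := p) (by linarith [d.p1]) (norm_nonneg (J z)), a2]
    simp only [inC]; simp; ring
  simp_rw [e2] at h0
  have i1 := (d.iH (y := y) (r := r)).const_mul sp p
  have i2 := d.iP (y := y) hr
  have i3 := (d.iR (y := y) hr).const_mul p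
  have i4 : Integrable fun z => sp p * (Hc y r z * na J z ^ p) - Pq y r z * na J z ^ p := i1.sub i2
  rw [integral_add i4 i3, integral_sub i1 i2, integral_const_mul, integral_const_mul] at h0
  unfold Ie De Rr; linarith

lemma Ie_d (hr : 0 < r) : HasDerivAt (Ie p J y) (De p J y r / r) r := dI d.iE hr
lemma Th_d (hr : 0 < r) (h : ‖y‖ + 2 * r < 2) : HasDerivAt (Th p J y) (p * r ^ (p - 3) * Rr p J y r) r := by
  have h1 := (Real.hasDerivAt_rpow_const (x := r) (p := p - 2) (Or.inl hr.ne')).mul (d.Ie_d (y := y) hr)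
  refine h1.congr_deriv ?_
  have e1 : r ^ pm p = r ^ (p - 3) * r := by rw [← Real.rpow_add_one hr.ne']; congr 1; ring
  have e2 : p - 2 - 1 = p - 3 := by ring
  have := d.stat1 hr h
  rw [e1, e2]; field_simp
  linear_combination (-1) * this
lemma Th_mono {s : ℝ} (hr : 0 < r) (hs : r ≤ s) (h : ‖y‖ + 2 * s < 2) : Th p J y r ≤ Th p J y s := by
  refine monotoneOn_of_deriv_nonneg (convex_Icc r s) (fun x hx => ?_) (fun x hx => ?_) (fun x hx => ?_)
    (left_mem_Icc.2 hs) (right_mem_Icc.2 hs) hs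
  · exact (d.Th_d (by linarith [hx.1]) (by linarith [hx.2])).continuousAt.continuousWithinAt
  · rw [interior_Icc] at hx
    exact (d.Th_d (by linarith [hx.1]) (by linarith [hx.2])).differentiableAt.differentiableWithinAt
  · rw [interior_Icc] at hx
    have hx0 : 0 < x := by linarith [hx.1]
    rw [(d.Th_d hx0 (by linarith [hx.2])).deriv]
    have := Rr_nonneg (p := p) (J := J) (y := y) (r := x); have := d.p1
    positivity
omit d in
lemma Th_nonneg (hr : 0 < r) : 0 ≤ Th p J y r := mul_nonneg pV Ie_nonneg
end Dat
end

open MeasureTheory Metric Filter Topology Set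
open scoped ENNReal NNReal Convolution
noncomputable section

lemma trans_est {V : ℂ → ℂ} (hV : ContDiff ℝ 1 V) {z h : ℂ} {e : ℝ} (hh : ‖h‖ ≤ 2 * e) :
    ∫⁻ x in ball z e, ‖V (x + h) - V x‖ₑ ≤ ‖h‖ₑ * ∫⁻ x in ball z (3 * e), ‖fderiv ℝ V x‖ₑ := by
  have hc := hV.continuous_fderiv one_ne_zero
  set g : ℂ → ℝ≥0∞ := (ball z (3 * e)).indicator fun x => ‖fderiv ℝ V x‖ₑ
  have hg : Measurable g := hc.enorm.measurable.indicator measurableSet_ball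
  have h1 : ∀ x ∈ ball z e, ‖V (x + h) - V x‖ₑ ≤ ∫⁻ t in Ioc zR 1, g (x + t • h) * ‖h‖ₑ := by
    intro x hx
    have hd : ∀ t : ℝ, HasDerivAt (fun t : ℝ => V (x + t • h)) (fderiv ℝ V (x + t • h) h) t := fun t => by
      have a : HasDerivAt (fun t : ℝ => x + t • h) h t := by
        simpa using ((hasDerivAt_id t).smul_const h).const_add x
      exact ((hV.differentiable one_ne_zero _).hasFDerivAt).comp_hasDerivAt t a
    have h2 := intervalIntegral.integral_eq_sub_of_hasDerivAt (a := 0) (b := 1) (fun t _ => hd t)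
      (by apply Continuous.intervalIntegrable; fun_prop)
    simp only [one_smul, zero_smul, add_zero] at h2
    rw [← h2, intervalIntegral.integral_of_le zero_le_one]
    refine (enorm_integral_le_lintegral_enorm _).trans (setLIntegral_mono' measurableSet_Ioc fun t ht => ?_)
    have : x + t • h ∈ ball z (3 * e) := by
      rw [mem_ball, dist_eq_norm] at hx ⊢
      have h3 : ‖t • h‖ ≤ ‖h‖ := by
        rw [norm_smul, Real.norm_of_nonneg ht.1.le]; exact mul_le_of_le_one_left nN ht.2
      have : x + t • h - z = (x - z) + t • h := by ring
      rw [this]; linarith [norm_add_le (x - z) (t • h)]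
    simp only [g, indicator_of_mem this]
    exact ContinuousLinearMap.le_opENorm _ _
  calc _ ≤ ∫⁻ x in ball z e, ∫⁻ t in Ioc zR 1, g (x + t • h) * ‖h‖ₑ := setLIntegral_mono' measurableSet_ball h1
    _ ≤ ∫⁻ x, ∫⁻ t in Ioc zR 1, g (x + t • h) * ‖h‖ₑ := setLIntegral_le_lintegral _ _
    _ = ∫⁻ t in Ioc zR 1, ∫⁻ x, g (x + t • h) * ‖h‖ₑ := by
      rw [lintegral_lintegral_swap]
      refine Measurable.aemeasurable (.mul_const (hg.comp ?_) _)
      exact Continuous.measurable fP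
    _ = ∫⁻ t in Ioc zR 1, (∫⁻ x, g x) * ‖h‖ₑ := by
      congr 1; ext t
      rw [lintegral_mul_const' _ _ enorm_ne_top, lintegral_add_right_eq_self g]
    _ = _ := by simp [g, lintegral_indicator measurableSet_ball, mul_comm]

/-- Poincare type estimate for smooth maps -/
lemma poin {V : ℂ → ℂ} (hV : ContDiff ℝ 1 V) (n : ℕ) (z : ℂ) :
    ∫⁻ x, ENNReal.ofReal (rn n (z - x)) * ‖V x - mol n V z‖ₑ ≤
      ENNReal.ofReal (32 * π / en n) * ∫⁻ x in ball z (3 * en n), ‖fderiv ℝ V x‖ₑ := by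
  have he := en_pos n
  set e := en n
  set K := ENNReal.ofReal (2 * (e ^ 2)⁻¹) with hK
  have hVc := hV.continuous
  have h0 : ∀ x, ENNReal.ofReal (rn n (z - x)) ≤ (ball z e).indicator (fun _ => K) x := by
    intro x
    by_cases hx : x ∈ ball z e
    · rw [indicator_of_mem hx]; exact ENNReal.ofReal_le_ofReal (rn_le n _)
    · have : z - x ∉ Function.support (rn n) := by
        rw [show Function.support (rn n) = ball 0 (rho n).rOut from (rho n).support_normed_eq]
        rw [mem_ball, dist_comm, dist_eq_norm] at hx
        simpa [rho, en, e] using hx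
      rw [Function.notMem_support.1 this]; simp
  set G := ∫⁻ x in ball z (3 * e), ‖fderiv ℝ V x‖ₑ
  have h1 : ∀ x ∈ ball z e, ‖V x - mol n V z‖ₑ ≤ K * ∫⁻ h in ball 0 (2 * e), ‖V (x + h) - V x‖ₑ := by
    intro x hx
    have e1 : V x - mol n V z = ∫ t, rn n (z - t) • (V x - V t) := by
      simp_rw [smul_sub]
      rw [integral_sub, integral_smul_const, rz_int, one_smul, mol_eq]
      · exact ((rz_cont n z).integrable_of_hasCompactSupport (rz_cs n z)).smul_const _
      · exact ((rz_cont n z).smul hVc).integrable_of_hasCompactSupport (rz_cs n z).smul_right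
    rw [e1]
    calc _ ≤ ∫⁻ t, ‖rn n (z - t) • (V x - V t)‖ₑ := enorm_integral_le_lintegral_enorm _
      _ ≤ ∫⁻ t, (ball z e).indicator (fun t => K * ‖V t - V x‖ₑ) t := by
        refine lintegral_mono fun t => ?_
        rw [enorm_smul, Real.enorm_of_nonneg (rn_nonneg _ _)]
        refine (mul_le_mul_left (h0 t) _).trans ?_
        by_cases ht : t ∈ ball z e
        · simp only [indicator_of_mem ht, ← enorm_neg (V x - V t), neg_sub, le_refl]
        · simp [indicator_of_notMem ht]
      _ ≤ ∫⁻ t, K * (ball 0 (2 * e)).indicator (fun h => ‖V (x + h) - V x‖ₑ) (t - x) := by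
        refine lintegral_mono fun t => ?_
        by_cases ht : t ∈ ball z e
        · have : t - x ∈ ball zC (2 * e) := by
            rw [mem_ball, dist_eq_norm] at *
            have : t - x - 0 = (t - z) - (x - z) := by ring
            rw [this]; linarith [norm_sub_le (t - z) (x - z)]
          simp [indicator_of_mem ht, indicator_of_mem this]
        · simp [indicator_of_notMem ht]
      _ = _ := by
        rw [lintegral_sub_right_eq_self (fun t => K * (ball 0 (2 * e)).indicator (fun h => ‖V (x + h) - V x‖ₑ) t),
          lintegral_const_mul' _ _ ENNReal.ofReal_ne_top, lintegral_indicator measurableSet_ball]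
  calc _ ≤ ∫⁻ x, (ball z e).indicator (fun x => K * (K * ∫⁻ h in ball 0 (2 * e), ‖V (x + h) - V x‖ₑ)) x := by
        refine lintegral_mono fun x => (mul_le_mul_left (h0 x) _).trans ?_
        by_cases hx : x ∈ ball z e
        · simp only [indicator_of_mem hx]; exact mul_le_mul_right (h1 x hx) _
        · simp [indicator_of_notMem hx]
    _ = K * (K * ∫⁻ h in ball 0 (2 * e), ∫⁻ x in ball z e, ‖V (x + h) - V x‖ₑ) := by
        rw [lintegral_indicator measurableSet_ball, lintegral_const_mul' _ _ ENNReal.ofReal_ne_top,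
          lintegral_const_mul' _ _ ENNReal.ofReal_ne_top, lintegral_lintegral_swap]
        refine Continuous.aemeasurable ?_
        exact Continuous.enorm fP
    _ ≤ K * (K * ∫⁻ h in ball zC (2 * e), ENNReal.ofReal (2 * e) * G) := by
        gcongr K * (K * ?_)
        refine setLIntegral_mono' measurableSet_ball fun h hh => ?_
        rw [mem_ball, dist_zero_right] at hh
        refine (trans_est hV hh.le).trans (mul_le_mul_left ?_ _)
        rw [← ofReal_norm]; exact ENNReal.ofReal_le_ofReal hh.le
    _ = _ := by
        rw [setLIntegral_const, Complex.volume_ball, hK]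
        have : ENNReal.ofReal (2 * e) ^ 2 * (NNReal.pi : ℝ≥0∞) = ENNReal.ofReal ((2 * e) ^ 2 * π) := by
          rw [ENNReal.ofReal_mul (p := (2 * e) ^ 2) pV, ENNReal.ofReal_pow pV]; congr 1
          rw [ENNReal.ofReal, ← NNReal.coe_real_pi, Real.toNNReal_coe]
        rw [this, show ∀ a b c d : ℝ≥0∞, a * (a * (b * d * c)) = (a * a * b * c) * d from fun a b c d => by ring]
        congr 1
        rw [← ENNReal.ofReal_mul pV, ← ENNReal.ofReal_mul pV, ← ENNReal.ofReal_mul pV]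
        congr 1; field_simp; norm_num

namespace Dat
variable {p : ℝ} {U J : ℂ → ℂ} (d : Dat p U J)
include d
lemma iUJ (w : ℂ) : Integrable fun z => Complex.I * U z * ((⟪J z, w⟫ : ℝ) : ℂ) := by
  refine (d.iJ.norm.mul_const ‖w‖).mono' ((d.mU.const_mul _).mul
    (Complex.continuous_ofReal.comp_aestronglyMeasurable (d.mJ.inner aestronglyMeasurable_const))) ?_
  filter_upwards [d.u2] with z hz
  simp only [norm_mul, Complex.norm_I, one_mul, Complex.norm_real]
  exact (mul_le_of_le_one_left nN hz).trans (norm_inner_le_norm _ _)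
lemma fdU {n : ℕ} {z : ℂ} (hz : ‖z‖ + en n < 2) (w : ℂ) :
    fderiv ℝ (mol n U) z w = mol n (fun z => Complex.I * U z * ((⟪J z, w⟫ : ℝ) : ℂ)) z :=
  weak_mol d.iU (fun φ h => d.weak φ h w) hz
lemma fdU_le {n : ℕ} {z : ℂ} (hz : ‖z‖ + en n < 2) : ‖fderiv ℝ (mol n U) z‖ ≤ mol n (fun z => na J z) z := by
  have h0 : 0 ≤ mol n (fun z => na J z) z := by
    rw [mol_eq]; exact integral_nonneg fun t => mul_nonneg (rn_nonneg _ _) nN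
  refine ContinuousLinearMap.opNorm_le_bound _ h0 fun w => ?_
  rw [d.fdU hz]
  refine (mol_norm (d.iUJ w) n z).trans ?_
  rw [mol_eq, mol_eq, ← integral_mul_const]
  refine integral_mono_ae (mol_i (d.iUJ w).norm n z) ((mol_i d.iJ.norm n z).mul_const _) ?_
  filter_upwards [d.u2] with t hz
  simp only [norm_mul, Complex.norm_I, one_mul, Complex.norm_real, smul_eq_mul, mul_assoc]
  exact mL ((mul_le_of_le_one_left nN hz).trans (norm_inner_le_norm _ _)) (rn_nonneg _ _)

lemma poinU {n : ℕ} {z : ℂ} (hz : ‖z‖ + 4 * en n < 2) :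
    1 ≤ ‖mol n U z‖ + 32 * π / en n * ∫ x in ball z (3 * en n), na J x := by
  have he := en_pos n
  set C := 32 * π / en n
  have hC : 0 ≤ C := by positivity
  have iJc : Integrable fun z => (na J z : ℂ) := d.iJ.norm.ofReal
  have key : ∀ᶠ m in atTop, ∫ x, ‖((rn n (z - x) : ℝ) : ℂ) * mol m U x‖ ≤ ‖mol n (mol m U) z‖ +
      C * ∫ x in ball z (3 * en n), ‖mol m (fun z => (na J z : ℂ)) x‖ := by
    filter_upwards [en_ev he] with m hm
    have hs : ContDiff ℝ 1 (mol m U) := (mol_smooth d.iU m).of_le (by norm_cast)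
    have h1 := poin hs n z
    have hB : ∀ x ∈ ball z (3 * en n), ‖fderiv ℝ (mol m U) x‖ₑ ≤ ENNReal.ofReal ‖mol m (fun z => (na J z : ℂ)) x‖ := by
      intro x hx
      rw [mem_ball, dist_eq_norm] at hx
      rw [← ofReal_norm]
      refine ENNReal.ofReal_le_ofReal ((d.fdU_le (by linarith [norm_le_norm_add_norm_sub' x z])).trans ?_)
      have : mol m (fun z => (na J z : ℂ)) x = ((mol m (fun z => na J z) x : ℝ) : ℂ) := by
        rw [mol_eq, mol_eq, ← integral_complex_ofReal]; simp
      rw [this, Complex.norm_real]; exact le_abs_self _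
    have i2 : Integrable (fun x => ‖mol m (fun z => (na J z : ℂ)) x‖) := (mol_integrable iJc m).norm
    have h2 := h1.trans (mul_le_mul_right (setLIntegral_mono' measurableSet_ball hB) _)
    rw [← ofReal_integral_eq_lintegral_ofReal i2.integrableOn (eF fun x => norm_nonneg _),
      ← ENNReal.ofReal_mul hC] at h2
    have i3 : Integrable fun x => rn n (z - x) * ‖mol m U x - mol n (mol m U) z‖ :=
      ((rz_cont n z).mul (hs.continuous.sub continuous_const).norm).integrable_of_hasCompactSupport (rz_cs n z).mul_right
    have e3 : ∀ x, ENNReal.ofReal (rn n (z - x)) * ‖mol m U x - mol n (mol m U) z‖ₑ =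
        ENNReal.ofReal (rn n (z - x) * ‖mol m U x - mol n (mol m U) z‖) := fun x => by
      rw [ENNReal.ofReal_mul (rn_nonneg _ _), ofReal_norm]
    simp_rw [e3] at h2
    rw [← ofReal_integral_eq_lintegral_ofReal i3 (eF fun x => mul_nonneg (rn_nonneg _ _) nN),
      ENNReal.ofReal_le_ofReal_iff (mul_nonneg hC (integral_nonneg fun x => norm_nonneg _))] at h2
    have i4 : Integrable fun x => rn n (z - x) * ‖mol n (mol m U) z‖ :=
      ((rz_cont n z).integrable_of_hasCompactSupport (rz_cs n z)).mul_const _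
    have h5 : ∫ x, ‖((rn n (z - x) : ℝ) : ℂ) * mol m U x‖ ≤ ∫ x, (rn n (z - x) * ‖mol n (mol m U) z‖ +
        rn n (z - x) * ‖mol m U x - mol n (mol m U) z‖) := by
      refine integral_mono ?_ (i4.add i3) fun x => ?_
      · have := (mol_i (mol_integrable d.iU m) n z).norm
        simpa [Complex.real_smul] using this
      · simp only [norm_mul, Complex.norm_real, Real.norm_of_nonneg (rn_nonneg _ _)]
        rw [← mul_add]
        exact mL (norm_le_norm_add_norm_sub' _ _) (rn_nonneg _ _)
    rw [integral_add i4 i3, integral_mul_const, rz_int, one_mul] at h5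
    linarith
  have nrm : ∀ {f : ℂ → ℂ}, Integrable f → Tendsto (fun m => ∫ x, ‖‖mol m f x‖ - na f x‖) atTop (𝓝 0) := by
    intro f hf
    refine squeeze_zero (fun m => integral_nonneg fun x => norm_nonneg _) (fun m => ?_) (mol_conv1 hf)
    exact integral_mono ((mol_integrable hf m).norm.sub hf.norm).norm ((mol_integrable hf m).sub hf).norm
      fun x => abs_norm_sub_norm_le _ _
  have ba : ∀ x, ‖rn n (z - x)‖ ≤ 2 * (en n ^ 2)⁻¹ := fun x => by
    rw [Real.norm_of_nonneg (rn_nonneg _ _)]; exact rn_le _ _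
  have T1 := L1lim (fun m => (mol_integrable d.iU m).norm) d.iU.norm (nrm d.iU) (rz_cont n z).aestronglyMeasurable
    (eF ba)
  have T2 := L1lim (fun m => (mol_integrable iJc m).norm) iJc.norm (nrm iJc)
    (a := (ball z (3 * en n)).indicator fun _ => 1) (C := 1)
    (measurable_const.indicator measurableSet_ball).aestronglyMeasurable
    (eF fun x => by by_cases h : x ∈ ball z (3 * en n) <;> simp [h])
  have T3 := L1lim (fun m => mol_integrable d.iU m) d.iU (mol_conv1 d.iU) (a := fun x => ((rn n (z - x) : ℝ) : ℂ))
    (Complex.continuous_ofReal.comp (rz_cont n z)).aestronglyMeasurable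
    (eF fun x => by rw [Complex.norm_real]; exact ba x)
  have i1 : ∫ x, rn n (z - x) * na U x = 1 := by
    rw [← rz_int n z]
    refine integral_congr_ae ?_
    filter_upwards [d.u1] with x hx
    by_cases h : en n < nb z x
    · rw [rn_zero h, zero_mul]
    · rw [hx, mul_one]
      rw [mem_ball, dist_zero_right]
      rw [norm_sub_rev] at h; linarith [norm_le_norm_add_norm_sub' x z]
  rw [i1] at T1
  have e2 : ∀ f : ℂ → ℝ, ∫ x, (ball z (3 * en n)).indicator (fun _ => 1) x * f x = ∫ x in ball z (3 * en n), f x := by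
    intro f
    rw [← integral_indicator measurableSet_ball]; congr 1; ext x
    by_cases h : x ∈ ball z (3 * en n) <;> simp [h]
  simp_rw [e2] at T2
  simp_rw [← Complex.real_smul, ← mol_eq] at T3
  refine le_of_tendsto_of_tendsto T1 (T3.norm.add ((by simpa using T2 : Tendsto _ _ (𝓝 (∫ x in ball z (3 * en n), na J x))).const_mul C)) ?_
  filter_upwards [key] with m hm
  simpa [abs_of_nonneg (rn_nonneg _ _)] using hm
end Dat

def Good (U : ℂ → ℂ) (z : ℂ) : Prop := ∃ h > 0, ∀ᶠ n in atTop, ∀ z' ∈ ball z h, 1 / 2 ≤ ‖mol n U z'‖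
def eps1 : ℝ := 1 / 40000000
lemma eps1_pos : 0 < eps1 := by unfold eps1; norm_num

lemma young1 {x g p : ℝ} (hx : 0 ≤ x) (hg : 0 < g) (hp : 1 ≤ p) : x ≤ g + g ^ (1 - p) * x ^ p := by
  rcases le_total x g with h | h
  · have : 0 ≤ g ^ (1 - p) * x ^ p := by positivity
    linarith
  · have hx0 : 0 < x := by linarith
    have e : x = x ^ (1 - p) * x ^ p := by rw [← Real.rpow_add hx0]; simp
    have : x ^ (1 - p) ≤ g ^ (1 - p) := Real.rpow_le_rpow_of_nonpos hg h lN
    have h2 : x ^ (1 - p) * x ^ p ≤ g ^ (1 - p) * x ^ p := by gcongr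
    linarith

lemma Dat.goodC {p : ℝ} {U J : ℂ → ℂ} (d : Dat p U J) {z : ℂ} {h : ℝ} (hh : 0 < h) (hz : ‖z‖ + 2 * h < 2)
    (hT : Th p J z h ≤ eps1) : Good U z := by
  have p1 := d.p1; have p2 := d.p2
  refine ⟨h / 4, by positivity, ?_⟩
  filter_upwards [en_ev (a := h / 16) pV] with n hn z' hz'
  have he := en_pos n
  set e := en n
  rw [mem_ball, dist_eq_norm] at hz'
  have nz := norm_le_norm_add_norm_sub' z' z
  have h1 := d.poinU (n := n) (z := z') lN
  have t1 : Th p J z' (h / 4) ≤ 2 * eps1 := by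
    have : Ie p J z' (h / 4) ≤ Ie p J z h := by
      refine integral_mono d.iH d.iH fun x => mul_le_mul_of_nonneg_right ?_ pV
      by_cases hx : 2 * (h / 4) ≤ ‖x - z'‖
      · rw [Hc_zero pV hx]; exact Hc_nonneg
      · rw [Hc_one (y := z) hh]
        · exact Hc_le
        · have : x - z = (x - z') + (z' - z) := by ring
          rw [this]; linarith [norm_add_le (x - z') (z' - z)]
    have e1 : (h / 4) ^ pm p = 4 ^ sp p * h ^ pm p := by
      rw [Real.div_rpow hh.le nU, div_eq_mul_inv, ← Real.rpow_neg nU, mul_comm]; congr 2; ring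
    have e2 : (4 : ℝ) ^ sp p ≤ 2 := by
      calc (4 : ℝ) ^ sp p ≤ 4 ^ (1 / 2 : ℝ) := Real.rpow_le_rpow_of_exponent_le nU lN
        _ = 2 := by rw [← Real.sqrt_eq_rpow, show (4 : ℝ) = 2 ^ 2 by norm_num]; simp
    unfold Th at hT ⊢
    calc _ ≤ (h / 4) ^ pm p * Ie p J z h := by gcongr
      _ = 4 ^ sp p * (h ^ pm p * Ie p J z h) := by rw [e1]; ring
      _ ≤ 2 * eps1 := by gcongr; exact mul_nonneg pV Dat.Ie_nonneg
  have t2 := (d.Th_mono (y := z') (r := 3 * e) (s := h / 4) pV lN lN).trans t1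
  have t3 : ∫ x in ball z' (3 * e), na J x ^ p ≤ 6 * eps1 * e ^ sp p := by
    have a1 : ∫ x in ball z' (3 * e), na J x ^ p ≤ Ie p J z' (3 * e) := by
      rw [← integral_indicator measurableSet_ball]
      refine integral_mono (d.iE.indicator measurableSet_ball) d.iH fun x => ?_
      by_cases hx : x ∈ ball z' (3 * e)
      · simp only [indicator_of_mem hx]; rw [Hc_one pV, one_mul]
        rw [mem_ball, dist_eq_norm] at hx; exact hx.le
      · simp only [indicator_of_notMem hx]; exact mul_nonneg Hc_nonneg pV
    have a2 : Ie p J z' (3 * e) = (3 * e) ^ sp p * Th p J z' (3 * e) := by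
      rw [Th, ← mul_assoc, ← Real.rpow_add pV]; simp
    have a3 : (3 : ℝ) ^ sp p ≤ 3 := by
      simpa using Real.rpow_le_rpow_of_exponent_le (x := 3) nU (show 2 - p ≤ 1 by linarith)
    calc _ ≤ _ := a1
      _ = 3 ^ sp p * e ^ sp p * Th p J z' (3 * e) := by rw [a2, Real.mul_rpow nU he.le]
      _ ≤ 3 * e ^ sp p * (2 * eps1) := by gcongr; exact mul_nonneg pV Dat.Ie_nonneg
      _ = _ := by ring
  set g : ℝ := 1 / 12000
  have t4 : ∫ x in ball z' (3 * e), na J x ≤ e * (9 * π * g + 6 * eps1 / g) := by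
    have ig : IntegrableOn (fun _ => g / e) (ball z' (3 * e)) := integrableOn_const measure_ball_lt_top.ne
    have iE := (d.iE.integrableOn (s := ball z' (3 * e))).const_mul ((g / e) ^ (1 - p))
    have a1 : ∫ x in ball z' (3 * e), na J x ≤ ∫ x in ball z' (3 * e), (g / e + (g / e) ^ (1 - p) * na J x ^ p) :=
      integral_mono d.iJ.norm.integrableOn (ig.add iE) fun x => young1 nN pV lN
    rw [integral_add ig iE, integral_const_mul] at a1
    have a2 : ∫ x in ball z' (3 * e), g / e = 9 * π * g * e := by
      rw [setIntegral_const, measureReal_def, Complex.volume_ball]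
      simp; rw [ENNReal.toReal_ofReal he.le]; field_simp; norm_num
    have a3 : (g / e) ^ (1 - p) ≤ e ^ (p - 1) / g := by
      rw [Real.div_rpow pV he.le, div_eq_mul_inv, ← Real.rpow_neg he.le, neg_sub, mul_comm, div_eq_mul_inv]
      gcongr
      rw [← Real.rpow_neg_one]
      exact Real.rpow_le_rpow_of_exponent_ge pV (by norm_num [g]) lN
    have a4 : (g / e) ^ (1 - p) * ∫ x in ball z' (3 * e), na J x ^ p ≤ e ^ (p - 1) / g * (6 * eps1 * e ^ sp p) := by
      gcongr
    have a5 : e ^ (p - 1) * e ^ sp p = e := by rw [← Real.rpow_add he]; ring_nf; simp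
    calc _ ≤ 9 * π * g * e + e ^ (p - 1) / g * (6 * eps1 * e ^ sp p) := by linarith
      _ = 9 * π * g * e + 6 * eps1 / g * (e ^ (p - 1) * e ^ sp p) := by ring
      _ = _ := by rw [a5]; ring
  have t5 : 32 * π / e * ∫ x in ball z' (3 * e), na J x ≤ 32 * π / e * (e * (9 * π * g + 6 * eps1 / g)) := by
    gcongr
  have t6 : 32 * π / e * (e * (9 * π * g + 6 * eps1 / g)) = 32 * π * (9 * π * g + 6 * eps1 / g) := by
    field_simp
  have t7 : 32 * π * (9 * π * g + 6 * eps1 / g) ≤ 1 / 2 := by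
    have := Real.pi_lt_d2; have := Real.pi_pos
    norm_num [g, eps1]; nlinarith
  linarith
end

open MeasureTheory Metric Filter Topology Set
open scoped ENNReal NNReal Convolution
noncomputable section
open Complex (I)

def rot (y : ℂ) (α : ℝ) (z : ℂ) : ℂ := y + Complex.exp (α * I) * (z - y)
lemma rot_sub (y : ℂ) (α : ℝ) (z : ℂ) : rot y α z - y = Complex.exp (α * I) * (z - y) := by simp [rot]
lemma rot_norm (y : ℂ) (α : ℝ) (z : ℂ) : ‖rot y α z - y‖ = nb z y := by
  rw [rot_sub, norm_mul, Complex.norm_exp_ofReal_mul_I, one_mul]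
lemma rot_cont (y : ℂ) : Continuous fun q : ℂ × ℝ => rot y q.2 q.1 := by unfold rot; fun_prop
lemma rot_int {E : Type*} [NormedAddCommGroup E] [NormedSpace ℝ E] (c : ℂ → E) (y : ℂ) (α : ℝ) :
    ∫ z, c (rot y α z) = ∫ z, c z := by
  have h1 := (rotation (Circle.exp α)).measurePreserving.integral_comp
    (rotation (Circle.exp α)).toHomeomorph.measurableEmbedding (fun w => c (y + w))
  simp only [rotation_apply, Circle.coe_exp] at h1
  have h2 := integral_sub_right_eq_self (μ := volume) (fun w => c (y + Complex.exp (α * I) * w)) y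
  have h3 := integral_add_left_eq_self (μ := volume) c y
  rw [← h3, ← h1, ← h2]; rfl
lemma rot_avg {E : Type*} [NormedAddCommGroup E] [NormedSpace ℝ E] [CompleteSpace E] {c : ℂ → E} (hc : Continuous c)
    (hs : HasCompactSupport c) (y : ℂ) :
    ∫ z, ∫ α in zR..2 * π, c (rot y α z) = (2 * π) • ∫ z, c z := by
  have h2 : zR ≤ 2 * π := by positivity
  simp_rw [intervalIntegral.integral_of_le h2]
  rw [integral_integral_swap]
  · simp_rw [rot_int]
    rw [setIntegral_const]; simp [measureReal_def, Real.volume_Ioc, Real.pi_pos.le]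
  obtain ⟨R, hR⟩ := hs.isCompact.isBounded.subset_closedBall y
  have hcont : Continuous (Function.uncurry fun z α => c (rot y α z)) := hc.comp (rot_cont y)
  have h3 : IntegrableOn (Function.uncurry fun z α => c (rot y α z)) (closedBall y R ×ˢ Icc 0 (2 * π)) :=
    hcont.continuousOn.integrableOn_compact ((isCompact_closedBall _ _).prod isCompact_Icc)
  have h4 : (volume : Measure ℂ).prod (volume.restrict (Ioc 0 (2 * π))) = volume.restrict (univ ×ˢ Ioc 0 (2 * π)) := by
    rw [Measure.volume_eq_prod, ← Measure.prod_restrict, Measure.restrict_univ]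
  rw [h4]
  refine IntegrableOn.of_forall_sdiff_eq_zero (h3.mono_set (prod_mono le_rfl Ioc_subset_Icc_self))
    (MeasurableSet.univ.prod measurableSet_Ioc) ?_
  rintro ⟨z, α⟩ ⟨h5, h6⟩
  by_contra h7
  refine h6 ⟨?_, h5.2⟩
  have := hR (subset_tsupport _ h7)
  rwa [mem_closedBall, dist_eq_norm, rot_norm, ← dist_eq_norm] at this

lemma wind_int {g g' : ℝ → ℂ} (hg : ∀ t, HasDerivAt g (g' t) t) (hc : Continuous g') (h0 : ∀ t, g t ≠ 0)
    {T : ℝ} (hT : g T = g 0) : ∃ k : ℤ, ∫ t in zR..T, g' t / g t = k * (2 * π * I) := by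
  have hgc : Continuous g := continuous_iff_continuousAt.2 fun t => (hg t).continuousAt
  have hq : Continuous fun t => g' t / g t := hc.div hgc h0
  set L : ℝ → ℂ := fun t => ∫ s in zR..t, g' s / g s
  have hL : ∀ t, HasDerivAt L (g' t / g t) t := fun t => hq.integral_hasStrictDerivAt 0 t |>.hasDerivAt
  have hd : ∀ t, HasDerivAt (fun t => g t * Complex.exp (-L t)) 0 t := fun t => by
    refine ((hg t).mul (hL t).neg.cexp).congr_deriv ?_
    have := h0 t; field_simp; simp
  have hk := is_const_of_deriv_eq_zero (fun t => (hd t).differentiableAt) (fun t => (hd t).deriv) T 0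
  simp only [hT] at hk
  have e0 : L 0 = 0 := by simp [L]
  rw [e0, neg_zero, Complex.exp_zero] at hk
  have := mul_left_cancel₀ (h0 0) hk
  rw [Complex.exp_eq_one_iff] at this
  obtain ⟨n, hn⟩ := this
  refine ⟨-n, ?_⟩
  have : L T = -(n * (2 * π * I)) := by rw [← hn, neg_neg]
  rw [show ∫ t in zR..T, g' t / g t = L T from rfl, this]; push_cast; ring

lemma wind_const {g : ℂ → ℂ} (hg : ContDiff ℝ 1 g) {y : ℂ} {r1 r2 : ℝ} (h12 : r1 ≤ r2)
    (h0 : ∀ z, r1 ≤ nb z y → nb z y ≤ r2 → g z ≠ 0) (hr : 0 < r1) :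
    ∃ k : ℤ, ∀ z, r1 ≤ nb z y → nb z y ≤ r2 →
      ∫ α in zR..2 * π, fderiv ℝ g (rot y α z) (I * (rot y α z - y)) / g (rot y α z) = k * (2 * π * I) := by
  have hc := hg.continuous_fderiv one_ne_zero
  set cl : ℝ → ℝ := fun s => max r1 (min s r2)
  have hcl : Continuous cl := by fun_prop
  set Z : ℝ × ℝ → ℂ := fun q => y + cl q.1 * Complex.exp (q.2 * I)
  have hZc : Continuous Z := by fun_prop
  have hZn : ∀ q, ‖Z q - y‖ = cl q.1 := fun q => by
    simp only [Z, add_sub_cancel_left, norm_mul, Complex.norm_exp_ofReal_mul_I, mul_one, Complex.norm_real]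
    exact abs_of_nonneg (hr.le.trans (le_max_left _ _))
  have hne : ∀ q α, g (rot y α (Z q)) ≠ 0 := fun q α => by
    refine h0 _ ?_ ?_ <;> rw [rot_norm, hZn]
    · exact le_max_left _ _
    · exact max_le h12 (min_le_right _ _)
  set W : ℝ × ℝ → ℂ := fun q => ∫ α in zR..2 * π,
    fderiv ℝ g (rot y α (Z q)) (I * (rot y α (Z q) - y)) / g (rot y α (Z q))
  have hW : ∀ q, ∃ k : ℤ, W q = k * (2 * π * I) := fun q => by
    refine wind_int (g := fun α => g (rot y α (Z q))) (fun t => ?_) ?_ (hne q) (by simp [rot, Complex.exp_two_pi_mul_I])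
    · refine ((hg.differentiable one_ne_zero _).hasFDerivAt).comp_hasDerivAt t ?_
      have : HasDerivAt (fun t : ℝ => y + Complex.exp (t * I) * (Z q - y)) _ t :=
        (((Complex.ofRealCLM.hasDerivAt (x := t)).mul_const I).cexp.mul_const (Z q - y)).const_add y
      refine this.congr_deriv ?_
      rw [rot_sub]; simp; ring
    · unfold rot; fun_prop
  choose κ hκ using hW
  have hWc : Continuous W := by
    refine intervalIntegral.continuous_parametric_intervalIntegral_of_continuous ?_ continuous_const
    have hrc : Continuous fun q : (ℝ × ℝ) × ℝ => rot y q.2 (Z q.1) := by unfold rot; fun_prop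
    refine Continuous.div ?_ (hg.continuous.comp hrc) fun q => hne _ _
    exact (hc.comp hrc).clm_apply (continuous_const.mul (hrc.sub continuous_const))
  have hκc : Continuous κ := by
    rw [Int.isClosedEmbedding_coe_real.isInducing.continuous_iff]
    have : (Int.cast ∘ κ : ℝ × ℝ → ℝ) = fun q => (W q).im / (2 * π) := by
      ext q; rw [hκ]; have := Real.pi_pos; simp
    rw [this]; fun_prop
  refine ⟨κ (0, 0), fun z hz1 hz2 => ?_⟩
  have hz : z = Z (nb z y, Complex.arg (z - y)) := by
    simp only [Z, cl, min_eq_left hz2, max_eq_right hz1, Complex.norm_mul_exp_arg_mul_I]; ring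
  rw [PreconnectedSpace.constant inferInstance hκc (x := (0, 0)) (y := (nb z y, Complex.arg (z - y))), ← hκ]
  simp only [W]; rw [← hz]

lemma curl0 {H g : ℂ → ℂ} (hH : ContDiff ℝ (⊤ : ℕ∞) H) (hs : HasCompactSupport H) (hg : ContDiff ℝ (⊤ : ℕ∞) g) :
    ∫ z, (fderiv ℝ g z 1 * fderiv ℝ H z I - fderiv ℝ g z I * fderiv ℝ H z 1) = 0 := by
  have hdH := hH.differentiable (by simp)
  have cH := hH.continuous_fderiv (by simp)
  have hg' : ContDiff ℝ (⊤ : ℕ∞) (fderiv ℝ g) := hg.fderiv_right (by norm_cast)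
  have e : ∀ v w : ℂ, ∫ z, fderiv ℝ g z v * fderiv ℝ H z w = -∫ z, fderiv ℝ (fderiv ℝ g) z w v * H z := by
    intro v w
    have hd : ∀ z, HasFDerivAt (fun z => fderiv ℝ g z v) ((fderiv ℝ (fderiv ℝ g) z).flip v) z := fun z =>
      (ContinuousLinearMap.apply ℝ ℂ v).hasFDerivAt.comp z (hg'.differentiable (by simp) z).hasFDerivAt
    have h := integral_mul_fderiv_eq_neg_fderiv_mul_of_integrable (μ := volume) (f := fun z => fderiv ℝ g z v) (g := H) (v := w)
      ?_ ?_ ?_ (fun x _ => (hd x).differentiableAt) (fun x _ => hdH x)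
    · rw [h]; congr 2; ext z; rw [(hd z).fderiv]; rfl
    · simp_rw [fun z => (hd z).fderiv]
      exact Continuous.integrable_of_hasCompactSupport (((hg'.continuous_fderiv (by simp)).clm_apply continuous_const
        |>.clm_apply continuous_const).mul hH.continuous) hs.mul_left
    · exact Continuous.integrable_of_hasCompactSupport ((hg'.continuous.clm_apply continuous_const).mul
        (cH.clm_apply continuous_const)) (hs.fderiv_apply ℝ w).mul_left
    · exact Continuous.integrable_of_hasCompactSupport ((hg'.continuous.clm_apply continuous_const).mul
        hH.continuous) hs.mul_left
  have i : ∀ v w : ℂ, Integrable fun z => fderiv ℝ g z v * fderiv ℝ H z w := fun v w =>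
    Continuous.integrable_of_hasCompactSupport ((hg'.continuous.clm_apply continuous_const).mul
        (cH.clm_apply continuous_const)) (hs.fderiv_apply ℝ w).mul_left
  rw [integral_sub (i _ _) (i _ _), e, e]
  have : ∀ z, fderiv ℝ (fderiv ℝ g) z I 1 = fderiv ℝ (fderiv ℝ g) z 1 I := fun z =>
    (hg.contDiffAt.isSymmSndFDerivAt (by simp; norm_cast)).eq _ _
  simp_rw [this]; simp
end

open MeasureTheory Metric Filter Topology Set
open scoped ENNReal NNReal Convolution
noncomputable section
open Complex (I)

def GS (U : ℂ → ℂ) : Set ℂ := {z | Good U z ∧ ‖z‖ < 2}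
lemma GS_compact {U : ℂ → ℂ} {K : Set ℂ} (hK : IsCompact K) (h : K ⊆ GS U) :
    ∀ᶠ n in atTop, ∀ z ∈ K, 1 / 2 ≤ ‖mol n U z‖ ∧ ‖z‖ + en n < 2 := by
  refine hK.induction_on (p := fun s => ∀ᶠ n in atTop, ∀ z ∈ s, 1 / 2 ≤ ‖mol n U z‖ ∧ ‖z‖ + en n < 2) (by simp) ?_ ?_ ?_
  · exact fun s t hst ht => ht.mono fun n hn z hz => hn z (hst hz)
  · intro s t hs ht
    filter_upwards [hs, ht] with n h1 h2 z hz
    exact hz.elim (h1 z) (h2 z)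
  · intro x hx
    obtain ⟨⟨r, hr, h1⟩, h2⟩ := h hx
    refine ⟨_, mem_nhdsWithin_of_mem_nhds (ball_mem_nhds x (lt_min hr (show 0 < (2 - ‖x‖) / 2 by linarith))), ?_⟩
    filter_upwards [h1, en_ev (a := (2 - ‖x‖) / 2) lN] with n h3 h4 z hz
    refine ⟨h3 z (ball_subset_ball (min_le_left _ _) hz), ?_⟩
    have := ball_subset_ball (min_le_right _ _) hz
    rw [mem_ball, dist_eq_norm] at this
    linarith [norm_le_norm_add_norm_sub' z x]

lemma cont_div {c : ℂ → ℂ} {f g : ℂ → ℂ} (hc : Continuous c) (hf : Continuous f) (hg : Continuous g)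
    (h0 : ∀ z ∈ tsupport c, g z ≠ 0) : Continuous fun z => c z * (f z / g z) := by
  refine continuous_iff_continuousAt.2 fun z => ?_
  by_cases hz : z ∈ tsupport c
  · exact hc.continuousAt.mul (hf.continuousAt.div hg.continuousAt (h0 z hz))
  · have : (fun _ => 0) =ᶠ[𝓝 z] fun z => c z * (f z / g z) := by
      filter_upwards [(isClosed_tsupport c).isOpen_compl.mem_nhds hz] with x hx
      rw [image_eq_zero_of_notMem_tsupport hx, zero_mul]
    exact continuousAt_const.congr this

namespace Dat
variable {p : ℝ} {U J : ℂ → ℂ} (d : Dat p U J)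
include d

lemma limL {c : ℂ → ℝ} (hc : Continuous c) (hs : HasCompactSupport c) (hG : tsupport c ⊆ GS U) (w : ℂ) :
    Tendsto (fun n => ∫ z, (c z : ℂ) * (fderiv ℝ (mol n U) z w / mol n U z)) atTop
      (𝓝 (∫ z, (c z : ℂ) * (I * ((⟪J z, w⟫ : ℝ) : ℂ)))) := by
  obtain ⟨C, hC⟩ := hs.exists_bound_of_continuous hc
  have hC0 : 0 ≤ C := (norm_nonneg _).trans (hC 0)
  set V : ℂ → ℂ := fun z => I * U z * ((⟪J z, w⟫ : ℝ) : ℂ) with hV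
  have iV : Integrable V := d.iUJ w
  have ev := GS_compact hs hG
  have mq : ∀ n, AEStronglyMeasurable fun z => (c z : ℂ) / mol n U z := fun n =>
    ((Complex.continuous_ofReal.comp hc).measurable.div (mol_smooth d.iU n).continuous.measurable).aestronglyMeasurable
  have bq : ∀ᶠ n in atTop, ∀ z, ‖(c z : ℂ) / mol n U z‖ ≤ 2 * C := by
    filter_upwards [ev] with n hn z
    by_cases hz : z ∈ tsupport c
    · rw [norm_div, Complex.norm_real, div_le_iff₀ (by linarith [(hn z hz).1])]
      nlinarith [(hn z hz).1, hC z]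
    · rw [image_eq_zero_of_notMem_tsupport hz]; simp; positivity
  have T1 : Tendsto (fun n => ∫ z, (c z : ℂ) / mol n U z * (mol n V z - V z)) atTop (𝓝 0) := by
    have := (mol_conv1 iV).const_mul (2 * C)
    rw [mul_zero] at this
    refine squeeze_zero_norm' ?_ this
    filter_upwards [bq] with n hn
    rw [← integral_const_mul]
    refine norm_integral_le_of_norm_le (((mol_integrable iV n).sub iV).norm.const_mul _) (eF fun z => ?_)
    rw [norm_mul]; exact mul_le_mul_of_nonneg_right (hn z) nN
  have T2 : Tendsto (fun n => ∫ z, (c z : ℂ) / mol n U z * V z) atTop (𝓝 (∫ z, (c z : ℂ) * (I * ((⟪J z, w⟫ : ℝ) : ℂ)))) := by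
    refine tendsto_integral_filter_of_dominated_convergence (fun z => 2 * C * na V z)
      (eF fun n => (mq n).mul iV.1) ?_ (iV.norm.const_mul _) ?_
    · filter_upwards [bq] with n hn
      refine eF fun z => ?_
      rw [norm_mul]; exact mul_le_mul_of_nonneg_right (hn z) nN
    · filter_upwards [mol_ae d.iU, d.u1] with z h1 h2
      by_cases hz : z ∈ tsupport c
      · have hn := h2 (by simpa using (hG hz).2)
        have hne : U z ≠ 0 := by intro h; rw [h] at hn; simp at hn
        have : Tendsto (fun n => (c z : ℂ) / mol n U z * V z) atTop (𝓝 (c z / U z * V z)) :=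
          ((tendsto_const_nhds (x := (c z : ℂ))).div h1 hne).mul_const (V z)
        have e : (c z : ℂ) * (I * ((⟪J z, w⟫ : ℝ) : ℂ)) = c z / U z * V z := by simp only [V]; field_simp
        rwa [e]
      · simp [image_eq_zero_of_notMem_tsupport hz]
  have T3 := T1.add T2
  rw [zero_add] at T3
  refine T3.congr' ?_
  filter_upwards [bq, ev] with n hn hn2
  have i1 : Integrable fun z => (c z : ℂ) / mol n U z * (mol n V z - V z) :=
    ((mol_integrable iV n).sub iV).bdd_mul (mq n) (eF hn)
  rw [← integral_add i1 (iV.bdd_mul (mq n) (eF hn))]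
  congr 1; ext z
  by_cases hz : z ∈ tsupport c
  · rw [d.fdU (hn2 z hz).2]; ring
  · rw [image_eq_zero_of_notMem_tsupport hz]; simp

lemma iJw (w : ℂ) {c : ℂ → ℝ} (hc : Continuous c) (hs : HasCompactSupport c) : Integrable fun z => c z * ⟪J z, w⟫ :=
  icm (d.iJ.inner_const w) hc hs

/-- vector version of `limL` -/
lemma limV {c1 c2 : ℂ → ℝ} (h1 : Continuous c1) (s1 : HasCompactSupport c1) (g1 : tsupport c1 ⊆ GS U)
    (h2 : Continuous c2) (s2 : HasCompactSupport c2) (g2 : tsupport c2 ⊆ GS U) :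
    Tendsto (fun n => ∫ z, ((c1 z : ℂ) * (fderiv ℝ (mol n U) z 1 / mol n U z) +
      (c2 z : ℂ) * (fderiv ℝ (mol n U) z I / mol n U z))) atTop
      (𝓝 (I * ((∫ z, (c1 z * ⟪J z, 1⟫ + c2 z * ⟪J z, I⟫) : ℝ) : ℂ))) := by
  have T := (d.limL h1 s1 g1 1).add (d.limL h2 s2 g2 I)
  have e : (∫ z, (c1 z : ℂ) * (I * ((⟪J z, 1⟫ : ℝ) : ℂ))) + ∫ z, (c2 z : ℂ) * (I * ((⟪J z, I⟫ : ℝ) : ℂ)) =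
      I * ((∫ z, (c1 z * ⟪J z, 1⟫ + c2 z * ⟪J z, I⟫) : ℝ) : ℂ) := by
    rw [integral_add (d.iJw 1 h1 s1) (d.iJw I h2 s2)]
    rw [Complex.ofReal_add, ← integral_complex_ofReal, ← integral_complex_ofReal, mul_add, ← integral_const_mul, ← integral_const_mul]
    congr 2 <;> (ext z; push_cast; ring)
  rw [e] at T
  refine T.congr' ?_
  filter_upwards [GS_compact s1 g1, GS_compact s2 g2] with n a1 a2
  have hg := mol_smooth d.iU n
  have hf := fun v : ℂ => (hg.continuous_fderiv (by simp)).clm_apply (continuous_const (y := v))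
  have ii : ∀ {c : ℂ → ℝ} (v : ℂ), Continuous c → HasCompactSupport c → (∀ z ∈ tsupport c, 1 / 2 ≤ ‖mol n U z‖ ∧ ‖z‖ + en n < 2) →
      Integrable fun z => (c z : ℂ) * (fderiv ℝ (mol n U) z v / mol n U z) := by
    intro c v hc hs ha
    refine (cont_div (Complex.continuous_ofReal.comp hc) (hf v) hg.continuous fun z hz h0 => ?_).integrable_of_hasCompactSupport
      (hs.comp_left (g := Complex.ofReal) rfl).mul_right
    have := (ha z (tsupport_comp_subset Complex.ofReal_zero c hz)).1
    rw [h0] at this; norm_num at this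
  exact (integral_add (ii 1 h1 s1 a1) (ii I h2 s2 a2)).symm

lemma closedJ {f : ℂ → ℝ} (hf : IsTest (ball 0 2) f) (hG : tsupport f ⊆ GS U) : ∫ z, fderiv ℝ f z (I * J z) = 0 := by
  have hfc := hf.1.continuous_fderiv (by simp)
  have k : ∀ v, Continuous (fun z => fderiv ℝ f z v) ∧ HasCompactSupport (fun z => fderiv ℝ f z v) ∧
      tsupport (fun z => fderiv ℝ f z v) ⊆ GS U := fun v =>
    ⟨hfc.clm_apply continuous_const, hf.2.1.fderiv_apply ℝ v, (tsupport_fderiv_apply_subset ℝ v).trans hG⟩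
  have T := d.limV (k I).1 (k I).2.1 (k I).2.2 (c2 := fun z => -fderiv ℝ f z 1) (k 1).1.neg
    ((k 1).2.1.comp_left (g := fun x => -x) neg_zero)
    ((tsupport_comp_subset (g := fun x : ℝ => -x) neg_zero (fun z => fderiv ℝ f z 1)).trans (k 1).2.2)
  have e : ∫ z, (fderiv ℝ f z I * ⟪J z, 1⟫ + -fderiv ℝ f z 1 * ⟪J z, I⟫) = ∫ z, fderiv ℝ f z (I * J z) := by
    congr 1; ext z
    have : I * J z = (J z).re • I - (J z).im • (1 : ℂ) := by
      apply Complex.ext <;> simp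
    rw [this, map_sub, map_smul, map_smul, inC, inC]; simp; ring
  rw [e] at T
  have T0 := tendsto_nhds_unique T ((tendsto_const_nhds (x := zC)).congr' ?_)
  · simpa using T0
  filter_upwards [GS_compact hf.2.1 hG] with n hn
  have hg := mol_smooth d.iU n
  set g := mol n U
  have g0 : ∀ z ∈ tsupport f, g z ≠ 0 := fun z hz h0 => by
    have := (hn z hz).1; rw [h0] at this; norm_num at this
  set H : ℂ → ℂ := fun z => f z * (g z)⁻¹
  have hH0 : ∀ z ∉ tsupport f, H =ᶠ[𝓝 z] fun _ => 0 := fun z hz => by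
    filter_upwards [(isClosed_tsupport f).isOpen_compl.mem_nhds hz] with x hx
    simp only [H, image_eq_zero_of_notMem_tsupport hx]; simp
  have hH : ContDiff ℝ (⊤ : ℕ∞) H := by
    refine contDiff_iff_contDiffAt.2 fun z => ?_
    by_cases hz : z ∈ tsupport f
    · exact ContDiffAt.mul (Complex.ofRealCLM.contDiff.comp hf.1).contDiffAt (hg.contDiffAt.inv (g0 z hz))
    · exact contDiffAt_const.congr_of_eventuallyEq (hH0 z hz)
  have hs : HasCompactSupport H := HasCompactSupport.intro' hf.2.1 (isClosed_tsupport f) fun z hz => (hH0 z hz).self_of_nhds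
  rw [← curl0 hH hs hg]
  congr 1; ext z
  by_cases hz : z ∈ tsupport f
  · have e2 : (fun z => (f z : ℂ)) =ᶠ[𝓝 z] fun z => H z * g z := by
      filter_upwards [hg.continuous.continuousAt.eventually_ne (g0 z hz)] with x hx
      simp only [H]; field_simp
    have e3 : ∀ v, ((fderiv ℝ f z v : ℝ) : ℂ) = H z * fderiv ℝ g z v + g z * fderiv ℝ H z v := by
      intro v
      have h1 : HasFDerivAt (fun z => (f z : ℂ)) _ z :=
        Complex.ofRealCLM.hasFDerivAt.comp z (hf.1.differentiable (by simp) z).hasFDerivAt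
      have h2 := ((hH.differentiable (by simp) z).hasFDerivAt.mul (hg.differentiable (by simp) z).hasFDerivAt).congr_of_eventuallyEq e2
      have := congrArg (fun L => L v) (h1.unique h2)
      simpa using this
    push_cast
    rw [e3, e3]; have := g0 z hz; field_simp; ring
  · have h1 : fderiv ℝ f z = 0 := by
      by_contra h; exact hz (tsupport_fderiv_subset ℝ (subset_tsupport _ h))
    have h2 : fderiv ℝ H z = 0 := by rw [(hH0 z hz).fderiv_eq]; simp
    simp [h1, h2]

lemma degree {y : ℂ} {r1 r2 : ℝ} (hr : 0 < r1) (h12 : r1 < r2) (hA : ∀ z, r1 ≤ nb z y → nb z y ≤ r2 → z ∈ GS U) :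
    ∃ κ : ℤ, ∀ b : ℝ → ℝ, (Continuous fun z : ℂ => b nb z y) → (∀ t, b t ≠ 0 → r1 ≤ t ∧ t ≤ r2) →
      ∫ z, b nb z y * jt J z z y = κ * ∫ z, b nb z y := by
  set A : Set ℂ := {z | r1 ≤ nb z y ∧ nb z y ≤ r2}
  have hAc : IsCompact A := by
    refine (isCompact_closedBall y r2).of_isClosed_subset ?_ fun z hz => by
      rw [mem_closedBall, dist_eq_norm]; exact hz.2
    exact isClosed_Icc.preimage (by fun_prop : Continuous fun z : ℂ => nb z y)
  have ev := GS_compact hAc fun z hz => hA z hz.1 hz.2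
  have ex : ∀ n, ∃ k : ℤ, (∀ z ∈ A, 1 / 2 ≤ ‖mol n U z‖ ∧ ‖z‖ + en n < 2) → ∀ z, r1 ≤ nb z y → nb z y ≤ r2 →
      ∫ α in zR..2 * π, fderiv ℝ (mol n U) (rot y α z) (I * (rot y α z - y)) / mol n U (rot y α z) = k * (2 * π * I) := by
    intro n
    by_cases h : ∀ z ∈ A, 1 / 2 ≤ ‖mol n U z‖ ∧ ‖z‖ + en n < 2
    · obtain ⟨k, hk⟩ := wind_const ((mol_smooth d.iU n).of_le (by norm_cast)) h12.le (y := y) (fun z h1 h2 h0 => by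
        have := (h z ⟨h1, h2⟩).1; rw [h0] at this; norm_num at this) hr
      exact ⟨k, fun _ => hk⟩
    · exact ⟨0, fun h' => absurd h' h⟩
  choose k hk using ex
  have main : ∀ b : ℝ → ℝ, (Continuous fun z : ℂ => b nb z y) → (∀ t, b t ≠ 0 → r1 ≤ t ∧ t ≤ r2) →
      Tendsto (fun n => (k n : ℝ) * ∫ z, b nb z y) atTop (𝓝 (∫ z, b nb z y * jt J z z y)) := by
    intro b hb hb0
    have tsA : tsupport (fun z => b nb z y) ⊆ A := closure_minimal (fun z hz => hb0 _ hz) hAc.isClosed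
    have sup : ∀ c : ℂ → ℝ, tsupport (fun z => b nb z y * c z) ⊆ A := fun c => (tsupport_mul_subset_left).trans tsA
    have cs : ∀ c : ℂ → ℝ, HasCompactSupport (fun z => b nb z y * c z) := fun c =>
      hAc.of_isClosed_subset (isClosed_tsupport _) (sup c)
    have sG : ∀ c : ℂ → ℝ, tsupport (fun z => b nb z y * c z) ⊆ GS U := fun c => (sup c).trans fun z hz => hA z hz.1 hz.2
    have T := d.limV (c1 := fun z => b nb z y * -(z - y).im) (hb.mul fP) (cs _) (sG _)
      (c2 := fun z => b nb z y * (z - y).re) (hb.mul fP) (cs _) (sG _)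
    have e : ∫ z, (b nb z y * -(z - y).im * ⟪J z, 1⟫ + b nb z y * (z - y).re * ⟪J z, I⟫) =
        ∫ z, b nb z y * jt J z z y := by
      congr 1; ext z; simp only [inC]; simp; ring
    rw [e] at T
    have T2 := (Complex.continuous_im.tendsto _).comp T
    rw [Complex.I_mul_im, Complex.ofReal_re] at T2
    refine T2.congr' ?_
    filter_upwards [ev] with n hn
    have hg := mol_smooth d.iU n
    set g := mol n U
    have g0 : ∀ z ∈ A, g z ≠ 0 := fun z hz h0 => by
      have := (hn z hz).1; rw [h0] at this; norm_num at this
    have e1 : ∀ z, ((b nb z y * -(z - y).im : ℝ) : ℂ) * (fderiv ℝ g z 1 / g z) +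
        ((b nb z y * (z - y).re : ℝ) : ℂ) * (fderiv ℝ g z I / g z) = (b nb z y : ℂ) * (fderiv ℝ g z (I * (z - y)) / g z) := by
      intro z
      have : I * (z - y) = -(z - y).im • (1 : ℂ) + (z - y).re • I := by apply Complex.ext <;> simp
      rw [this, map_add, map_smul, map_smul]; simp only [Complex.real_smul]; push_cast; ring
    have ct : Continuous fun z => (b nb z y : ℂ) * (fderiv ℝ g z (I * (z - y)) / g z) :=
      cont_div (Complex.continuous_ofReal.comp hb) ((hg.continuous_fderiv (by simp)).clm_apply fP) hg.continuous
        fun z hz => g0 z (tsA (tsupport_comp_subset Complex.ofReal_zero (fun z => b nb z y) hz))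
    have cst : HasCompactSupport fun z => (b nb z y : ℂ) * (fderiv ℝ g z (I * (z - y)) / g z) := by
      refine HasCompactSupport.mul_right (HasCompactSupport.comp_left (f := fun z => b nb z y) (g := Complex.ofReal) ?_ rfl)
      exact hAc.of_isClosed_subset (isClosed_tsupport _) tsA
    have ra := rot_avg ct cst y
    have e2 : ∀ z, ∫ α in zR..2 * π, (b ‖rot y α z - y‖ : ℂ) * (fderiv ℝ g (rot y α z) (I * (rot y α z - y)) / g (rot y α z))
        = (b nb z y : ℂ) * (k n * (2 * π * I)) := by
      intro z
      simp_rw [rot_norm]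
      rw [intervalIntegral.integral_const_mul]
      by_cases hz : b nb z y = 0
      · simp [hz]
      · rw [hk n hn z (hb0 _ hz).1 (hb0 _ hz).2]
    simp_rw [e2] at ra
    rw [integral_mul_const, integral_complex_ofReal] at ra
    show (∫ z, (((b nb z y * -(z - y).im : ℝ) : ℂ) * (fderiv ℝ g z 1 / g z) +
        ((b nb z y * (z - y).re : ℝ) : ℂ) * (fderiv ℝ g z I / g z))).im = _
    simp_rw [e1]
    have hpi : (2 * π : ℂ) ≠ 0 := by have := Real.pi_ne_zero; norm_cast; positivity
    have e3 : ∫ z, (b nb z y : ℂ) * (fderiv ℝ g z (I * (z - y)) / g z) = (((k n : ℝ) * ∫ z, b nb z y : ℝ) : ℂ) * I := by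
      apply mul_left_cancel₀ hpi
      rw [Complex.real_smul] at ra; push_cast at ra ⊢; rw [← ra]; ring
    rw [e3]; simp
  set b0 : ℝ → ℝ := fun t => max 0 ((t - r1) * (r2 - t))
  have b0c : Continuous fun z : ℂ => b0 nb z y := by fun_prop
  have b0s : ∀ t, b0 t ≠ 0 → r1 ≤ t ∧ t ≤ r2 := by
    intro t ht
    have : 0 < (t - r1) * (r2 - t) := by
      by_contra h; exact ht (max_eq_left lN)
    constructor <;> nlinarith
  have B0 : 0 < ∫ z : ℂ, b0 nb z y := by
    refine b0c.integral_pos_of_hasCompactSupport_nonneg_nonzero (x := y + ((r1 + r2) / 2 : ℝ))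
      (hAc.of_isClosed_subset (isClosed_tsupport _) (closure_minimal (fun z hz => b0s _ hz) hAc.isClosed)) (fun z => le_max_left _ _) ?_
    have : ‖y + (((r1 + r2) / 2 : ℝ) : ℂ) - y‖ = (r1 + r2) / 2 := by
      rw [add_sub_cancel_left, Complex.norm_real, Real.norm_of_nonneg lN]
    rw [this]; simp only [b0]
    have h3 : 0 < ((r1 + r2) / 2 - r1) * (r2 - (r1 + r2) / 2) := mul_pos lN lN
    rw [max_eq_right h3.le]; exact h3.ne'
  have T0 := (main b0 b0c b0s).div_const (∫ z, b0 nb z y)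
  simp_rw [mul_div_assoc, div_self B0.ne', mul_one] at T0
  obtain ⟨κ, hκ⟩ := Int.isClosedEmbedding_coe_real.isClosed_range.mem_of_tendsto T0
    (eF fun n => mem_range_self (k n))
  rw [← hκ] at T0
  exact ⟨κ, fun b hb hb0 => tendsto_nhds_unique (main b hb hb0) (T0.mul_const _)⟩
end Dat
end

open MeasureTheory Metric Filter Topology Set
open scoped ENNReal NNReal Convolution
noncomputable section
open Complex (I)

def IsPot (G : ℂ → ℂ) (φ : ℂ → ℝ) : Prop :=
  ContDiff ℝ (⊤ : ℕ∞) φ ∧ HasCompactSupport φ ∧ ∀ z v, ‖z‖ < 9 / 10 → fderiv ℝ φ z v = ⟪I * G z, v⟫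

lemma rI (a v : ℂ) : ⟪a, v⟫ = v.re * ⟪a, 1⟫ + v.im * ⟪a, I⟫ := by simp only [inC]; simp; ring

lemma Dat.pot {p : ℝ} {U J : ℂ → ℂ} (d : Dat p U J) : ∀ᶠ n in atTop, ∃ φ, IsPot (mol n (Fl p J)) φ := by
  filter_upwards [en_ev (a := 1) nU] with n hn
  have hG := mol_smooth d.iF n
  have hdiv : ∀ z, ‖z‖ < 1 → (fderiv ℝ (mol n (Fl p J)) z 1).re + (fderiv ℝ (mol n (Fl p J)) z I).im = 0 := by
    intro z hz
    have hc : ∀ v, Continuous fun t => fderiv ℝ (rn n) (z - t) v := fun v =>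
      (((rn_smooth n).continuous_fderiv (by simp)).comp fP).clm_apply continuous_const
    have hs : ∀ v, HasCompactSupport fun t => fderiv ℝ (rn n) (z - t) v := fun v =>
      ((rn_cs n).fderiv_apply ℝ v).comp_homeomorph (Homeomorph.subLeft z)
    have i : ∀ v, Integrable fun t => fderiv ℝ (rn n) (z - t) v • Fl p J t := fun v => icc d.iF (hc v) (hs v)
    have i1 : Integrable fun t => (fderiv ℝ (rn n) (z - t) 1 • Fl p J t).re := (i 1).re
    have i2 : Integrable fun t => (fderiv ℝ (rn n) (z - t) I • Fl p J t).im := (i I).im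
    have a1 : (∫ t, fderiv ℝ (rn n) (z - t) 1 • Fl p J t).re = ∫ t, (fderiv ℝ (rn n) (z - t) 1 • Fl p J t).re := (integral_re (i 1)).symm
    have a2 : (∫ t, fderiv ℝ (rn n) (z - t) I • Fl p J t).im = ∫ t, (fderiv ℝ (rn n) (z - t) I • Fl p J t).im := (integral_im (i I)).symm
    rw [mol_fd d.iF, mol_fd d.iF, a1, a2, ← integral_add i1 i2]
    have := d.pharm _ (rz_test (n := n) (z := z) lN)
    rw [← neg_eq_zero, ← integral_neg, ← this]
    congr 1; ext t
    rw [rz_fd]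
    have e : J t = (J t).re • (1 : ℂ) + (J t).im • I := by apply Complex.ext <;> simp
    have e2 : fderiv ℝ (rn n) (z - t) (J t) = (J t).re * fderiv ℝ (rn n) (z - t) 1 + (J t).im * fderiv ℝ (rn n) (z - t) I := by
      conv_lhs => rw [e]
      rw [map_add, map_smul, map_smul]; rfl
    rw [e2, Fl]; simp; ring
  set ω : ℂ → ℂ →L[ℝ] ℝ := fun z => innerSL ℝ (I * mol n (Fl p J) z)
  have hω : ContDiff ℝ (⊤ : ℕ∞) ω := (innerSL ℝ).contDiff.comp (contDiff_const.mul hG)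
  have hωd : ∀ z x, fderiv ℝ ω z x = innerSL ℝ (I * fderiv ℝ (mol n (Fl p J)) z x) := fun z x => by
    have h1 := ((innerSL ℝ (E := ℂ)).hasFDerivAt.comp z
      ((hG.differentiable (by simp) z).hasFDerivAt.const_mul I))
    have : fderiv ℝ ω z = _ := h1.fderiv
    rw [this]; simp
  obtain ⟨f, hf⟩ := (convex_ball zC 1).exists_forall_hasFDerivAt_of_fderiv_symmetric isOpen_ball
    (hω.differentiable (by simp)).differentiableOn (fun a ha x y => by
      have h0 := hdiv a (by simpa using ha)
      have e : ∀ v, fderiv ℝ (mol n (Fl p J)) a v = v.re * fderiv ℝ (mol n (Fl p J)) a 1 + v.im * fderiv ℝ (mol n (Fl p J)) a I := fun v => by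
        have e1 : v = v.re • (1 : ℂ) + v.im • I := by apply Complex.ext <;> simp
        conv_lhs => rw [e1]
        rw [map_add, map_smul, map_smul]; simp
      rw [hωd, hωd, innerSL_apply_apply, innerSL_apply_apply, e x, e y, inC, inC]
      simp; linear_combination (x.re * y.im - x.im * y.re) * h0)
  have hfs : ContDiffOn ℝ (⊤ : ℕ∞) f (ball 0 1) := by
    rw [contDiffOn_infty_iff_fderiv_of_isOpen isOpen_ball]
    exact ⟨fun z hz => (hf z hz).differentiableAt.differentiableWithinAt,
      hω.contDiffOn.congr fun z hz => (hf z hz).fderiv⟩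
  set c := (⟨9 / 10, 19 / 20, by norm_num, by norm_num⟩ : ContDiffBump zC)
  have hcz : ∀ z, z ∉ ball zC 1 → (fun z => c z * f z) =ᶠ[𝓝 z] fun _ => 0 := fun z hz => by
    have : z ∉ tsupport c := by
      rw [c.tsupport_eq]; intro h; apply hz; simp only [mem_ball, mem_closedBall] at *
      exact h.trans_lt (by norm_num [c])
    filter_upwards [(isClosed_tsupport c).isOpen_compl.mem_nhds this] with x hx
    simp [image_eq_zero_of_notMem_tsupport hx]
  refine ⟨fun z => c z * f z, contDiff_iff_contDiffAt.2 fun z => ?_, c.hasCompactSupport.mul_right, fun z v hz => ?_⟩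
  · by_cases hz : z ∈ ball zC 1
    · exact c.contDiff.contDiffAt.mul (hfs.contDiffAt (isOpen_ball.mem_nhds hz))
    · exact contDiffAt_const.congr_of_eventuallyEq (hcz z hz)
  · have h1 : (fun z => c z * f z) =ᶠ[𝓝 z] f := by
      filter_upwards [isOpen_ball.mem_nhds (show z ∈ ball zC (9 / 10) by simpa using hz)] with x hx
      rw [c.one_of_mem_closedBall (ball_subset_closedBall hx), one_mul]
    rw [h1.fderiv_eq, (hf z (by simp; linarith)).fderiv]; rfl

lemma inner_I_mul (a b : ℂ) : ⟪I * a, I * b⟫ = ⟪a, b⟫ := by simp only [inC]; simp; ring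

lemma rotI {φ : ℂ → ℝ} (y z : ℂ) :
    ∫ α in zR..2 * π, φ (rot y α z) = ∫ α in zR..2 * π, φ (y + Complex.exp (α * I) * nb z y) := by
  set h : ℝ → ℝ := fun α => φ (y + Complex.exp (α * I) * nb z y)
  have hp : Function.Periodic h (2 * π) := fun α => by
    simp only [h]; push_cast; rw [add_mul, Complex.exp_add, Complex.exp_two_pi_mul_I, mul_one]
  have e : ∀ α : ℝ, φ (rot y α z) = h (α + (z - y).arg) := fun α => by
    simp only [h, rot]; congr 2
    conv_lhs => rw [← Complex.norm_mul_exp_arg_mul_I (z - y)]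
    push_cast; rw [add_mul, Complex.exp_add]; ring
  simp_rw [e]
  rw [intervalIntegral.integral_comp_add_right, zero_add, add_comm (2 * π)]
  simpa using hp.intervalIntegral_add_eq (z - y).arg 0

lemma rot_diff {G : ℂ → ℂ} {φ : ℂ → ℝ} (h : IsPot G φ) (hG : Continuous G) {y z : ℂ} (hz : ‖y‖ + nb z y < 9 / 10)
    {β : ℝ} (hβ : β ∈ Icc 0 (2 * π)) :
    |φ (rot y β z) - φ z| ≤ nb z y * ∫ α in zR..2 * π, ‖G (rot y α z)‖ := by
  have hr : ∀ α : ℝ, HasDerivAt (fun α : ℝ => rot y α z) (I * (rot y α z - y)) α := fun α => by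
    have h1 : HasDerivAt (fun α : ℝ => (α : ℂ) * I) I α := by simpa using (Complex.ofRealCLM.hasDerivAt (x := α)).mul_const I
    refine ((h1.cexp.mul_const (z - y)).const_add y).congr_deriv ?_
    rw [rot_sub]; ring
  have hrc : Continuous fun α : ℝ => rot y α z := continuous_iff_continuousAt.2 fun α => (hr α).continuousAt
  have hd : ∀ α : ℝ, HasDerivAt (fun α => φ (rot y α z)) ⟪G (rot y α z), rot y α z - y⟫ α := fun α => by
    refine ((h.1.differentiable (by simp) _).hasFDerivAt.comp_hasDerivAt α (hr α)).congr_deriv ?_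
    rw [h.2.2 _ _ ?_, inner_I_mul]
    have := norm_add_le (rot y α z - y) y
    rw [rot_norm, sub_add_cancel] at this; linarith
  have hdc : Continuous fun α => ⟪G (rot y α z), rot y α z - y⟫ := (hG.comp hrc).inner (hrc.sub continuous_const)
  have e0 : rot y 0 z = z := by simp [rot]
  have e1 := intervalIntegral.integral_eq_sub_of_hasDerivAt (a := 0) (b := β) (fun α _ => hd α) (hdc.intervalIntegrable (μ := volume) _ _)
  have hc : Continuous fun α => nb z y * ‖G (rot y α z)‖ := continuous_const.mul (hG.comp hrc).norm
  rw [e0] at e1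
  rw [← e1, ← intervalIntegral.integral_const_mul, ← Real.norm_eq_abs]
  refine (intervalIntegral.norm_integral_le_of_norm_le (g := fun α => nb z y * ‖G (rot y α z)‖) hβ.1
    (eF fun α _ => ?_) (hc.intervalIntegrable (μ := volume) _ _)).trans ?_
  · refine (norm_inner_le_norm _ _).trans ?_
    rw [rot_norm, mul_comm]
  · rw [← intervalIntegral.integral_add_adjacent_intervals (b := β) (hc.intervalIntegrable (μ := volume) 0 β) (hc.intervalIntegrable β (2 * π))]
    have : 0 ≤ ∫ α in β..2 * π, nb z y * ‖G (rot y α z)‖ :=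
      intervalIntegral.integral_nonneg hβ.2 fun α _ => by positivity
    linarith

lemma young2 {p a b : ℝ} (hp : 1 < p) (ha : 0 ≤ a) (hb : 0 ≤ b) : a * b ≤ a ^ p + b ^ pc p := by
  have hq : p.HolderConjugate pc p := Real.HolderConjugate.conjExponent hp
  have := Real.young_inequality_of_nonneg ha hb hq
  have h1 : a ^ p / p ≤ a ^ p := div_le_self pV hp.le
  have h2 : b ^ pc p / pc p ≤ b ^ pc p := div_le_self pV hq.symm.lt.le
  linarith

namespace Dat
variable {p : ℝ} {U J : ℂ → ℂ} (d : Dat p U J) {y : ℂ} {r : ℝ}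
include d

/-- test function against the tangential part of `J` on a dyadic annulus -/
lemma err (hr : 0 < r) (hy : ‖y‖ + 2 * r < 9 / 10) {r1 r2 : ℝ} (h1 : r1 ≤ r) (h2 : 2 * r ≤ r2) {κ : ℤ}
    (hκ : ∀ b : ℝ → ℝ, (Continuous fun z : ℂ => b nb z y) → (∀ t, b t ≠ 0 → r1 ≤ t ∧ t ≤ r2) →
      ∫ z, b nb z y * jt J z z y = κ * ∫ z, b nb z y) {G : ℂ → ℂ} (hG : Continuous G) {φ : ℂ → ℝ} (hφ : IsPot G φ) :
    |(∫ z, Pc y r z * φ z * jt J z z y) - κ * ∫ z, Pc y r z * φ z| ≤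
      2 * π * (De p J y r + ∫ z, Pq y r z * na G z ^ pc p) := by
  have p1 := d.p1
  have hpi := Real.pi_pos
  have hφc := hφ.1.continuous
  have hq : 0 ≤ p / (p - 1) := div_nonneg lN lN
  set A : ℝ → ℝ := fun t => (2 * π)⁻¹ * ∫ α in zR..2 * π, φ (y + Complex.exp (α * I) * t)
  set b : ℝ → ℝ := fun t => 2 / r ^ 2 * pe (max t 0 ^ 2 / r ^ 2) * A t
  have hAc : Continuous A := by
    refine continuous_const.mul (intervalIntegral.continuous_parametric_intervalIntegral_of_continuous' ?_ _ _)
    exact hφc.comp fP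
  have bA : ∀ z, b nb z y = Pc y r z * A nb z y := fun z => by simp only [b, Pc, max_eq_left nN]
  have hAr : ∀ z, A nb z y = (2 * π)⁻¹ * ∫ α in zR..2 * π, φ (rot y α z) := fun z => by
    simp only [A]; rw [rotI]
  have hAz : Continuous fun z : ℂ => A nb z y := hAc.comp fP
  have hrot : ∀ (α : ℝ) z, Pc y r (rot y α z) = Pc y r z := fun α z => by simp only [Pc, rot_norm]
  have hb := hκ b (by simp_rw [bA]; exact Pc_cont.mul hAz) (fun t ht => by
    have hp : pe (max t 0 ^ 2 / r ^ 2) ≠ 0 := fun h => ht (by simp [b, h])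
    have hm : ‖(y + (max t 0 : ℝ)) - y‖ = max t 0 := by
      rw [add_sub_cancel_left, Complex.norm_real, Real.norm_of_nonneg (le_max_right _ _)]
    have hP : Pc y r (y + (max t 0 : ℝ)) ≠ 0 := by rw [Pc, hm]; exact mul_ne_zero pV hp
    have := Pc_supp hr hP
    rw [hm] at this
    rcases max_choice t 0 with h | h <;> rw [h] at this <;> constructor <;> linarith)
  have cs : ∀ c : ℂ → ℝ, HasCompactSupport fun z => Pc y r z * c z := fun c => (Pc_cs hr).mul_right
  have e1 : ∫ z, b nb z y = ∫ z, Pc y r z * φ z := by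
    have := rot_avg (c := fun z => Pc y r z * φ z) (Pc_cont.mul hφc) (cs φ) y
    simp only [hrot, intervalIntegral.integral_const_mul] at this
    have e : ∀ z, b nb z y = (2 * π)⁻¹ * (Pc y r z * ∫ α in zR..2 * π, φ (rot y α z)) := fun z => by
      rw [bA, hAr]; ring
    simp_rw [e]
    rw [integral_const_mul, this, smul_eq_mul]; field_simp
  have iw : ∀ c : ℂ → ℝ, Continuous c → Integrable fun z => Pc y r z * c z * jt J z z y := fun c hc => by
    have : ∀ z, Pc y r z * c z * jt J z z y = (Pc y r z * (c z * -(z - y).im)) * (J z).re + (Pc y r z * (c z * (z - y).re)) * (J z).im := fun z => by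
      rw [inC]; simp; ring
    rw [show (fun z => Pc y r z * c z * jt J z z y) = _ from funext this]
    exact (icm d.iJ.re (Pc_cont.mul (hc.mul fP)) (cs _)).add (icm d.iJ.im (Pc_cont.mul (hc.mul fP)) (cs _))
  rw [← e1, ← hb]
  simp_rw [bA]
  rw [← integral_sub (iw φ hφc) (iw _ hAz)]
  have hGq : Continuous fun z => na G z ^ pc p := hG.norm.rpow_const fun z => Or.inr hq
  have hGc : Continuous fun z => Pq y r z * na G z ^ pc p := (Pc_cont.mul fP).mul hGq
  have hGs : HasCompactSupport fun z => Pq y r z * na G z ^ pc p := (Pc_cs hr).mul_right.mul_right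
  have ra := rot_avg (c := fun z => Pq y r z * na G z ^ pc p) hGc hGs y
  have hrc : ∀ z, Continuous fun α : ℝ => rot y α z := fun z => (rot_cont y).comp (by fun_prop : Continuous fun α : ℝ => (z, α))
  set B : ℂ → ℝ := fun z => ∫ α in zR..2 * π, Pc y r (rot y α z) * ‖rot y α z - y‖ ^ 2 * ‖G (rot y α z)‖ ^ pc p
  have hBc : Continuous B := intervalIntegral.continuous_parametric_intervalIntegral_of_continuous'
    (f := fun z α => Pc y r (rot y α z) * ‖rot y α z - y‖ ^ 2 * ‖G (rot y α z)‖ ^ pc p) (hGc.comp (rot_cont y)) _ _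
  have hBe : ∀ z, B z = Pc y r z * (nb z y ^ 2 * ∫ α in zR..2 * π, ‖G (rot y α z)‖ ^ pc p) := fun z => by
    simp only [B, hrot, rot_norm]; rw [intervalIntegral.integral_const_mul, mul_assoc]
  have hBi : Integrable B := hBc.integrable_of_hasCompactSupport (by
    rw [show B = _ from funext hBe]; exact cs _)
  have hD := (d.iP (y := y) hr).const_mul (2 * π)
  rw [← Real.norm_eq_abs]
  refine (norm_integral_le_of_norm_le (g := fun z => 2 * π * (Pq y r z * na J z ^ p) + B z) (hD.add hBi)
    (eF fun z => ?_)).trans (le_of_eq ?_)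
  · rw [← sub_mul, ← mul_sub, norm_mul, norm_mul, Real.norm_of_nonneg Pc_nonneg, hBe]
    by_cases hP : Pc y r z = 0
    · simp [hP]
    have hz := (Pc_supp hr hP).2
    have hGr : Continuous fun α => ‖G (rot y α z)‖ := (hG.comp (hrc z)).norm
    have k1 : |φ z - A nb z y| ≤ nb z y * ∫ α in zR..2 * π, ‖G (rot y α z)‖ := by
      have : φ z - A nb z y = (2 * π)⁻¹ * ∫ α in zR..2 * π, (φ z - φ (rot y α z)) := by
        have i0 : IntervalIntegrable (fun α => φ (rot y α z)) volume 0 (2 * π) := (hφc.comp (hrc z)).intervalIntegrable _ _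
        rw [hAr, intervalIntegral.integral_sub (by simp) i0]
        simp; field_simp
      rw [this, abs_mul, abs_of_pos pV, inv_mul_le_iff₀ pV, ← Real.norm_eq_abs]
      refine (intervalIntegral.norm_integral_le_of_norm_le_const (C := nb z y * ∫ α in zR..2 * π, ‖G (rot y α z)‖) fun α hα => ?_).trans (le_of_eq ?_)
      · rw [uIoc_of_le pV] at hα
        rw [Real.norm_eq_abs, abs_sub_comm]
        exact rot_diff hφ hG lN ⟨hα.1.le, hα.2⟩
      · rw [sub_zero, abs_of_pos pV]; ring
    have k2 : ‖jt J z z y‖ ≤ na J z * nb z y := by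
      refine (norm_inner_le_norm _ _).trans ?_; rw [norm_mul]; simp
    have k3 : na J z * ∫ α in zR..2 * π, ‖G (rot y α z)‖ ≤
        2 * π * na J z ^ p + ∫ α in zR..2 * π, ‖G (rot y α z)‖ ^ pc p := by
      rw [← intervalIntegral.integral_const_mul]
      have : 2 * π * na J z ^ p = ∫ α in zR..2 * π, na J z ^ p := by simp
      have i0 : IntervalIntegrable (fun α => ‖G (rot y α z)‖ ^ pc p) volume 0 (2 * π) := (hGq.comp (hrc z)).intervalIntegrable _ _
      rw [this, ← intervalIntegral.integral_add (by simp) i0]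
      exact intervalIntegral.integral_mono_on pV ((continuous_const.mul hGr).intervalIntegrable _ _)
        ((continuous_const.add (hGq.comp (hrc z))).intervalIntegrable _ _) fun α _ => young2 lN nN nN
    calc _ ≤ Pc y r z * (nb z y * ∫ α in zR..2 * π, ‖G (rot y α z)‖) * (na J z * nb z y) := by
          have hP0 := Pc_nonneg (y := y) (r := r) (z := z)
          have hP1 := mul_nonneg hP0 ((abs_nonneg _).trans k1)
          rw [Real.norm_eq_abs]
          gcongr
      _ = Pq y r z * (na J z * ∫ α in zR..2 * π, ‖G (rot y α z)‖) := by ring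
      _ ≤ Pq y r z * _ := mL k3 (mul_nonneg Pc_nonneg pV)
      _ = _ := by ring
  · rw [integral_add hD hBi, integral_const_mul, ra, De, smul_eq_mul]; ring
end Dat
end

open MeasureTheory Metric Filter Topology Set
open scoped ENNReal NNReal Convolution
noncomputable section
open Complex (I)

lemma dT {c : ℂ → ℝ} {a b : ℂ → ℂ} (hc : Continuous c) (hs : HasCompactSupport c) (ha : Continuous a) (hb : Continuous b)
    {φ : ℂ → ℝ} (hφ : ContDiff ℝ (⊤ : ℕ∞) φ) (hφs : HasCompactSupport φ) (t : ℝ) :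
    HasDerivAt (fun t : ℝ => ∫ s, c s * φ (a s + t • b s)) (∫ s, c s * fderiv ℝ φ (a s + t • b s) (b s)) t := by
  have hd := hφ.continuous_fderiv (by simp)
  obtain ⟨B, hB⟩ := (hφs.fderiv ℝ).exists_bound_of_continuous hd
  have hi : ∀ x : ℝ, Continuous fun s => c s * φ (a s + x • b s) := fun x =>
    hc.mul (hφ.continuous.comp (ha.add (hb.const_smul x)))
  refine (hasDerivAt_integral_of_dominated_loc_of_deriv_le (μ := volume) (s := univ) (F' := fun t s => c s * fderiv ℝ φ (a s + t • b s) (b s)) (bound := fun s => na c s * (B * na b s)) univ_mem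
    (eF fun x => (hi x).aestronglyMeasurable)
    ((hi t).integrable_of_hasCompactSupport hs.mul_right) ?_ ?_ ?_ ?_).2
  · exact (hc.mul ((hd.comp (ha.add (hb.const_smul t))).clm_apply hb)).aestronglyMeasurable
  · refine eF fun s x _ => ?_
    rw [norm_mul]
    gcongr
    exact (ContinuousLinearMap.le_opNorm _ _).trans (by gcongr; exact hB _)
  · exact (hc.norm.mul (continuous_const.mul hb.norm)).integrable_of_hasCompactSupport hs.norm.mul_right
  · refine eF fun s x _ => ?_
    have h1 : HasDerivAt (fun x : ℝ => a s + x • b s) (b s) x := by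
      simpa using ((hasDerivAt_id x).smul_const (b s)).const_add (a s)
    exact ((hφ.differentiable (by simp) _).hasFDerivAt.comp_hasDerivAt x h1).const_mul (c s)

lemma Pcv {r : ℝ} (hr : 0 < r) (y : ℂ) (g : ℂ → ℝ) : ∫ s, Pc 0 1 s * g (y + r • s) = ∫ z, Pc y r z * g z := by
  have e : ∀ s, Pc 0 1 s * g (y + r • s) = r ^ 2 * ((fun w => Pc y r (y + w) * g (y + w)) (r • s)) := fun s => by
    have : ‖r • s‖ ^ 2 / r ^ 2 = ‖s‖ ^ 2 := by rw [norm_smul, Real.norm_of_nonneg hr.le]; field_simp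
    simp only [Pc, add_sub_cancel_left, this]; simp; field_simp
  rw [integral_congr_ae (eF e), integral_const_mul, Measure.integral_comp_smul volume (fun w => Pc y r (y + w) * g (y + w)), integral_add_left_eq_self (fun z => Pc y r z * g z) y]
  rw [Complex.finrank_real_complex, abs_of_pos pV, smul_eq_mul, ← mul_assoc, mul_inv_cancel₀ pV, one_mul]

lemma PhiD {y : ℂ} {r1 r2 : ℝ} (h2 : 0 < r2) (h12 : r2 ≤ r1) (hy : ‖y‖ + 2 * r1 < 9 / 10) {G : ℂ → ℂ} {φ : ℂ → ℝ} (hφ : IsPot G φ) :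
    (∫ z, Pc y r1 z * φ z) - ∫ z, Pc y r2 z * φ z =
      ∫ z, Hd y r1 r2 z * (⟪I * G z, z - y⟫ / max nb z y r2 ^ 2) := by
  have hd := hφ.1.continuous_fderiv (by simp)
  have hm : ∀ z : ℂ, max nb z y r2 ^ 2 ≠ 0 := fun z => by have := lt_max_of_lt_right (b := nb z y) h2; positivity
  set k : ℂ → ℝ := fun z => fderiv ℝ φ z (z - y) / max nb z y r2 ^ 2
  have hk : Continuous k := (hd.clm_apply fP).div fP hm
  have hks : HasCompactSupport k := by
    refine (hφ.2.1.fderiv ℝ).mono' fun z hz => subset_tsupport _ fun h => hz ?_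
    simp [k, h]
  have hki := hk.integrable_of_hasCompactSupport (μ := volume) hks
  have D : ∀ r ∈ Icc r2 r1, HasDerivAt (fun r => (∫ z, Pc y r z * φ z) - ∫ z, Hc y r z * k z) 0 r := fun r hr => by
    have r0 : 0 < r := h2.trans_le hr.1
    have a1 : HasDerivAt (fun r => ∫ z, Pc y r z * φ z) (∫ s, Pc 0 1 s * fderiv ℝ φ (y + r • s) s) r := by
      refine (dT Pc_cont (Pc_cs one_pos) (continuous_const (y := y)) continuous_id hφ.1 hφ.2.1 r).congr_of_eventuallyEq ?_
      filter_upwards [lt_mem_nhds r0] with x hx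
      exact (Pcv hx y φ).symm
    have a2 := dI (y := y) hki r0
    refine (a1.sub a2).congr_deriv (sub_eq_zero.2 ?_)
    have := Pcv r0 y fun z => fderiv ℝ φ z (z - y)
    rw [eq_div_iff r0.ne', mul_comm, ← integral_const_mul]
    simp only [add_sub_cancel_left, map_smul, smul_eq_mul] at this
    rw [show (fun z => Pq y r z * k z) = fun z => Pc y r z * fderiv ℝ φ z (z - y) from funext fun z => ?_, ← this]
    · congr 1; ext s; ring
    · by_cases hP : Pc y r z = 0
      · simp [hP]
      have hz := (Pc_supp r0 hP).1
      simp only [k]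
      rw [max_eq_left (hr.1.trans hz.le)]
      have : nb z y ≠ 0 := by linarith
      field_simp
  have e := constant_of_has_deriv_right_zero (fun r hr => (D r hr).continuousAt.continuousWithinAt)
    (fun r hr => (D r ⟨hr.1, hr.2.le⟩).hasDerivWithinAt) r1 (right_mem_Icc.2 h12)
  have i1 := icm hki (Hc_cont (y := y) (r := r1)) (Hc_cs lN)
  have i2 := icm hki (Hc_cont (y := y) (r := r2)) (Hc_cs lN)
  have : (∫ z, Pc y r1 z * φ z) - ∫ z, Pc y r2 z * φ z = ∫ z, (Hc y r1 z * k z - Hc y r2 z * k z) := by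
    rw [integral_sub i1 i2]; linarith
  rw [this]
  congr 1; ext z
  by_cases hz : nb z y < 2 * r1
  · have : ‖z‖ < 9 / 10 := by have := norm_sub_norm_le z y; linarith
    simp only [k]; rw [hφ.2.2 z _ this]; ring
  · rw [Hc_zero lN (not_lt.1 hz), Hc_zero lN lN]; ring

lemma PhiT {y : ℂ} {r : ℝ} (hr : 0 < r) (hy : ‖y‖ + 2 * r < 9 / 10) {G : ℂ → ℂ} (hi : Integrable G) {φ : ℂ → ℝ} (hφ : IsPot G φ) :
    |(∫ z, Pc y r z * φ z) - ∫ z, Pc 0 r z * φ z| ≤ ‖y‖ * (Ck / r ^ 2) * ∫ z, na G z := by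
  have key := Convex.norm_image_sub_le_of_norm_hasDerivWithin_le (f := fun t : ℝ => ∫ s, Pc 0 1 s * φ (r • s + t • y))
    (C := ‖y‖ * (Ck / r ^ 2) * ∫ z, na G z) (s := Icc 0 1) (x := 0) (y := 1)
    (fun t _ => (dT Pc_cont (Pc_cs one_pos) (a := fun s => r • s) fP (continuous_const (y := y)) hφ.1 hφ.2.1 t).hasDerivWithinAt)
    (fun t ht => ?_) (convex_Icc _ _) (by simp) (by simp)
  · have e1 := Pcv hr y φ
    have e0 := Pcv hr 0 φ
    simp only [zero_add] at e0
    simpa only [one_smul, zero_smul, add_zero, add_comm _ y, e1, e0, sub_zero, norm_one, mul_one, Real.norm_eq_abs] using key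
  · have e := Pcv hr (t • y) fun z => fderiv ℝ φ z y
    simp only [add_comm (t • y)] at e
    rw [e, ← integral_const_mul]
    refine norm_integral_le_of_norm_le (hi.norm.const_mul _) (eF fun z => ?_)
    by_cases hP : Pc (t • y) r z = 0
    · simp only [hP, zero_mul, norm_zero]; have := Ck_pos; positivity
    have hz := (Pc_supp hr hP).2
    have : ‖z‖ < 9 / 10 := by
      have := norm_sub_norm_le z (t • y)
      have h : ‖t • y‖ ≤ ‖y‖ := by
        rw [norm_smul, Real.norm_of_nonneg ht.1]; exact mul_le_of_le_one_left nN ht.2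
      linarith
    rw [hφ.2.2 z _ this, norm_mul, Real.norm_of_nonneg Pc_nonneg]
    calc _ ≤ Ck / r ^ 2 * (na G z * ‖y‖) := by
          gcongr
          · have := Ck_pos; positivity
          · exact Pc_le hr
          · refine (norm_inner_le_norm _ _).trans ?_; rw [norm_mul]; simp
      _ = _ := by ring
end

open MeasureTheory Metric Filter Topology Set
open scoped ENNReal NNReal Convolution
noncomputable section
open Complex (I)

def Deg (J : ℂ → ℂ) (y : ℂ) (r1 r2 : ℝ) (κ : ℤ) : Prop :=
  ∀ b : ℝ → ℝ, (Continuous fun z : ℂ => b nb z y) → (∀ t, b t ≠ 0 → r1 ≤ t ∧ t ≤ r2) →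
      ∫ z, b nb z y * jt J z z y = κ * ∫ z, b nb z y
def Ze (y0 : ℂ) (r0 : ℝ) (Y : Finset ℂ) (ρ : ℂ → ℝ) (z : ℂ) : ℝ := Hc y0 r0 z - ∑ y ∈ Y, Hc y (ρ y) z

lemma Deg.mono {J : ℂ → ℂ} {y : ℂ} {r1 r2 s1 s2 : ℝ} {κ : ℤ} (h : Deg J y r1 r2 κ) (h1 : r1 ≤ s1) (h2 : s2 ≤ r2) : Deg J y s1 s2 κ :=
  fun b hb hs => h b hb fun t ht => ⟨h1.trans (hs t ht).1, (hs t ht).2.trans h2⟩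

lemma Deg.P {J : ℂ → ℂ} {y : ℂ} {r : ℝ} {κ : ℤ} (h : Deg J y r (2 * r) κ) (hr : 0 < r) :
    ∫ z, Pc y r z * jt J z z y = κ * (2 * π) := by
  have e : ∀ z, 2 / r ^ 2 * pe (max nb z y 0 ^ 2 / r ^ 2) = Pc y r z := fun z => by rw [Pc, max_eq_left nN]
  have := h (fun t => 2 / r ^ 2 * pe (max t 0 ^ 2 / r ^ 2)) (by simp_rw [e]; exact Pc_cont) fun t ht => by
    have hm : ‖(y + (max t 0 : ℝ)) - y‖ = max t 0 := by
      rw [add_sub_cancel_left, Complex.norm_real, Real.norm_of_nonneg (le_max_right _ _)]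
    have hP : Pc y r (y + (max t 0 : ℝ)) ≠ 0 := by rw [Pc, hm]; exact ht
    have := Pc_supp hr hP
    rw [hm] at this
    have h0 : 0 < t := by
      by_contra h0; rw [max_eq_right (not_lt.1 h0)] at this; linarith [this.1]
    rw [max_eq_left h0.le] at this
    exact ⟨this.1.le, this.2.le⟩
  simp only [e] at this
  rw [this, Pc_int hr]

namespace Dat
variable {p : ℝ} {U J : ℂ → ℂ} (d : Dat p U J)
include d

lemma iPJ {y : ℂ} {r : ℝ} (hr : 0 < r) {φ : ℂ → ℝ} (hφ : Continuous φ) : Integrable fun z => Pc y r z * φ z * jt J z z y := by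
  have h1 : Integrable fun z => (Pc y r z * φ z) • J z := icc d.iJ (Pc_cont.mul hφ) (Pc_cs hr).mul_right
  have h2 : Integrable fun z => (Pc y r z * φ z * nb z y) * na J z :=
    icm d.iJ.norm ((Pc_cont.mul hφ).mul fP) ((Pc_cs hr).mul_right.mul_right)
  refine h2.norm.mono' ((Pc_cont.mul hφ).aestronglyMeasurable.mul (d.mJ.inner fP)) (eF fun z => ?_)
  rw [norm_mul, norm_mul _ (na J z), norm_mul _ (nb z y), norm_norm, norm_norm, mul_assoc _ nb z y]
  gcongr
  refine (norm_inner_le_norm _ _).trans (le_of_eq ?_); rw [norm_mul]; simp [mul_comm]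

lemma ML {y0 : ℂ} {r0 : ℝ} {Y : Finset ℂ} {ρ : ℂ → ℝ} {κ : ℂ → ℤ} {κ0 : ℤ} (h0 : 0 < r0) (hy0 : ‖y0‖ + 2 * r0 < 9 / 10)
    (hρ : ∀ y ∈ Y, 0 < ρ y ∧ ‖y‖ + 2 * ρ y < 9 / 10 ∧ Deg J y (ρ y) (2 * ρ y) (κ y)) (hκ0 : Deg J y0 r0 (2 * r0) κ0)
    (hζ : tsupport (Ze y0 r0 Y ρ) ⊆ GS U) {G : ℂ → ℂ} (hG : Continuous G) {φ : ℂ → ℝ} (hφ : IsPot G φ) :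
    |(∫ z, Ze y0 r0 Y ρ z * ⟪J z, G z⟫) - ∑ y ∈ Y, κ y * ((∫ z, Pc y (ρ y) z * φ z) - ∫ z, Pc y0 r0 z * φ z)| ≤
      2 * π * ((De p J y0 r0 + ∫ z, Pq y0 r0 z * na G z ^ pc p) +
        ∑ y ∈ Y, (De p J y (ρ y) + ∫ z, Pc y (ρ y) z * nb z y ^ 2 * na G z ^ pc p)) := by
  set ζ := Ze y0 r0 Y ρ with hζd
  have sm : ContDiff ℝ (⊤ : ℕ∞) ζ := (Hc_smooth).sub (ContDiff.sum fun y _ => Hc_smooth)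
  have cs : HasCompactSupport ζ := by
    have : HasCompactSupport fun z => ∑ y ∈ Y, Hc y (ρ y) z := by
      refine HasCompactSupport.of_support_subset_isCompact (Y.isCompact_biUnion fun y _ => isCompact_closedBall y (2 * ρ y)) fun z hz => ?_
      obtain ⟨y, hy, h⟩ := Finset.exists_ne_zero_of_sum_ne_zero hz
      exact mem_iUnion₂.2 ⟨y, hy, Hc_ts (hρ y hy).1 (subset_tsupport _ h)⟩
    exact (Hc_cs h0).sub this
  have fd : ∀ z v, fderiv ℝ ζ z v = ∑ y ∈ Y, Pc y (ρ y) z * ⟪z - y, v⟫ - Pc y0 r0 z * ⟪z - y0, v⟫ := fun z v => by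
    have df : ∀ y r, DifferentiableAt ℝ (Hc y r) z := fun y r => (Hc_smooth.differentiable (by simp)) z
    have : fderiv ℝ ζ z = fderiv ℝ (Hc y0 r0) z - ∑ y ∈ Y, fderiv ℝ (Hc y (ρ y)) z := by
      rw [hζd]; unfold Ze
      rw [fderiv_fun_sub (df _ _) (DifferentiableAt.fun_sum fun y _ => df _ _), fderiv_fun_sum fun y _ => df _ _]
    rw [this, ContinuousLinearMap.sub_apply, ContinuousLinearMap.sum_apply, Hc_fderiv h0,
      Finset.sum_congr rfl fun y hy => Hc_fderiv (hρ y hy).1 v]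
    simp only [neg_mul, Finset.sum_neg_distrib]; ring
  have iz : ∀ w a : ℂ, ⟪w, I * a⟫ = -⟪a, I * w⟫ := fun w a => by simp only [inC]; simp; ring
  have ts : ∀ f : ℂ → ℝ, ContDiff ℝ (⊤ : ℕ∞) f → IsTest (ball 0 2) (fun z => ζ z * f z) ∧ tsupport (fun z => ζ z * f z) ⊆ GS U := fun f hf => by
    have : tsupport (fun z => ζ z * f z) ⊆ GS U := (tsupport_mul_subset_left (f := ζ) (g := f)).trans hζ
    exact ⟨⟨sm.mul hf, cs.mul_right, fun z hz => by simpa using (this hz).2⟩, this⟩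
  have key : ∀ f : ℂ → ℝ, ContDiff ℝ (⊤ : ℕ∞) f → ∫ z, ζ z * fderiv ℝ f z (I * J z) =
      ∑ y ∈ Y, (∫ z, Pc y (ρ y) z * f z * jt J z z y) - ∫ z, Pc y0 r0 z * f z * jt J z z y0 := fun f hf => by
    have c0 := d.closedJ (ts f hf).1 (ts f hf).2
    have e : ∀ z, fderiv ℝ (fun z => ζ z * f z) z (I * J z) = ζ z * fderiv ℝ f z (I * J z) -
        (∑ y ∈ Y, Pc y (ρ y) z * f z * jt J z z y - Pc y0 r0 z * f z * jt J z z y0) := fun z => by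
      rw [fderiv_fun_mul (sm.differentiable (by simp) z) (hf.differentiable (by simp) z)]
      simp only [ContinuousLinearMap.add_apply, ContinuousLinearMap.smul_apply, smul_eq_mul, fd]
      simp only [iz (z - _)]
      rw [mul_sub, Finset.mul_sum]
      simp only [mul_neg, Finset.sum_neg_distrib]
      have : ∀ y, f z * (Pc y (ρ y) z * jt J z z y) = Pc y (ρ y) z * f z * jt J z z y := fun y => by ring
      simp only [this]; ring
    have i1 : Integrable fun z => ζ z * fderiv ℝ f z (I * J z) := by
      have hc := hf.continuous_fderiv (by simp)
      have h1 := icm d.iJ.norm (c := fun z => ζ z * ‖fderiv ℝ f z‖) (sm.continuous.mul hc.norm) cs.mul_right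
      refine h1.norm.mono' (sm.continuous.aestronglyMeasurable.mul ?_) (eF fun z => ?_)
      · exact (ContinuousLinearMap.apply ℝ ℝ).flip.aestronglyMeasurable_comp₂ hc.aestronglyMeasurable (d.mJ.const_mul I)
      · rw [norm_mul, norm_mul, norm_mul, mul_assoc, norm_norm, norm_norm]
        gcongr
        refine (ContinuousLinearMap.le_opNorm _ _).trans (le_of_eq ?_); simp
    have i2 : ∀ y ∈ Y, Integrable fun z => Pc y (ρ y) z * f z * jt J z z y := fun y hy => d.iPJ (hρ y hy).1 hf.continuous
    have i3 := d.iPJ (y := y0) h0 hf.continuous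
    simp only [e] at c0
    have i4 := integrable_finsetSum Y i2
    have i5 : Integrable fun z => ∑ y ∈ Y, Pc y (ρ y) z * f z * jt J z z y - Pc y0 r0 z * f z * jt J z z y0 := i4.sub i3
    rw [integral_sub i1 i5, integral_sub i4 i3, integral_finsetSum Y i2] at c0
    linarith
  have k1 := key (fun _ => 1) contDiff_const
  simp only [fderiv_fun_const, mul_one, Pi.zero_apply, zero_apply, mul_zero, integral_zero, hκ0.P h0] at k1
  rw [Finset.sum_congr rfl fun y hy => (hρ y hy).2.2.P (hρ y hy).1, ← Finset.sum_mul, ← sub_mul] at k1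
  have kk : (κ0 : ℝ) = ∑ y ∈ Y, (κ y : ℝ) := by
    rcases mul_eq_zero.1 k1.symm with h | h
    · linarith
    · linarith [Real.pi_pos]
  have k2 := key φ hφ.1
  have : ∀ z, ζ z * fderiv ℝ φ z (I * J z) = ζ z * ⟪J z, G z⟫ := fun z => by
    by_cases hz : ‖z‖ < 9 / 10
    · rw [hφ.2.2 z _ hz, inner_I_mul, real_inner_comm]
    · have hh : ∀ y r, 0 < r → ‖y‖ + 2 * r < 9 / 10 → Hc y r z = 0 := fun y r hr h =>
        Hc_zero hr (by have := norm_sub_norm_le z y; linarith)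
      have : ζ z = 0 := by
        rw [hζd, Ze, hh _ _ h0 hy0, Finset.sum_eq_zero fun y hy => hh _ _ (hρ y hy).1 (hρ y hy).2.1]; simp
      simp [this]
  simp only [this] at k2
  rw [k2]
  have e0 := d.err h0 hy0 le_rfl le_rfl hκ0 hG hφ
  have eY : ∀ y ∈ Y, _ := fun y hy => d.err (hρ y hy).1 (hρ y hy).2.1 le_rfl le_rfl (hρ y hy).2.2 hG hφ
  have eS := (Finset.abs_sum_le_sum_abs _ _).trans (Finset.sum_le_sum eY)
  rw [Finset.sum_sub_distrib, ← Finset.mul_sum] at eS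
  have : ∑ y ∈ Y, κ y * ((∫ z, Pc y (ρ y) z * φ z) - ∫ z, Pc y0 r0 z * φ z) = ∑ y ∈ Y, κ y * (∫ z, Pc y (ρ y) z * φ z) - κ0 * ∫ z, Pc y0 r0 z * φ z := by
    rw [kk, Finset.sum_mul, ← Finset.sum_sub_distrib]; congr 1; ext y; ring
  rw [this]
  rw [abs_le] at e0 eS ⊢
  constructor <;> nlinarith [e0.1, e0.2, eS.1, eS.2]
end Dat
end

open MeasureTheory Metric Filter Topology Set
open scoped ENNReal NNReal Convolution
noncomputable section
open Complex (I)

lemma mol_conv1R {f : ℂ → ℝ} (hf : Integrable f) : Tendsto (fun n => ∫ z, ‖mol n f z - f z‖) atTop (𝓝 0) := by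
  have h := mol_conv1 (f := fun z => (f z : ℂ)) hf.ofReal
  have e : ∀ n z, mol n (fun z => (f z : ℂ)) z = (mol n f z : ℝ) := fun n z => by
    rw [mol_eq, mol_eq]; simpa using integral_ofReal (𝕜 := ℂ) (μ := volume) (f := fun t => rn n (z - t) * f t)
  simpa only [e, ← Complex.ofReal_sub, Complex.norm_real] using h

namespace Dat
variable {p : ℝ} {U J : ℂ → ℂ} (d : Dat p U J)
include d

lemma q1 : 1 ≤ p / (p - 1) := by have := d.p1; rw [le_div_iff₀ lN]; linarith

lemma limE {c : ℂ → ℝ} (hc : Continuous c) (hs : HasCompactSupport c) :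
    Tendsto (fun n => ∫ z, c z * ⟪J z, mol n (Fl p J) z⟫) atTop (𝓝 (∫ z, c z * na J z ^ p)) := by
  have p1 := d.p1
  obtain ⟨C, hC⟩ := hs.exists_bound_of_continuous hc
  obtain ⟨m1, m2⟩ := mol_conv d.iF d.q1 d.iFq
  have hpq : p.HolderConjugate pc p := Real.HolderConjugate.conjExponent lN
  have q0 : 0 < p / (p - 1) := hpq.symm.pos
  have mJ : MemLp (fun z => na J z) (ENNReal.ofReal p) :=
    ((integrable_norm_rpow_iff d.mJ (by simp; linarith) (by simp)).1 (by rw [ENNReal.toReal_ofReal lN]; exact d.iE)).norm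
  have mG : ∀ n, MemLp (fun z => ‖mol n (Fl p J) z - Fl p J z‖) (ENNReal.ofReal pc p) := fun n =>
    ((integrable_norm_rpow_iff ((mol_integrable d.iF n).sub d.iF).1 (by simpa using q0) (by simp)).1
      (by rw [ENNReal.toReal_ofReal q0.le]; exact m1 n)).norm
  have hol := fun n => integral_mul_le_Lp_mul_Lq_of_nonneg hpq (eF fun z => norm_nonneg _) (eF fun z => norm_nonneg _) mJ (mG n)
  have iJG : ∀ n, Integrable fun z => na J z * ‖mol n (Fl p J) z - Fl p J z‖ := fun n =>
    haveI := hpq.ennrealOfReal; mJ.integrable_mul (mG n)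
  have e : ∀ z, c z * na J z ^ p = c z * ⟪J z, Fl p J z⟫ := fun z => by
    rw [Fl, inner_smul_right, real_inner_self_eq_norm_sq, rp2 lN nN]
  have T : Tendsto (fun n => C * ((∫ z, na J z ^ p) ^ (1 / p) * (∫ z, ‖mol n (Fl p J) z - Fl p J z‖ ^ pc p) ^ (1 / pc p))) atTop (𝓝 0) := by
    have := ((m2.rpow_const (p := 1 / pc p) (Or.inr pV)).const_mul ((∫ z, na J z ^ p) ^ (1 / p))).const_mul C
    rwa [Real.zero_rpow pV, mul_zero, mul_zero] at this
  rw [tendsto_iff_norm_sub_tendsto_zero]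
  refine squeeze_zero (fun n => norm_nonneg _) (fun n => ?_) T
  have i1 : Integrable fun z => c z * na J z ^ p := icm d.iE hc hs
  have i2 : Integrable fun z => c z * ⟪J z, mol n (Fl p J) z - Fl p J z⟫ := by
    refine ((iJG n).const_mul C).mono' (hc.aestronglyMeasurable.mul (d.mJ.inner ((mol_integrable d.iF n).sub d.iF).1)) (eF fun z => ?_)
    rw [norm_mul]; exact mul_le_mul (hC z) (norm_inner_le_norm _ _) nN ((norm_nonneg _).trans (hC z))
  have : (∫ z, c z * ⟪J z, mol n (Fl p J) z⟫) - ∫ z, c z * na J z ^ p = ∫ z, c z * ⟪J z, mol n (Fl p J) z - Fl p J z⟫ := by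
    rw [sub_eq_iff_eq_add, ← integral_add i2 i1]; congr 1; ext z; rw [e, inner_sub_right]; ring
  rw [this]
  have C0 : 0 ≤ C := (norm_nonneg _).trans (hC 0)
  refine (norm_integral_le_of_norm_le ((iJG n).const_mul C) (eF fun z => ?_)).trans ?_
  · rw [norm_mul]; exact mul_le_mul (hC z) (norm_inner_le_norm _ _) nN C0
  · rw [integral_const_mul]; exact mL (hol n) C0

lemma limI {a : ℂ → ℂ} (hc : Continuous a) (hs : HasCompactSupport a) :
    Tendsto (fun n => ∫ z, ⟪a z, mol n (Fl p J) z⟫) atTop (𝓝 (∫ z, ⟪a z, Fl p J z⟫)) := by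
  obtain ⟨C, hC⟩ := hs.exists_bound_of_continuous hc
  have ii : ∀ {f : ℂ → ℂ}, Integrable f → Integrable fun z => ⟪a z, f z⟫ := fun {f} hf =>
    (hf.norm.const_mul C).mono' (hc.aestronglyMeasurable.inner hf.1) (eF fun z =>
      (norm_inner_le_norm _ _).trans (mul_le_mul_of_nonneg_right (hC z) nN))
  have T := (mol_conv1 d.iF).const_mul C
  rw [mul_zero] at T
  rw [tendsto_iff_norm_sub_tendsto_zero]
  refine squeeze_zero (fun n => norm_nonneg _) (fun n => ?_) T
  rw [← integral_sub (ii (mol_integrable d.iF n)) (ii d.iF), ← integral_const_mul]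
  refine norm_integral_le_of_norm_le (((mol_integrable d.iF n).sub d.iF).norm.const_mul C) (eF fun z => ?_)
  rw [← inner_sub_right]
  exact (norm_inner_le_norm _ _).trans (mul_le_mul_of_nonneg_right (hC z) nN)

lemma limN {c : ℂ → ℝ} {C : ℝ} (hc : Continuous c) (hC : ∀ z, na c z ≤ C) :
    Tendsto (fun n => ∫ z, c z * ‖mol n (Fl p J) z‖) atTop (𝓝 (∫ z, c z * ‖Fl p J z‖)) := by
  refine L1lim (fun n => (mol_integrable d.iF n).norm) d.iF.norm ?_ hc.aestronglyMeasurable (eF hC)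
  refine squeeze_zero (fun n => integral_nonneg fun z => norm_nonneg _) (fun n => ?_) (mol_conv1 d.iF)
  exact integral_mono ((mol_integrable d.iF n).norm.sub d.iF.norm).norm ((mol_integrable d.iF n).sub d.iF).norm
    fun z => abs_norm_sub_norm_le _ _

lemma limD (y : ℂ) {r : ℝ} (hr : 0 < r) : ∃ e : ℕ → ℝ, (∀ n, ∫ z, Pq y r z * ‖mol n (Fl p J) z‖ ^ pc p ≤ e n) ∧
    Tendsto e atTop (𝓝 (De p J y r)) := by
  have hc : Continuous fun z => Pq y r z := Pc_cont.mul fP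
  have q1 := d.q1
  refine ⟨fun n => ∫ z, Pq y r z * mol n (fun z => na J z ^ p) z, fun n => ?_,
    L1lim (fun n => mol_integrable d.iE n) d.iE (mol_conv1R d.iE) hc.aestronglyMeasurable (C := Ck)
      (eF fun z => by
        rw [Real.norm_of_nonneg (mul_nonneg Pc_nonneg (sq_nonneg _))]; exact Pc_mul_le hr)⟩
  refine integral_mono ?_ (icm (mol_integrable d.iE n) hc (Pc_cs hr).mul_right) fun z => ?_
  · refine Continuous.integrable_of_hasCompactSupport ?_ (Pc_cs hr).mul_right.mul_right
    exact hc.mul ((mol_smooth d.iF n).continuous.norm.rpow_const fun _ => Or.inr lN)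
  · refine mL ?_ (mul_nonneg Pc_nonneg (sq_nonneg _))
    refine (Real.rpow_le_rpow nN (mol_norm d.iF n z) lN).trans
        ((mol_jensen (fun z => norm_nonneg _) d.iF.norm q1 d.iFq n z).trans (le_of_eq ?_))
    simp only [d.nFq]

lemma lemmaN {y : ℂ} {r1 r2 : ℝ} {κ : ℤ} (h2 : 0 < r2) (h12 : r2 ≤ r1) (hy : ‖y‖ + 2 * r1 < 9 / 10)
    (hA : ∀ z, r2 ≤ nb z y → nb z y ≤ 2 * r1 → z ∈ GS U) (hκ : Deg J y r2 (2 * r1) κ) :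
    |(∫ z, Hd y r1 r2 z * na J z ^ p) -
      κ * ∫ z, Hd y r1 r2 z * (⟪Fl p J z, I * (z - y)⟫ / max nb z y r2 ^ 2)| ≤ 4 * π * (De p J y r1 + De p J y r2) := by
  have h1 : 0 < r1 := by linarith
  have hZ : Ze y r1 {y} (fun _ => r2) = fun z => Hc y r1 z - Hc y r2 z := by ext z; simp [Ze]
  have hm : ∀ z : ℂ, max nb z y r2 ^ 2 ≠ 0 := fun z => by have := lt_max_of_lt_right (b := nb z y) h2; positivity
  have hχc : Continuous fun z => Hc y r1 z - Hc y r2 z := Hc_cont.sub Hc_cont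
  have hχs : HasCompactSupport fun z => Hc y r1 z - Hc y r2 z := (Hc_cs h1).sub (Hc_cs h2)
  have hts : tsupport (Ze y r1 {y} fun _ => r2) ⊆ GS U := by
    have hcl : IsClosed {z : ℂ | r2 ≤ nb z y ∧ nb z y ≤ 2 * r1} :=
      (isClosed_le continuous_const fP).and (isClosed_le fP continuous_const)
    refine (closure_minimal (fun z hz => ?_) hcl).trans fun z hz => hA z hz.1 hz.2
    rw [hZ] at hz
    constructor <;> by_contra h <;> refine hz ?_ <;> rw [not_le] at h <;> simp only
    · rw [Hc_one h1 lN, Hc_one h2 h.le, sub_self]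
    · rw [Hc_zero h1 h.le, Hc_zero h2 lN, sub_self]
  obtain ⟨e1, b1, t1⟩ := d.limD y h1
  obtain ⟨e2, b2, t2⟩ := d.limD y h2
  set a : ℂ → ℂ := fun z => (Hd y r1 r2 z / max nb z y r2 ^ 2) • (I * (z - y))
  have ac : Continuous a := (hχc.div fP hm).smul fP
  have as : HasCompactSupport a := by
    refine hχs.mono' fun z hz => subset_tsupport _ fun h => hz ?_
    show (Hd y r1 r2 z / _ : ℝ) • (_ : ℂ) = 0
    rw [show Hc y r1 z - Hc y r2 z = 0 from h, zero_div, zero_smul]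
  have ea : ∀ (G : ℂ → ℂ) z, Hd y r1 r2 z * (jt G z z y / max nb z y r2 ^ 2) = ⟪a z, G z⟫ := fun G z => by
    rw [inner_smul_left, real_inner_comm]; simp; ring
  have T1 := ((d.limE hχc hχs).sub ((d.limI ac as).const_mul cR κ)).abs
  have T2 := (((t1.const_add (De p J y r1)).add (t2.const_add (De p J y r2)))).const_mul (2 * π)
  simp only [ea]
  have := le_of_tendsto_of_tendsto T1 T2 ?_
  · linarith
  filter_upwards [d.pot] with n ⟨φ, hφ⟩
  have m := d.ML (κ := fun _ => κ) (κ0 := κ) h1 hy (Y := {y}) (ρ := fun _ => r2) (fun z hz => by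
    rw [Finset.mem_singleton] at hz; subst hz
    exact ⟨h2, by linarith, hκ.mono le_rfl lN⟩) (hκ.mono h12 le_rfl) hts (mol_smooth d.iF n).continuous hφ
  have g := PhiD h2 h12 hy hφ
  have : ∀ z, Hd y r1 r2 z * (⟪I * mol n (Fl p J) z, z - y⟫ / max nb z y r2 ^ 2) = -⟪a z, mol n (Fl p J) z⟫ := fun z => by
    rw [← ea, ← inner_I_mul, ← mul_assoc]; simp [inner_neg_left]; ring
  simp only [this, integral_neg] at g
  rw [← neg_sub, neg_inj] at g
  simp only [hZ, Finset.sum_singleton, g] at m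
  refine m.trans (mL ?_ pV)
  gcongr
  · exact b1 n
  · exact b2 n

lemma outer {Y : Finset ℂ} {ρ : ℂ → ℝ} {κ : ℂ → ℤ} {κ0 : ℤ}
    (hρ : ∀ y ∈ Y, 0 < ρ y ∧ ρ y ≤ 1 / 4 ∧ ‖y‖ ≤ 1 / 16 ∧ Deg J y (ρ y) (2 * ρ y) (κ y)) (hκ0 : Deg J 0 (1 / 4) (2 * (1 / 4)) κ0)
    (hζ : tsupport (Ze 0 (1 / 4) Y ρ) ⊆ GS U) :
    ∫ z, Ze 0 (1 / 4) Y ρ z * na J z ^ p ≤ ∑ y ∈ Y, |(κ y : ℝ)| * ((∫ z, (Hc y (1 / 4) z - Hc y (ρ y) z) / max nb z y (ρ y) * ‖Fl p J z‖) +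
      Ck * ∫ z, ‖Fl p J z‖) + 4 * π * (De p J 0 (1 / 4) + ∑ y ∈ Y, De p J y (ρ y)) := by
  have hzc : Continuous (Ze 0 (1 / 4) Y ρ) := Hc_cont.sub (continuous_finsetSum _ fun y _ => Hc_cont)
  have hzs : HasCompactSupport (Ze 0 (1 / 4) Y ρ) := by
    have : HasCompactSupport fun z => ∑ y ∈ Y, Hc y (ρ y) z := by
      refine HasCompactSupport.of_support_subset_isCompact (Y.isCompact_biUnion fun y _ => isCompact_closedBall y (2 * ρ y)) fun z hz => ?_
      obtain ⟨y, hy, h⟩ := Finset.exists_ne_zero_of_sum_ne_zero hz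
      exact mem_iUnion₂.2 ⟨y, hy, Hc_ts (hρ y hy).1 (subset_tsupport _ h)⟩
    exact (Hc_cs nU).sub this
  have eD : ∀ y, ∃ e : ℕ → ℝ, 0 < ρ y → (∀ n, ∫ z, Pc y (ρ y) z * nb z y ^ 2 * ‖mol n (Fl p J) z‖ ^ pc p ≤ e n) ∧
      Tendsto e atTop (𝓝 (De p J y (ρ y))) := fun y => by
    by_cases h : 0 < ρ y
    · obtain ⟨e, he⟩ := d.limD y h; exact ⟨e, fun _ => he⟩
    · exact ⟨0, fun h' => absurd h' h⟩
  choose e he using eD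
  obtain ⟨e0, b0, t0⟩ := d.limD 0 (show zR < 1 / 4 by norm_num)
  have cc : ∀ y ∈ Y, Continuous (fun z => (Hc y (1 / 4) z - Hc y (ρ y) z) / max nb z y (ρ y)) ∧
      ∀ z, ‖(Hc y (1 / 4) z - Hc y (ρ y) z) / max nb z y (ρ y)‖ ≤ 1 / ρ y := fun y hy => by
    have h := hρ y hy
    have hm : ∀ z : ℂ, 0 < max nb z y (ρ y) := fun z => lt_max_of_lt_right h.1
    refine ⟨(Hc_cont.sub Hc_cont).div fP fun z => (hm z).ne', fun z => ?_⟩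
    rw [norm_div, Real.norm_of_nonneg (hm z).le, Real.norm_eq_abs]
    refine div_le_div₀ one_pos.le ?_ h.1 (le_max_right _ _)
    rw [abs_of_nonneg (sub_nonneg.2 (Hc_anti h.1 h.2.1))]
    linarith [Hc_le (y := y) (r := 1 / 4) (z := z), Hc_nonneg (y := y) (r := ρ y) (z := z)]
  have tn : Tendsto (fun n => ∫ z, ‖mol n (Fl p J) z‖) atTop (𝓝 (∫ z, ‖Fl p J z‖)) := by
    simpa using d.limN (c := fun _ => 1) (C := 1) continuous_const (by simp)
  have T1 := d.limE hzc hzs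
  have T2 := (tendsto_finsetSum Y fun y hy => (((d.limN (cc y hy).1 (cc y hy).2).add (tn.const_mul Ck)).const_mul |(κ y : ℝ)|)).add
    (((t0.const_add (De p J 0 (1 / 4))).add (tendsto_finsetSum Y fun y hy => ((he y (hρ y hy).1).2.const_add (De p J y (ρ y))))).const_mul (2 * π))
  have := le_of_tendsto_of_tendsto T1 T2 ?_
  · refine this.trans (le_of_eq ?_)
    rw [Finset.sum_add_distrib]; ring
  filter_upwards [d.pot] with n ⟨φ, hφ⟩
  have m := d.ML (κ := κ) (κ0 := κ0) nU nU (Y := Y) (ρ := ρ) (fun y hy => ⟨(hρ y hy).1, by linarith [hρ y hy], (hρ y hy).2.2.2⟩)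
    hκ0 hζ (mol_smooth d.iF n).continuous hφ
  have m1 := (abs_le.1 m).2
  rw [sub_le_iff_le_add, add_comm] at m1
  refine m1.trans (add_le_add (Finset.sum_le_sum fun y hy => ?_) (mL ?_ pV))
  · refine (le_abs_self _).trans ?_
    rw [abs_mul]
    refine mL ?_ (abs_nonneg _)
    have h := hρ y hy
    have hm : ∀ z : ℂ, 0 < max nb z y (ρ y) := fun z => lt_max_of_lt_right h.1
    have g := PhiD (y := y) h.1 h.2.1 (by linarith [h.2.2.1]) hφ
    have gt := PhiT (y := y) (r := 1 / 4) nU (by linarith [h.2.2.1]) (mol_integrable d.iF n) hφ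
    have b1 : |(∫ z, Pc y (1 / 4) z * φ z) - ∫ z, Pc y (ρ y) z * φ z| ≤ ∫ z, (Hc y (1 / 4) z - Hc y (ρ y) z) / max nb z y (ρ y) * ‖mol n (Fl p J) z‖ := by
      rw [g, ← Real.norm_eq_abs]
      refine norm_integral_le_of_norm_le ((mol_integrable d.iF n).norm.bdd_mul (cc y hy).1.aestronglyMeasurable (eF (cc y hy).2)) (eF fun z => ?_)
      have hh := sub_nonneg.2 (Hc_anti (y := y) (z := z) h.1 h.2.1)
      rw [norm_mul, norm_div, Real.norm_of_nonneg hh, div_mul_eq_mul_div, mul_div_assoc, Real.norm_of_nonneg (sq_nonneg _)]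
      refine mL ?_ hh
      rw [div_le_div_iff₀ (by have := hm z; positivity) (hm z)]
      have : ‖(⟪I * mol n (Fl p J) z, z - y⟫ : ℝ)‖ ≤ ‖mol n (Fl p J) z‖ * max nb z y (ρ y) := by
        refine (norm_inner_le_norm _ _).trans ?_
        rw [norm_mul, Complex.norm_I, one_mul]; gcongr; exact le_max_left _ _
      nlinarith [hm z]
    have b2 : ‖y‖ * (Ck / (1 / 4) ^ 2) * (∫ z, ‖mol n (Fl p J) z‖) ≤ Ck * ∫ z, ‖mol n (Fl p J) z‖ := by
      refine mul_le_mul_of_nonneg_right ?_ (integral_nonneg fun z => norm_nonneg _)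
      have := Ck_pos
      calc _ = 16 * ‖y‖ * Ck := by ring
        _ ≤ 1 * Ck := by gcongr; linarith [h.2.2.1]
        _ = Ck := one_mul _
    rw [abs_le] at *
    constructor <;> linarith [b1.1, b1.2, gt.1, gt.2]
  · gcongr with y hy
    · exact b0 n
    · exact (he y (hρ y hy).1).1 n
end Dat
end

open MeasureTheory Metric Filter Topology Set
open scoped ENNReal NNReal Convolution
noncomputable section
open Complex (I)

lemma MV {k : ℂ → ℝ} (hk : Integrable k) (y : ℂ) {a b : ℝ} (ha : 0 < a) (hab : a < b) :
    ∃ r ∈ Ioo a b, (∫ z, Pq y r z * k z) * (Real.log b - Real.log a) = ∫ z, (Hc y b z - Hc y a z) * k z := by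
  obtain ⟨r, hr, h⟩ := exists_ratio_hasDerivAt_eq_ratio_slope (fun r => ∫ z, Hc y r z * k z) (fun r => (∫ z, Pq y r z * k z) / r) hab
    (fun r hr => (dI hk (ha.trans_le hr.1)).continuousAt.continuousWithinAt) (fun r hr => dI hk (ha.trans hr.1)) Real.log (fun r => r⁻¹)
    (fun r hr => (Real.continuousAt_log (ha.trans_le hr.1).ne').continuousWithinAt) (fun r hr => Real.hasDerivAt_log (ha.trans hr.1).ne')
  refine ⟨r, hr, ?_⟩
  have r0 : 0 < r := ha.trans hr.1
  have i1 := icm hk (Hc_cont (y := y) (r := b)) (Hc_cs lN)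
  have i2 := icm hk (Hc_cont (y := y) (r := a)) (Hc_cs ha)
  simp only [sub_mul]
  rw [integral_sub i1 i2]
  field_simp at h
  linarith

namespace Dat
variable {p : ℝ} {U J : ℂ → ℂ} (d : Dat p U J)
include d

lemma Isub (y : ℂ) (a b : ℝ) : ∫ z, (Hc y b z - Hc y a z) * na J z ^ p = Ie p J y b - Ie p J y a := by
  simp only [sub_mul]; rw [integral_sub d.iH d.iH]; rfl

lemma MVD (y : ℂ) {a b : ℝ} (ha : 0 < a) (hab : a < b) :
    ∃ r ∈ Ioo a b, De p J y r * (Real.log b - Real.log a) = Ie p J y b - Ie p J y a := by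
  obtain ⟨r, hr, h⟩ := MV d.iE y ha hab
  exact ⟨r, hr, by rw [← d.Isub]; exact h⟩

lemma Ie_mono (y : ℂ) {a b : ℝ} (ha : 0 < a) (hab : a ≤ b) : Ie p J y a ≤ Ie p J y b :=
  integral_mono d.iH d.iH fun z => mul_le_mul_of_nonneg_right (Hc_anti ha hab) pV

lemma degB {y : ℂ} {r g : ℝ} (hr : 0 < r) (hg : 0 < g) {κ : ℤ} (hκ : Deg J y r (2 * r) κ) :
    2 * π * |cR κ| ≤ 2 * π * g + g ^ (1 - p) * (r ^ pm p * De p J y r) := by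
  have p1 := d.p1
  have p2 := d.p2
  have iP0 : Integrable (Pc y r) := Pc_cont.integrable_of_hasCompactSupport (Pc_cs hr)
  have i1 : Integrable fun z => g * Pc y r z := iP0.const_mul g
  have i2 : Integrable fun z => g ^ (1 - p) * (r ^ pm p * (Pq y r z * na J z ^ p)) := ((d.iP hr).const_mul _).const_mul _
  have e : 2 * π * |cR κ| = ‖∫ z, Pc y r z * jt J z z y‖ := by
    rw [hκ.P hr, norm_mul, Real.norm_eq_abs, Real.norm_of_nonneg Real.two_pi_pos.le]; ring
  have e2 : 2 * π * g + g ^ (1 - p) * (r ^ pm p * De p J y r) =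
      ∫ z, (g * Pc y r z + g ^ (1 - p) * (r ^ pm p * (Pq y r z * na J z ^ p))) := by
    rw [integral_add i1 i2, integral_const_mul, integral_const_mul, integral_const_mul, Pc_int hr, De]; ring
  rw [e, e2]
  refine norm_integral_le_of_norm_le (i1.add i2) (eF fun z => ?_)
  by_cases hP : Pc y r z = 0
  · simp [hP]
  have hz := Pc_supp hr hP
  have hw : 0 < nb z y := hr.trans hz.1
  have P0 := Pc_nonneg (y := y) (r := r) (z := z)
  rw [norm_mul, Real.norm_of_nonneg P0]
  have k1 : ‖(jt J z z y : ℝ)‖ ≤ nb z y * na J z := by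
    refine (norm_inner_le_norm _ _).trans (le_of_eq ?_); rw [norm_mul]; simp [mul_comm]
  have k2 := young1 (p := p) (mul_nonneg hw.le (norm_nonneg (J z))) hg lN
  rw [Real.mul_rpow hw.le nN, ← rp2 (p := p) lN hw.le] at k2
  have k3 : nb z y ^ pm p ≤ r ^ pm p := Real.rpow_le_rpow_of_nonpos hr hz.1.le lN
  calc _ ≤ Pc y r z * (g + g ^ (1 - p) * (r ^ pm p * nb z y ^ 2 * na J z ^ p)) := by
        gcongr; exact k1.trans (k2.trans (by gcongr))
    _ = _ := by ring

lemma good_of {y : ℂ} {ρ : ℝ} {z : ℂ} (hρ : 0 < ρ) (hz : nb z y = 4 * ρ) (hz2 : ‖z‖ + 2 * ρ < 2)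
    (h : ρ ^ pm p * (Ie p J y (6 * ρ) - Ie p J y ρ) ≤ eps1) : z ∈ GS U := by
  refine ⟨d.goodC hρ hz2 (le_trans ?_ h), by linarith⟩
  refine mL ?_ pV
  rw [← d.Isub]
  have i : Integrable fun x => (Hc y (6 * ρ) x - Hc y ρ x) * na J x ^ p := by simp only [sub_mul]; exact d.iH.sub d.iH
  refine integral_mono d.iH i fun x => mul_le_mul_of_nonneg_right ?_ pV
  by_cases hx : nb x z < 2 * ρ
  · have a1 : nb x y ≤ nb x z + nb z y := norm_sub_le_norm_sub_add_norm_sub _ _ _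
    have a2 : nb z y ≤ nb z x + nb x y := norm_sub_le_norm_sub_add_norm_sub _ _ _
    rw [norm_sub_rev z x] at a2
    rw [Hc_one (y := y) (r := 6 * ρ) lN lN, Hc_zero (y := y) hρ lN, sub_zero]; exact Hc_le
  · rw [Hc_zero hρ lN]; exact sub_nonneg.2 (Hc_anti hρ lN)

omit d in
lemma IeT (y : ℂ) {r : ℝ} (hr : 0 < r) : Ie p J y r = r ^ sp p * Th p J y r := by
  rw [Th, ← mul_assoc, ← Real.rpow_add hr]; simp

set_option maxHeartbeats 2000000 in
/-- density gap -/
lemma gap {y : ℂ} {r0 : ℝ} (hy : ‖y‖ ≤ 1 / 2) (h0 : 0 < r0) (h1 : r0 ≤ 1 / 4) (hs : 2 - p < 1 / 400)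
    (hT : sp p * Th p J y r0 < eps1 / 10) : y ∈ GS U := by
  by_contra hb
  have p2 := d.p2
  set s := 2 - p with hsd
  have s0 : 0 < s := by linarith
  have ep := eps1_pos
  have e1 : eps1 = 1 / 40000000 := rfl
  set T := Th p J y with hTd
  have lo : ∀ h, 0 < h → h ≤ 1 / 4 → eps1 ≤ T h := fun h hh h4 => by
    by_contra hc
    exact hb ⟨d.goodC hh lN (not_le.1 hc).le, by linarith⟩
  have mono : ∀ a b, 0 < a → a ≤ b → b ≤ 1 / 4 → T a ≤ T b := fun a b ha hab hb => d.Th_mono ha hab lN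
  set Θ := sInf (T '' Ioc 0 r0)
  have hbd : BddBelow (T '' Ioc 0 r0) := ⟨eps1, by rintro _ ⟨h, hh, rfl⟩; exact lo h hh.1 (hh.2.trans h1)⟩
  have hne : (T '' Ioc 0 r0).Nonempty := ⟨_, r0, ⟨h0, le_rfl⟩, rfl⟩
  have Θ1 : eps1 ≤ Θ := le_csInf hne (by rintro _ ⟨h, hh, rfl⟩; exact lo h hh.1 (hh.2.trans h1))
  have Θ0 : 0 < Θ := ep.trans_le Θ1
  have Θle : ∀ h, 0 < h → h ≤ r0 → Θ ≤ T h := fun h a b => csInf_le hbd ⟨h, ⟨a, b⟩, rfl⟩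
  have Θs : s * Θ ≤ eps1 / 10 := (mL (Θle r0 h0 le_rfl) s0.le).trans hT.le
  obtain ⟨_, ⟨t, ht, rfl⟩, htΘ⟩ := exists_lt_of_csInf_lt hne (show sInf (T '' Ioc 0 r0) < (1 + s) * Θ by
    show Θ < (1 + s) * Θ; linarith [mul_pos s0 Θ0])
  have ss : s * s ≤ s / 5 := by linarith [mL (show s ≤ 1 / 5 by linarith) s0.le]
  have up : ∀ h, 0 < h → h ≤ t → T h ≤ (1 + s) * Θ := fun h a b => (mono h t a b (ht.2.trans h1)).trans htΘ.le
  have lo2 : ∀ h, 0 < h → h ≤ t → Θ ≤ T h := fun h a b => Θle h a (b.trans ht.2)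
  have inc : ∀ (m a : ℝ), 1 ≤ m → 0 < a → m * a ≤ t → Ie p J y (m * a) - Ie p J y a ≤ a ^ s * ((1 + s * (m - 1)) * (1 + s) - 1) * Θ := by
    intro m a hm ha hma
    have ha' : a ≤ t := (le_mul_of_one_le_left ha.le hm).trans hma
    rw [IeT y pV, IeT y ha, Real.mul_rpow lN ha.le]
    have b1 : m ^ s ≤ 1 + s * (m - 1) := by
      have := rpow_one_add_le_one_add_mul_self (s := m - 1) (p := s) lN s0.le lN
      simpa using this
    have b2 := up (m * a) pV hma
    have b3 := lo2 a ha ha'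
    have : m ^ s * T (m * a) ≤ (1 + s * (m - 1)) * ((1 + s) * Θ) := by gcongr; exact (lo2 _ pV hma).trans' Θ0.le
    calc _ = a ^ s * (m ^ s * T (m * a) - T a) := by ring
      _ ≤ a ^ s * ((1 + s * (m - 1)) * ((1 + s) * Θ) - Θ) := by gcongr
      _ = _ := by ring
  have l2 := Real.log_two_gt_d9
  have Db : ∀ a, 0 < a → 2 * a ≤ t → ∃ r ∈ Ioo a (2 * a), De p J y r ≤ 5 * s * a ^ s * Θ := fun a ha h2a => by
    obtain ⟨r, hr, e⟩ := d.MVD y ha (show a < 2 * a by linarith)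
    refine ⟨r, hr, ?_⟩
    rw [Real.log_mul nU ha.ne', add_sub_cancel_right] at e
    have i := inc 2 a nU ha h2a
    have as : 0 ≤ a ^ s * Θ := by positivity
    have : ((1 + s * (2 - 1)) * (1 + s) - 1) ≤ 3 * s := by linarith
    have i' : Ie p J y (2 * a) - Ie p J y a ≤ a ^ s * (3 * s) * Θ := i.trans (by gcongr)
    have D0 := De_nonneg (p := p) (J := J) (y := y) (r := r)
    have sas := mul_nonneg s0.le as
    linarith [mL l2.le D0]
  obtain ⟨K, hKe⟩ : ∃ K, K = Real.exp 200 := ⟨_, rfl⟩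
  have K1 : 1 ≤ K := hKe ▸ Real.one_le_exp nU
  have Ks : K ^ s = Real.exp (200 * s) := by rw [hKe, ← Real.exp_mul]
  have Ks2 : K ^ s ≤ 2 := by
    rw [Ks]; refine (Real.exp_le_exp.2 (show 200 * s ≤ Real.log 2 by linarith)).trans (by rw [Real.exp_log]; norm_num)
  have Ks1 : 1 + 200 * s ≤ K ^ s := by rw [Ks]; linarith [Real.add_one_le_exp (200 * s)]
  obtain ⟨h, hK⟩ : ∃ h, 8 * (K * h) = t := ⟨t / (8 * K), by field_simp⟩
  have hh : 0 < h := by have := ht.1; rw [← hK] at this; exact pos_of_mul_pos_right (pos_of_mul_pos_right this nU) lN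
  have hKh : h ≤ K * h := le_mul_of_one_le_left hh.le K1
  obtain ⟨r2, hr2, D2⟩ := Db h hh lN
  obtain ⟨r1, hr1, D1⟩ := Db (K * h) pV lN
  have t4 : t ≤ 1 / 4 := ht.2.trans h1
  have r20 : 0 < r2 := hh.trans hr2.1
  have K4 : 4 ≤ K := by rw [hKe]; have := Real.add_one_le_exp 200; linarith
  have r21 : 2 * r2 ≤ r1 := by linarith [mul_le_mul_of_nonneg_right K4 hh.le, hr2.2, hr1.1]
  have hA : ∀ z, r2 ≤ nb z y → nb z y ≤ 2 * r1 → z ∈ GS U := fun z z1 z2 => by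
    have w0 : 0 < nb z y / 4 := by linarith
    refine d.good_of w0 (by ring) (by have := norm_sub_norm_le z y; linarith [hr1.2]) ?_
    have i := inc 6 _ nU w0 (by linarith [hr1.2])
    have wp : (nb z y / 4) ^ pm p * (nb z y / 4) ^ s = 1 := by rw [← Real.rpow_add w0, hsd]; simp
    calc _ ≤ (nb z y / 4) ^ pm p * ((nb z y / 4) ^ s * ((1 + s * (6 - 1)) * (1 + s) - 1) * Θ) := by gcongr
      _ = ((1 + s * (6 - 1)) * (1 + s) - 1) * Θ := by rw [mul_assoc, ← mul_assoc, wp, one_mul]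
      _ ≤ 7 * s * Θ := by gcongr; linarith
      _ ≤ eps1 := by linarith
  obtain ⟨κ, hκ⟩ := d.degree r20 (show r2 < 2 * r1 by linarith) hA
  have hs1 : h ^ s ≤ r2 ^ s := Real.rpow_le_rpow hh.le hr2.1.le s0.le
  have κ0 : κ = 0 := by
    have b := d.degB r20 (show zR < 1 / 2 by norm_num) (Deg.mono hκ le_rfl lN)
    have c1 : r2 ^ pm p * De p J y r2 ≤ eps1 / 2 := by
      calc _ ≤ r2 ^ pm p * (5 * s * r2 ^ s * Θ) := by gcongr; exact D2.trans (by gcongr)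
        _ = (r2 ^ pm p * r2 ^ s) * (5 * (s * Θ)) := by ring
        _ = 5 * (s * Θ) := by rw [← Real.rpow_add r20, hsd]; simp
        _ ≤ _ := by linarith
    have c2 : (1 / 2 : ℝ) ^ (1 - p) ≤ 2 := by
      rw [one_div, Real.inv_rpow nU, ← Real.rpow_neg nU]
      calc (2 : ℝ) ^ (-(1 - p)) ≤ 2 ^ (1 : ℝ) := Real.rpow_le_rpow_of_exponent_le nU lN
        _ = 2 := by norm_num
    have c3 : (1 / 2 : ℝ) ^ (1 - p) * (r2 ^ pm p * De p J y r2) ≤ 2 * (eps1 / 2) := by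
      gcongr; exact mul_nonneg pV De_nonneg
    have : |cR κ| < 1 := by
      have := Real.pi_gt_three
      by_contra hc
      linarith [mL (not_lt.1 hc) Real.pi_pos.le]
    have : |κ| < 1 := by exact_mod_cast this
    exact Int.abs_lt_one_iff.1 this
  subst κ0
  have N := d.lemmaN r20 lN (by linarith [hr1.2]) hA hκ
  rw [Int.cast_zero, zero_mul, sub_zero, d.Isub] at N
  have N1 := (le_abs_self _).trans N
  have L1 : Ie p J y (K * h) ≤ Ie p J y r1 := d.Ie_mono y pV hr1.1.le
  have L2 : Ie p J y r2 ≤ Ie p J y (2 * h) := d.Ie_mono y r20 hr2.2.le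
  have hs0 : 0 < h ^ s * Θ := by positivity
  have L3 : h ^ s * Θ * (1 + 200 * s) ≤ Ie p J y (K * h) := by
    rw [IeT y pV, Real.mul_rpow lN hh.le]
    calc _ ≤ h ^ s * Θ * K ^ s := by gcongr
      _ = K ^ s * h ^ s * Θ := by ring
      _ ≤ _ := by gcongr; exact lo2 _ pV lN
  have L4 : Ie p J y (2 * h) ≤ h ^ s * Θ * (1 + 4 * s) := by
    have i := inc 2 h nU hh lN
    have j : Ie p J y h ≤ h ^ s * ((1 + s) * Θ) := by rw [IeT y hh]; gcongr; exact up h hh lN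
    calc _ ≤ h ^ s * ((1 + s * (2 - 1)) * (1 + s) - 1) * Θ + h ^ s * ((1 + s) * Θ) := by linarith
      _ = h ^ s * Θ * (1 + 3 * s + s * s) := by ring
      _ ≤ _ := by gcongr ?_ * ?_; linarith
  have L5 : De p J y r1 ≤ 10 * (s * (h ^ s * Θ)) := by
    refine D1.trans ?_
    rw [Real.mul_rpow lN hh.le]
    calc _ = 5 * (s * (h ^ s * Θ)) * K ^ s := by ring
      _ ≤ 5 * (s * (h ^ s * Θ)) * 2 := by gcongr
      _ = _ := by ring
  have L6 : De p J y r2 ≤ 5 * (s * (h ^ s * Θ)) := by linarith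
  have M0 : 0 < s * (h ^ s * Θ) := by positivity
  have e3 : h ^ s * Θ * (1 + 200 * s) = h ^ s * Θ + 200 * (s * (h ^ s * Θ)) := by ring
  have e4 : h ^ s * Θ * (1 + 4 * s) = h ^ s * Θ + 4 * (s * (h ^ s * Θ)) := by ring
  rw [e3] at L3
  rw [e4] at L4
  generalize s * (h ^ s * Θ) = M at *
  have N2 : 196 * M ≤ 4 * π * (15 * M) := by
    have : 4 * π * (De p J y r1 + De p J y r2) ≤ 4 * π * (15 * M) := by gcongr; linarith
    linarith
  have := Real.pi_lt_d2
  linarith [mul_lt_mul_of_pos_right this M0]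
end Dat
end

open MeasureTheory Metric Filter Topology Set
open scoped ENNReal NNReal Convolution
noncomputable section
open Complex (I)

def Fv (p : ℝ) (a : ℂ) : ℂ := (‖a‖ ^ pm p : ℝ) • a

lemma conv2 {p : ℝ} (p1 : 3 / 2 < p) (p2 : p < 2) {a b : ℂ} (hb : b ≠ 0) (hab : ‖b‖ ≤ ‖a‖) :
    (p - 1) * (nb a b ^ 2 * (‖a‖ + ‖b‖) ^ pm p) ≤ ⟪Fv p a - Fv p b, a - b⟫ := by
  have B0 : 0 < ‖b‖ := norm_pos_iff.2 hb
  have A0 : 0 < ‖a‖ := B0.trans_le hab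
  have e1 : ⟪Fv p a - Fv p b, a - b⟫ = ‖a‖ ^ pm p * ‖a‖ ^ 2 + ‖b‖ ^ pm p * ‖b‖ ^ 2 - (‖a‖ ^ pm p + ‖b‖ ^ pm p) * ⟪a, b⟫ := by
    simp only [Fv, inner_sub_left, inner_sub_right, real_inner_smul_left, real_inner_self_eq_norm_sq, real_inner_comm b a]; ring
  rw [e1, norm_sub_sq_real]
  have c1 : ⟪a, b⟫ ≤ ‖a‖ * ‖b‖ := real_inner_le_norm a b
  set A := ‖a‖
  set B := ‖b‖
  have m1 : (A + B) ^ pm p ≤ A ^ pm p := Real.rpow_le_rpow_of_nonpos A0 lN lN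
  have m2 : (A + B) ^ pm p ≤ B ^ pm p := Real.rpow_le_rpow_of_nonpos B0 lN lN
  have M0 : 0 < (A + B) ^ pm p := by positivity
  have t : B ^ pm p * B ≤ A ^ pm p * (A + (p - 1) * (B - A)) := by
    have h := rpow_one_add_le_one_add_mul_self (s := B / A - 1) (p := p - 1) (by have : 0 < B / A := by positivity
                                                                                 linarith) lN lN
    rw [add_sub_cancel, Real.div_rpow B0.le A0.le, div_le_iff₀ pV, ← rp1 lN A0.le, ← rp1 lN B0.le] at h
    refine h.trans (le_of_eq ?_); field_simp
  have k1 : 0 ≤ (A ^ pm p + B ^ pm p - 2 * (p - 1) * (A + B) ^ pm p) * (A * B - ⟪a, b⟫) :=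
    mul_nonneg (by nlinarith) lN
  have k2 : (p - 1) * (A - B) ^ 2 * (A + B) ^ pm p ≤ (p - 1) * (A - B) ^ 2 * A ^ pm p :=
    mL m1 (mul_nonneg lN (sq_nonneg _))
  have k3 := mul_nonneg (sub_nonneg.2 t) (sub_nonneg.2 hab)
  linarith

lemma conv3 {p : ℝ} (p1 : 3 / 2 < p) (p2 : p < 2) (a b : ℂ) :
    (p - 1) * (nb a b ^ 2 * (‖a‖ + ‖b‖) ^ pm p) ≤ ⟪Fv p a - Fv p b, a - b⟫ := by
  wlog h : ‖b‖ ≤ ‖a‖ generalizing a b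
  · have := this b a (not_le.1 h).le
    rw [norm_sub_rev, add_comm] at this
    refine this.trans (le_of_eq ?_)
    rw [← neg_sub a, ← neg_sub (Fv p a), inner_neg_neg]
  by_cases hb : b = 0
  · subst hb
    have : Fv p zC = 0 := by simp [Fv]
    rw [this, sub_zero, sub_zero, Fv, real_inner_smul_left, real_inner_self_eq_norm_sq, norm_zero, add_zero]
    have : 0 ≤ ‖a‖ ^ pm p * ‖a‖ ^ 2 := by positivity
    nlinarith
  · exact conv2 p1 p2 hb h

lemma conv0 {p : ℝ} (p1 : 3 / 2 < p) (p2 : p < 2) (a b : ℂ) : 0 ≤ ⟪Fv p a - Fv p b, a - b⟫ :=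
  (mul_nonneg lN pV).trans (conv3 p1 p2 a b)

lemma conv1 {p : ℝ} (p1 : 3 / 2 < p) (p2 : p < 2) (a b : ℂ) :
    nb a b ^ p ≤ 2 * (⟪Fv p a - Fv p b, a - b⟫ + sp p * (‖a‖ ^ p + ‖b‖ ^ p)) := by
  have g := conv3 p1 p2 a b
  have N := norm_sub_le a b
  rcases (add_nonneg (norm_nonneg a) (norm_nonneg b)).eq_or_lt with h | M0
  · have : nb a b = 0 := le_antisymm lN nN
    rw [this, Real.zero_rpow lN]
    have := conv0 p1 p2 a b
    have : 0 ≤ sp p * (‖a‖ ^ p + ‖b‖ ^ p) := mul_nonneg lN pV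
    linarith
  have s1 := rpow_add_le (r := p) (norm_nonneg a) (norm_nonneg b) lN
  set M := ‖a‖ + ‖b‖
  have y := Real.geom_mean_le_arith_mean2_weighted (w₁ := p / 2) (w₂ := sp p / 2) (p₁ := nb a b ^ 2 * M ^ pm p) (p₂ := M ^ p)
    lN lN pV pV (by ring)
  have e : (nb a b ^ 2 * M ^ pm p) ^ (p / 2) * (M ^ p) ^ (sp p / 2) = nb a b ^ p := by
    rw [Real.mul_rpow pV pV, ← Real.rpow_natCast, ← Real.rpow_mul nN, ← Real.rpow_mul M0.le, ← Real.rpow_mul M0.le,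
      mul_assoc, ← Real.rpow_add M0]
    have : pm p * (p / 2) + p * (sp p / 2) = 0 := by ring
    rw [this, Real.rpow_zero, mul_one]; congr 1; push_cast; ring
  rw [e] at y
  have s2 : (2 : ℝ) ^ p ≤ 4 := by
    calc (2 : ℝ) ^ p ≤ 2 ^ (2 : ℝ) := Real.rpow_le_rpow_of_exponent_le nU p2.le
      _ = 4 := by norm_num
  have s3 : M ^ p ≤ 4 * (‖a‖ ^ p + ‖b‖ ^ p) := s1.trans (by gcongr)
  have q0 : 0 ≤ nb a b ^ 2 * M ^ pm p := by positivity
  have s4 : sp p / 2 * M ^ p ≤ sp p / 2 * (4 * (‖a‖ ^ p + ‖b‖ ^ p)) := mL s3 lN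
  have s5 : p / 2 * (nb a b ^ 2 * M ^ pm p) ≤ 2 * ((p - 1) * (nb a b ^ 2 * M ^ pm p)) := by nlinarith
  linarith

lemma conv4 {p g x y : ℝ} (p1 : 1 ≤ p) (p2 : p ≤ 2) (g0 : 0 < g) (g1 : g ≤ 1 / 2) (hx : 0 ≤ x) (hy : 0 ≤ y) :
    (x + y) ^ p ≤ (1 + 2 * g) * x ^ p + g⁻¹ * y ^ p := by
  have h := (convexOn_rpow p1).2 (x := x / (1 - g)) (y := y / g) (mem_Ici.2 (div_nonneg hx lN)) (mem_Ici.2 pV)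
    (show 0 ≤ 1 - g by linarith) g0.le (by ring)
  have e1 : (1 - g) • (x / (1 - g)) + g • (y / g) = x + y := by
    rw [smul_eq_mul, smul_eq_mul, mul_div_cancel₀ _ lN, mul_div_cancel₀ _ g0.ne']
  have f : ∀ c : ℝ, 0 < c → c ≤ 1 → ∀ x : ℝ, 0 ≤ x → c • (x / c) ^ p ≤ c⁻¹ * x ^ p := fun c c0 c1 x hx => by
    have : c ^ (2 : ℝ) ≤ c ^ p := Real.rpow_le_rpow_of_exponent_ge c0 c1 p2
    rw [Real.div_rpow hx c0.le, smul_eq_mul, ← mul_div_assoc, div_le_iff₀ pV]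
    rw [Real.rpow_two] at this
    have h2 : 0 ≤ c⁻¹ * x ^ p := by positivity
    calc c * x ^ p = c⁻¹ * x ^ p * c ^ 2 := by field_simp
      _ ≤ _ := by gcongr
  rw [e1] at h
  have f1 := f (1 - g) lN lN x hx
  have f2 := f g g0 lN y hy
  have : (1 - g)⁻¹ ≤ 1 + 2 * g := by rw [inv_le_iff_one_le_mul₀ lN]; nlinarith
  have f3 : (1 - g)⁻¹ * x ^ p ≤ (1 + 2 * g) * x ^ p := by gcongr
  linarith

lemma mint {y : ℂ} {p r1 r2 : ℝ} (p2 : p < 2) (h2 : 0 < r2) (h12 : r2 ≤ r1) (h1 : 2 * r1 ≤ 1) :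
    sp p * ∫ z, Hd y r1 r2 z * max nb z y r2 ^ (-p) ≤ 2 * π * (1 - r2 ^ sp p) := by
  have h10 : 0 < r1 := by linarith
  rw [show (fun z => Hd y r1 r2 z * max nb z y r2 ^ (-p)) =
    fun z => (fun t : ℝ => (Hc 0 r1 (t : ℂ) - Hc 0 r2 (t : ℂ)) * max t r2 ^ (-p)) nb z y by ext z; simp [Hc], integral_radial (fun t : ℝ => (Hc 0 r1 (t : ℂ) - Hc 0 r2 (t : ℂ)) * max t r2 ^ (-p))]
  have b : ∫ t in Ioi zR, t * ((Hc 0 r1 (t : ℂ) - Hc 0 r2 (t : ℂ)) * max t r2 ^ (-p)) ≤ ∫ t in Ioi zR, (Ioc r2 (2 * r1)).indicator (fun t => t ^ (1 - p)) t := by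
    refine integral_mono_of_nonneg ?_ ?_ ?_
    · filter_upwards [ae_restrict_mem measurableSet_Ioi] with t (ht : 0 < t)
      exact mul_nonneg ht.le (mul_nonneg (sub_nonneg.2 (Hc_anti h2 h12)) pV)
    · refine Integrable.integrableOn ?_
      rw [integrable_indicator_iff measurableSet_Ioc, ← intervalIntegrable_iff_integrableOn_Ioc_of_le lN]
      refine ContinuousOn.intervalIntegrable fun t ht => ?_
      rw [uIcc_of_le lN] at ht
      exact (Real.continuousAt_rpow_const _ _ (Or.inl (by linarith [ht.1]))).continuousWithinAt
    · filter_upwards [ae_restrict_mem measurableSet_Ioi] with t (ht : 0 < t)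
      have n : ‖(t : ℂ) - 0‖ = t := by simp [abs_of_pos ht]
      by_cases hm : t ∈ Ioc r2 (2 * r1)
      · rw [indicator_of_mem hm, max_eq_left hm.1.le]
        have e : t ^ (1 - p) = t * (1 * t ^ (-p)) := by rw [one_mul, sub_eq_add_neg, Real.rpow_add ht, Real.rpow_one]
        rw [e]
        gcongr
        linarith [Hc_le (y := 0) (r := r1) (z := (t : ℂ)), Hc_nonneg (y := 0) (r := r2) (z := (t : ℂ))]
      · rw [indicator_of_notMem hm]
        have : Hc 0 r1 (t : ℂ) - Hc 0 r2 (t : ℂ) = 0 := by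
          by_cases h : t ≤ r2
          · rw [Hc_one h10 lN, Hc_one h2 lN, sub_self]
          · have : 2 * r1 < t := by by_contra h'; exact hm ⟨not_le.1 h, not_lt.1 h'⟩
            rw [Hc_zero h10 lN, Hc_zero h2 lN, sub_self]
        rw [this]; simp
  rw [setIntegral_indicator measurableSet_Ioc, inter_eq_right.2 (show Ioc r2 (2 * r1) ⊆ Ioi 0 from fun t ht => h2.trans ht.1), ← intervalIntegral.integral_of_le lN,
    integral_rpow (Or.inr ⟨by linarith, by rw [uIcc_of_le lN]; exact fun h => by linarith [h.1]⟩)] at b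
  have e : 1 - p + 1 = 2 - p := by ring
  rw [e, le_div_iff₀ lN] at b
  have : (2 * r1) ^ sp p ≤ 1 := Real.rpow_le_one lN h1 lN
  have := Real.pi_pos
  calc _ = 2 * π * ((∫ t in Ioi zR, t * ((Hc 0 r1 (t : ℂ) - Hc 0 r2 (t : ℂ)) * max t r2 ^ (-p))) * sp p) := by ring
    _ ≤ _ := by gcongr; linarith
end

open MeasureTheory Metric Filter Topology Set
open scoped ENNReal NNReal Convolution
noncomputable section
open Complex (I)

def bv (κ : ℤ) (y z : ℂ) : ℂ := (cR κ / nb z y ^ 2 : ℝ) • (I * (z - y))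

lemma bv_norm {κ : ℤ} {y z : ℂ} : ‖bv κ y z‖ = |cR κ| / nb z y := by
  rw [bv, norm_smul, norm_mul, Complex.norm_I, one_mul, norm_div, norm_pow, norm_norm, Real.norm_eq_abs]
  by_cases h : nb z y = 0
  · simp [h]
  · field_simp
lemma bv_meas {κ : ℤ} {y : ℂ} : Measurable (bv κ y) := by unfold bv; fun_prop
lemma bv_perp {κ : ℤ} {y z : ℂ} : ⟪z - y, bv κ y z⟫ = 0 := by
  rw [bv, real_inner_smul_right]
  have : ⟪z - y, I * (z - y)⟫ = 0 := by simp [Complex.inner]; ring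
  rw [this, mul_zero]

lemma icI {f : ℂ → ℂ} {c : ℂ → ℝ} {y : ℂ} (hf : Integrable f) (hc : Continuous c) (hs : HasCompactSupport c) :
    Integrable fun z => c z * jt f z z y := by
  have h2 : Integrable fun z => (c z * nb z y) * na f z := icm hf.norm (hc.mul fP) hs.mul_right
  refine h2.norm.mono' (hc.aestronglyMeasurable.mul (hf.1.inner fP)) (eF fun z => ?_)
  rw [norm_mul, norm_mul _ (na f z), norm_mul _ (nb z y), norm_norm, norm_norm, mul_assoc _ nb z y]
  refine mL ((norm_inner_le_norm _ _).trans (le_of_eq ?_)) nN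
  rw [norm_mul, Complex.norm_I, one_mul, mul_comm]

lemma chi_supp {y z : ℂ} {r1 r2 : ℝ} (h2 : 0 < r2) (h12 : r2 ≤ r1) (h : Hc y r1 z - Hc y r2 z ≠ 0) : r2 ≤ nb z y ∧ nb z y ≤ 2 * r1 := by
  constructor
  · by_contra hc
    exact h (by rw [Hc_one (h2.trans_le h12) lN, Hc_one h2 lN, sub_self])
  · by_contra hc
    exact h (by rw [Hc_zero (h2.trans_le h12) lN, Hc_zero h2 lN, sub_self])

namespace Dat
variable {p : ℝ} {U J : ℂ → ℂ} (d : Dat p U J)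
include d

lemma neckA {y : ℂ} {r1 r2 : ℝ} {κ : ℤ} (h2 : 0 < r2) (h12 : r2 ≤ r1) (hy : ‖y‖ + 2 * r1 < 9 / 10)
    (hA : ∀ z, r2 ≤ nb z y → nb z y ≤ 2 * r1 → z ∈ GS U) (hκ : Deg J y r2 (2 * r1) κ) :
    (Integrable fun z => Hd y r1 r2 z * ⟪Fv p (J z) - Fv p (bv κ y z), J z - bv κ y z⟫) ∧
    (∫ z, Hd y r1 r2 z * ⟪Fv p (J z) - Fv p (bv κ y z), J z - bv κ y z⟫) ≤ 4 * π * (De p J y r1 + De p J y r2) ∧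
    (Integrable fun z => Hd y r1 r2 z * ‖bv κ y z‖ ^ p) ∧
    ((∫ z, Hd y r1 r2 z * ‖bv κ y z‖ ^ p) = |cR κ| ^ p * ∫ z, Hd y r1 r2 z * max nb z y r2 ^ (-p)) := by
  have p1 := d.p1
  have p2 := d.p2
  have h10 : 0 < r1 := by linarith
  have N := d.lemmaN h2 h12 hy hA hκ
  have cm : Continuous fun z : ℂ => max nb z y r2 := by fun_prop
  have cχ : Continuous fun z => Hc y r1 z - Hc y r2 z := Hc_cont.sub Hc_cont
  have sχ : HasCompactSupport fun z => Hc y r1 z - Hc y r2 z := (Hc_cs h10).sub (Hc_cs h2)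
  have m0 : ∀ z : ℂ, 0 < max nb z y r2 := fun z => h2.trans_le (le_max_right _ _)
  have cp : Continuous fun z : ℂ => max nb z y r2 ^ (-p) := cm.rpow_const fun z => Or.inl (m0 z).ne'
  have cq : Continuous fun z : ℂ => (max nb z y r2 ^ 2)⁻¹ := (cm.pow 2).inv₀ fun z => (pow_pos (m0 z) 2).ne'
  set χ := fun z => Hc y r1 z - Hc y r2 z with hχ
  set L : ℝ := |cR κ| ^ pm p * κ with hL
  have i1 : Integrable fun z => χ z * na J z ^ p := icm d.iE cχ sχ
  have i2 : Integrable fun z => χ z * (⟪Fl p J z, I * (z - y)⟫ / max nb z y r2 ^ 2) := by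
    have := icI (c := fun z => χ z * (max nb z y r2 ^ 2)⁻¹) (y := y) d.iF (cχ.mul cq) (HasCompactSupport.mul_right sχ)
    refine this.congr (eF fun z => ?_)
    simp only [div_eq_mul_inv, mul_left_comm, mul_comm]
  have iβ : Integrable fun z => χ z * max nb z y r2 ^ (-p) := (cχ.mul cp).integrable_of_hasCompactSupport (HasCompactSupport.mul_right sχ)
  have i3 : Integrable fun z => (χ z * max nb z y r2 ^ (-p)) * jt J z z y := icI d.iJ (cχ.mul cp) (HasCompactSupport.mul_right sχ)
  have dg : ∫ z, (χ z * max nb z y r2 ^ (-p)) * jt J z z y = κ * ∫ z, χ z * max nb z y r2 ^ (-p) := by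
    have e : ∀ z : ℂ, (Hc 0 r1 ((max nb z y 0 : ℝ) : ℂ) - Hc 0 r2 ((max nb z y 0 : ℝ) : ℂ)) * max nb z y r2 ^ (-p) = χ z * max nb z y r2 ^ (-p) := fun z => by
      rw [max_eq_left nN]; simp [Hc, hχ]
    have := hκ (fun t => (Hc 0 r1 ((max t 0 : ℝ) : ℂ) - Hc 0 r2 ((max t 0 : ℝ) : ℂ)) * max t r2 ^ (-p)) (by simp_rw [e]; exact cχ.mul cp) fun t ht => by
      have := chi_supp h2 h12 (left_ne_zero_of_mul ht)
      rw [sub_zero, Complex.norm_real, Real.norm_of_nonneg (le_max_right _ _)] at this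
      have h0 : 0 < t := by
        by_contra h0; rw [max_eq_right (not_lt.1 h0)] at this; linarith [this.1]
      rwa [max_eq_left h0.le] at this
    simp only [e] at this
    exact this
  have pe : ∀ z, χ z * ‖bv κ y z‖ ^ p = |cR κ| ^ p * (χ z * max nb z y r2 ^ (-p)) := fun z => by
    by_cases hz : χ z = 0
    · simp [hz]
    · have := chi_supp h2 h12 hz
      rw [max_eq_left this.1, bv_norm, Real.div_rpow (abs_nonneg _) nN, Real.rpow_neg nN]; ring
  have kk : |cR κ| ^ p = L * κ := by rw [← rp2 lN (abs_nonneg _), sq_abs, hL]; ring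
  have pt : ∀ z, χ z * ⟪Fv p (J z) - Fv p (bv κ y z), J z - bv κ y z⟫ =
      (χ z * na J z ^ p - κ * (χ z * (⟪Fl p J z, I * (z - y)⟫ / max nb z y r2 ^ 2))) -
      (L * ((χ z * max nb z y r2 ^ (-p)) * jt J z z y) - L * κ * (χ z * max nb z y r2 ^ (-p))) := fun z => by
    by_cases hz : χ z = 0
    · simp [hz]
    have hs := chi_supp h2 h12 hz
    have w0 : 0 < nb z y := h2.trans_le hs.1
    have q := pe z
    rw [max_eq_left hs.1] at q ⊢
    have q' : ‖bv κ y z‖ ^ p = L * κ * nb z y ^ (-p) := by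
      rw [← kk]; exact mul_left_cancel₀ hz (by rw [q]; ring)
    have a1 : ⟪Fv p (J z), J z⟫ = na J z ^ p := by rw [Fv, real_inner_smul_left, real_inner_self_eq_norm_sq, rp2 lN nN]
    have a2 : ⟪Fv p (bv κ y z), bv κ y z⟫ = ‖bv κ y z‖ ^ p := by rw [Fv, real_inner_smul_left, real_inner_self_eq_norm_sq, rp2 lN nN]
    have a3 : ⟪Fv p (J z), bv κ y z⟫ = κ * (⟪Fl p J z, I * (z - y)⟫ / nb z y ^ 2) := by
      rw [bv, real_inner_smul_right]; show _ * ⟪Fl p J z, _⟫ = _; ring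
    have a4 : ⟪Fv p (bv κ y z), J z⟫ = L * (nb z y ^ (-p) * jt J z z y) := by
      rw [Fv, real_inner_smul_left, bv_norm, bv, real_inner_smul_left, real_inner_comm, Real.div_rpow (abs_nonneg _) w0.le, hL,
        show -p = -pm p + -(2 : ℕ) by push_cast; ring, Real.rpow_add w0, Real.rpow_neg w0.le, Real.rpow_neg w0.le, Real.rpow_natCast]
      field_simp
    rw [inner_sub_left, inner_sub_right, inner_sub_right, a1, a2, a3, a4, q']; ring
  have j1 : Integrable fun z => χ z * na J z ^ p - κ * (χ z * (⟪Fl p J z, I * (z - y)⟫ / max nb z y r2 ^ 2)) := i1.sub (i2.const_mul _)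
  have j2 : Integrable fun z => L * ((χ z * max nb z y r2 ^ (-p)) * jt J z z y) - L * κ * (χ z * max nb z y r2 ^ (-p)) :=
    (i3.const_mul _).sub (iβ.const_mul _)
  refine ⟨(j1.sub j2).congr (eF fun z => (pt z).symm), ?_, (iβ.const_mul (|cR κ| ^ p)).congr (eF fun z => (pe z).symm), ?_⟩
  · rw [integral_congr_ae (eF pt), integral_sub j1 j2, integral_sub i1 (i2.const_mul _), integral_sub (i3.const_mul _) (iβ.const_mul _),
      integral_const_mul, integral_const_mul, integral_const_mul, dg]
    have := (le_abs_self _).trans N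
    linarith
  · rw [integral_congr_ae (eF pe), integral_const_mul]

lemma neckQ {y : ℂ} {r1 r2 a b Λ : ℝ} {κ : ℤ} (h2 : 0 < r2) (ha : 2 * r2 ≤ a) (hab : a < b) (hb : 2 * b ≤ r1) (hy : ‖y‖ + 2 * r1 < 9 / 10)
    (hA : ∀ z, r2 ≤ nb z y → nb z y ≤ 2 * r1 → z ∈ GS U) (hκ : Deg J y r2 (2 * r1) κ) (hΛ : sp p * (∫ z, na J z ^ p) ≤ Λ) :
    ∃ r ∈ Ioo a b, (Integrable fun z => Pq y r z * ‖J z - bv κ y z‖ ^ p) ∧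
      (∫ z, Pq y r z * ‖J z - bv κ y z‖ ^ p) * (Real.log b - Real.log a) ≤
        2 * (4 * π * (De p J y r1 + De p J y r2) + Λ + 2 * π * |cR κ| ^ p) := by
  have p1 := d.p1
  have p2 := d.p2
  have h12 : r2 ≤ r1 := by linarith
  have h10 : 0 < r1 := by linarith
  obtain ⟨ig, Ig, ib, Ib⟩ := d.neckA h2 h12 hy hA hκ
  have mi := mint (y := y) (p := p) p2 h2 h12 (by have := norm_nonneg y; linarith)
  have sχ : HasCompactSupport fun z => Hc y r1 z - Hc y r2 z := (Hc_cs h10).sub (Hc_cs h2)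
  have iJ : Integrable fun z => Hd y r1 r2 z * na J z ^ p := icm d.iE (Hc_cont.sub Hc_cont) sχ
  have χ0 : ∀ z, 0 ≤ Hc y r1 z - Hc y r2 z := fun z => sub_nonneg.2 (Hc_anti h2 h12)
  set k : ℂ → ℝ := fun z => Hd y r1 r2 z * ⟪Fv p (J z) - Fv p (bv κ y z), J z - bv κ y z⟫ +
    (sp p * (Hd y r1 r2 z * na J z ^ p) + sp p * (Hd y r1 r2 z * ‖bv κ y z‖ ^ p)) with hk
  have i2 : Integrable fun z => sp p * (Hd y r1 r2 z * na J z ^ p) + sp p * (Hd y r1 r2 z * ‖bv κ y z‖ ^ p) :=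
    (iJ.const_mul sp p).add (ib.const_mul sp p)
  have ik : Integrable k := ig.add i2
  have k0 : ∀ z, 0 ≤ k z := fun z => by
    have := conv0 p1 p2 (J z) (bv κ y z)
    have := χ0 z
    have : 0 < 2 - p := by linarith
    positivity
  have kI : ∫ z, k z ≤ 4 * π * (De p J y r1 + De p J y r2) + Λ + 2 * π * |cR κ| ^ p := by
    have e : ∫ z, k z = (∫ z, Hd y r1 r2 z * ⟪Fv p (J z) - Fv p (bv κ y z), J z - bv κ y z⟫) +
      (sp p * (∫ z, Hd y r1 r2 z * na J z ^ p) + sp p * ∫ z, Hd y r1 r2 z * ‖bv κ y z‖ ^ p) := by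
      rw [← integral_const_mul, ← integral_const_mul, ← integral_add (iJ.const_mul _) (ib.const_mul _), ← integral_add ig i2]
    have s1 : ∫ z, Hd y r1 r2 z * na J z ^ p ≤ ∫ z, na J z ^ p := by
      rw [d.Isub]; linarith [d.Ie_le (y := y) (r := r1), Ie_nonneg (p := p) (J := J) (y := y) (r := r2)]
    have s2 := mL s1 (show 0 ≤ 2 - p by linarith)
    have s3 : sp p * ∫ z, Hd y r1 r2 z * ‖bv κ y z‖ ^ p ≤ 2 * π * |cR κ| ^ p := by
      rw [Ib]
      have r0 : 0 ≤ r2 ^ sp p := by positivity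
      calc _ = |cR κ| ^ p * (sp p * ∫ z, Hd y r1 r2 z * max nb z y r2 ^ (-p)) := by ring
        _ ≤ |cR κ| ^ p * (2 * π) := by
          refine mL ?_ pV
          exact mi.trans (mul_le_of_le_one_right (by have := Real.pi_pos; linarith) lN)
        _ = _ := by ring
    rw [e]; linarith
  obtain ⟨r, hr, e⟩ := MV ik y (show 0 < a by linarith) hab
  have r0 : 0 < r := by linarith [hr.1]
  have le1 : ∀ z, Pq y r z * ‖J z - bv κ y z‖ ^ p ≤ 2 * (Pq y r z * k z) := fun z => by
    by_cases hP : Pc y r z = 0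
    · simp [hP]
    have hz := Pc_supp r0 hP
    have c1 : Hc y r1 z - Hc y r2 z = 1 := by
      rw [Hc_one h10 (by linarith [hr.2]), Hc_zero h2 (by linarith [hr.1]), sub_zero]
    have P0 := Pc_nonneg (y := y) (r := r) (z := z)
    have := conv1 p1 p2 (J z) (bv κ y z)
    calc _ ≤ Pq y r z * (2 * k z) := by
          gcongr; refine this.trans (le_of_eq ?_); simp only [hk, c1]; ring
      _ = _ := by ring
  have iPk : Integrable fun z => Pq y r z * k z := icm ik (Pc_cont.mul fP) (Pc_cs r0).mul_right
  have iQ : Integrable fun z => Pq y r z * ‖J z - bv κ y z‖ ^ p := by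
    refine (iPk.const_mul 2).mono' ?_ (eF fun z => ?_)
    · refine AEStronglyMeasurable.mul ((Pc_cont.mul fP).aestronglyMeasurable) ?_
      exact (((d.mJ.sub bv_meas.aestronglyMeasurable).norm.aemeasurable).pow_const p).aestronglyMeasurable
    · rw [Real.norm_of_nonneg (mul_nonneg (mul_nonneg Pc_nonneg pV) pV)]; exact le1 z
  refine ⟨r, hr, iQ, ?_⟩
  have lg : 0 ≤ Real.log b - Real.log a := by
    have := Real.log_le_log (show 0 < a by linarith) hab.le; linarith
  have m1 := integral_mono iQ (iPk.const_mul 2) le1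
  rw [integral_const_mul] at m1
  have ih1 : Integrable fun z => Hc y b z * k z := icm ik Hc_cont (Hc_cs lN)
  have ih2 : Integrable fun z => Hc y a z * k z := icm ik Hc_cont (Hc_cs lN)
  have m2 : ∫ z, (Hc y b z - Hc y a z) * k z ≤ ∫ z, k z := by
    refine integral_mono ?_ ik fun z => ?_
    · simp only [sub_mul]; exact ih1.sub ih2
    · have := Hc_le (y := y) (r := b) (z := z)
      have := Hc_nonneg (y := y) (r := a) (z := z)
      nlinarith [k0 z]
  calc _ ≤ (2 * ∫ z, Pq y r z * k z) * (Real.log b - Real.log a) := by gcongr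
    _ = 2 * ∫ z, (Hc y b z - Hc y a z) * k z := by rw [← e]; ring
    _ ≤ _ := by linarith
end Dat
end

open MeasureTheory Metric Filter Topology Set
open scoped ENNReal NNReal Convolution
noncomputable section
open Complex (I)

lemma rIneq {p x N w B : ℝ} (hp : 0 < p) (p2 : p ≤ 2) (hw : 0 ≤ w) (hN : 0 ≤ N) (hB : 0 ≤ B) (h1 : |x| ≤ w * N) (h2 : |x| ≤ w * B) :
    N ^ pm p * x ^ 2 ≤ w ^ 2 * B ^ p := by
  rcases hw.eq_or_lt with rfl | hw
  · have : x = 0 := abs_nonpos_iff.1 lN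
    rw [this]; simp
  have e : x ^ 2 = w ^ 2 * (|x| / w) ^ 2 := by rw [div_pow, sq_abs]; field_simp
  set t := |x| / w with ht
  have tN : t ≤ N := by rw [ht, div_le_iff₀ hw]; linarith
  have tB : t ≤ B := by rw [ht, div_le_iff₀ hw]; linarith
  have t0 : 0 ≤ t := by positivity
  rw [e]
  rcases t0.eq_or_lt with h0 | h0
  · rw [← h0]; simp; positivity
  calc _ = w ^ 2 * (N ^ pm p * t ^ 2) := by ring
    _ ≤ w ^ 2 * (t ^ pm p * t ^ 2) := by gcongr w ^ 2 * (?_ * t ^ 2); exact Real.rpow_le_rpow_of_nonpos h0 tN lN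
    _ = w ^ 2 * t ^ p := by rw [rp2 hp t0]
    _ ≤ _ := by gcongr

lemma kpow {κ : ℤ} {p K : ℝ} (p1 : 1 < p) (p2 : p < 2) (hK : |cR κ| ≤ K) :
    |cR κ| ^ p ≤ cR κ ^ 2 ∧ cR κ ^ 2 - |cR κ| ^ p ≤ sp p * K ^ 3 ∧ cR κ ^ 2 ≤ K ^ 2 := by
  have K0 : 0 ≤ K := (abs_nonneg _).trans hK
  have e : cR κ ^ 2 ≤ K ^ 2 := by rw [← sq_abs]; gcongr
  by_cases h : κ = 0
  · subst h
    simp only [Int.cast_zero, abs_zero]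
    rw [Real.zero_rpow lN]
    refine ⟨by simp, ?_, by simpa using e⟩
    have : 0 ≤ sp p * K ^ 3 := mul_nonneg lN pV
    simpa using this
  have h1 : 1 ≤ |cR κ| := by exact_mod_cast Int.one_le_abs h
  have e2 : cR κ ^ 2 = |cR κ| ^ p * |cR κ| ^ sp p := by
    rw [← Real.rpow_add lN, ← sq_abs]; simp
  have b := rpow_one_add_le_one_add_mul_self (s := |cR κ| - 1) (p := 2 - p) lN lN lN
  rw [add_sub_cancel] at b
  have b1 : 1 ≤ |cR κ| ^ sp p := Real.one_le_rpow h1 lN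
  have n0 : 0 ≤ |cR κ| ^ p := by positivity
  have f : |cR κ| ^ p ≤ cR κ ^ 2 := by rw [e2]; exact le_mul_of_one_le_right n0 b1
  refine ⟨f, ?_, e⟩
  calc _ = |cR κ| ^ p * (|cR κ| ^ sp p - 1) := by rw [e2]; ring
    _ ≤ K ^ 2 * (sp p * K) := by
      refine mul_le_mul (f.trans e) ?_ lN pV
      have : sp p * |cR κ| ≤ sp p * K := mL hK lN
      linarith
    _ = _ := by ring

namespace Dat
variable {p : ℝ} {U J : ℂ → ℂ} (d : Dat p U J)
include d

set_option maxHeartbeats 1000000 in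
lemma neckR {y : ℂ} {r ρ g C1 K : ℝ} {κ : ℤ} (hρ : 0 < ρ) (hr : ρ ≤ r) (hr1 : 2 * r ≤ 1) (hy : ‖y‖ + 2 * r < 2)
    (iQ : Integrable fun z => Pq y r z * ‖J z - bv κ y z‖ ^ p) (hg : 0 < g) (g2 : g ≤ 1 / 2) (hs : 2 - p = g ^ 2)
    (hQ : (∫ z, Pq y r z * ‖J z - bv κ y z‖ ^ p) ≤ g ^ 2 * C1) (hK : |cR κ| ≤ K) :
    |sp p * Ie p J y r - 2 * π * cR κ ^ 2| ≤ g * (4 * (2 * π * K ^ 2) + 5 * C1 + 2 * π * K ^ 3) + 2 * π * cR κ ^ 2 * (1 - ρ ^ sp p) ∧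
    sp p * De p J y r ≤ g * (5 * (2 * π * K ^ 2) + 3 * C1) := by
  have p1 := d.p1
  have p2 := d.p2
  have r0 : 0 < r := by linarith
  have pi0 := Real.pi_pos
  have K0 : 0 ≤ K := (abs_nonneg _).trans hK
  obtain ⟨k1, k2, k3⟩ := kpow lN p2 hK
  set Q := ∫ z, Pq y r z * ‖J z - bv κ y z‖ ^ p with hQd
  have iP0 : Integrable (Pc y r) := Pc_cont.integrable_of_hasCompactSupport (Pc_cs r0)
  have P0 : ∀ z, 0 ≤ Pc y r z := fun z => Pc_nonneg
  have Q0 : 0 ≤ Q := integral_nonneg fun z => mul_nonneg (mul_nonneg (P0 z) pV) pV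
  have C0 : 0 ≤ C1 := by have : 0 < g ^ 2 := by positivity
                         by_contra h; nlinarith
  have gg : g ^ 2 ≤ g := by nlinarith
  have RQ : Rr p J y r ≤ Q := integral_mono (d.iR r0) iQ fun z => by
    simp only [mul_assoc]
    refine mL ?_ (P0 z)
    refine rIneq lN p2.le nN nN nN (abs_real_inner_le_norm _ _) ?_
    have : ⟪z - y, J z⟫ = ⟪z - y, J z - bv κ y z⟫ := by rw [inner_sub_right, bv_perp, sub_zero]
    rw [this]; exact abs_real_inner_le_norm _ _
  have eV : ∀ z, Pq y r z * ‖bv κ y z‖ ^ p = |cR κ| ^ p * (Pc y r z * nb z y ^ sp p) := fun z => by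
    by_cases hP : Pc y r z = 0
    · simp [hP]
    have w0 : 0 < nb z y := r0.trans (Pc_supp r0 hP).1
    rw [bv_norm, Real.div_rpow (abs_nonneg _) w0.le, Real.rpow_sub w0, Real.rpow_two]; ring
  have iV0 : Integrable fun z => Pc y r z * nb z y ^ sp p :=
    (Pc_cont.mul ((by fun_prop : Continuous fun z : ℂ => nb z y).rpow_const fun z => Or.inr lN)).integrable_of_hasCompactSupport (Pc_cs r0).mul_right
  have iV : Integrable fun z => Pq y r z * ‖bv κ y z‖ ^ p := (iV0.const_mul (|cR κ| ^ p)).congr (eF fun z => (eV z).symm)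
  set V := ∫ z, Pq y r z * ‖bv κ y z‖ ^ p with hV
  have V1 : V ≤ 2 * π * |cR κ| ^ p := by
    rw [hV, integral_congr_ae (eF eV), integral_const_mul, mul_comm, ← Pc_int r0 (y := y)]
    refine mul_le_mul_of_nonneg_right (integral_mono iV0 iP0 fun z => ?_) pV
    by_cases hP : Pc y r z = 0
    · simp [hP]
    exact mul_le_of_le_one_right (P0 z) (Real.rpow_le_one nN (by linarith [(Pc_supp r0 hP).2]) lN)
  have V2 : 2 * π * |cR κ| ^ p * ρ ^ sp p ≤ V := by
    rw [hV, integral_congr_ae (eF eV), integral_const_mul, ← Pc_int r0 (y := y), mul_comm _ (|cR κ| ^ p), mul_assoc, ← integral_mul_const]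
    refine mL (integral_mono (iP0.mul_const _) iV0 fun z => ?_) pV
    by_cases hP : Pc y r z = 0
    · simp [hP]
    exact mL (Real.rpow_le_rpow hρ.le (by linarith [(Pc_supp r0 hP).1]) lN) (P0 z)
  have V0 : 0 ≤ V := integral_nonneg fun z => mul_nonneg (mul_nonneg (P0 z) pV) pV
  have cmp : ∀ A B : ℂ → ℂ, (Integrable fun z => Pq y r z * na A z ^ p) → (Integrable fun z => Pq y r z * na B z ^ p) →
      (∀ z, na A z ≤ na B z + ‖J z - bv κ y z‖) →
      ∫ z, Pq y r z * na A z ^ p ≤ (1 + 2 * g) * (∫ z, Pq y r z * na B z ^ p) + g⁻¹ * Q := fun A B iA iB h => by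
    rw [hQd, ← integral_const_mul, ← integral_const_mul, ← integral_add (iB.const_mul _) (iQ.const_mul _)]
    refine integral_mono iA ((iB.const_mul _).add (iQ.const_mul _)) fun z => ?_
    have c := conv4 (p := p) (g := g) lN p2.le hg g2 (norm_nonneg (B z)) (norm_nonneg (J z - bv κ y z))
    have h' := Real.rpow_le_rpow nN (h z) (show 0 ≤ p by linarith)
    have := P0 z
    calc _ ≤ Pq y r z * ((1 + 2 * g) * na B z ^ p + g⁻¹ * ‖J z - bv κ y z‖ ^ p) := by gcongr; exact h'.trans c
      _ = _ := by ring
  have c1 := cmp J (bv κ y) (d.iP r0) iV fun z => by have := norm_add_le (bv κ y z) (J z - bv κ y z); simpa using this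
  have c2 := cmp (bv κ y) J iV (d.iP r0) fun z => by have := norm_sub_le (J z) (J z - bv κ y z); simpa using this
  change De p J y r ≤ (1 + 2 * g) * V + g⁻¹ * Q at c1
  change V ≤ (1 + 2 * g) * De p J y r + g⁻¹ * Q at c2
  have D0 := De_nonneg (p := p) (J := J) (y := y) (r := r)
  have st := d.stat1 (y := y) r0 hy
  set D := De p J y r
  have gQ : g⁻¹ * Q ≤ g * C1 := by
    rw [inv_mul_le_iff₀ hg]; linarith
  have R0 := Rr_nonneg (p := p) (J := J) (y := y) (r := r)
  clear_value D Q V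
  set W := 2 * π * K ^ 2 with hW
  have VW : V ≤ W := V1.trans (by rw [hW]; exact mL (k1.trans k3) pV)
  have u1 : D - V ≤ g * (2 * V + C1) := by linarith
  have u2 : V - D ≤ g * (2 * D + C1) := by linarith
  have gV : g * V ≤ g * W := by gcongr
  have gC : g * (g * C1) ≤ 1 / 2 * (g * C1) := by gcongr
  have gV2 : g * (g * V) ≤ 1 / 2 * (g * V) := by gcongr
  have gD : g * D ≤ g * (V + g * (2 * V + C1)) := by gcongr; linarith
  have gV0 : 0 ≤ g * V := by positivity
  have gW0 : 0 ≤ g * W := gV0.trans gV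
  have gC0 : 0 ≤ g * C1 := by positivity
  have u3 : |D - V| ≤ g * (4 * W + 3 * C1) := by rw [abs_le]; constructor <;> linarith
  constructor
  · rw [st]
    have w1 : p * Rr p J y r ≤ 2 * (1 / 2 * (g * C1)) := by
      have : Rr p J y r ≤ 1 / 2 * (g * C1) := by rw [sq, mul_assoc] at hQ; linarith
      exact mul_le_mul p2.le this R0 nU
    have w0 : 0 ≤ p * Rr p J y r := mul_nonneg lN R0
    have w2 : V ≤ 2 * π * cR κ ^ 2 := V1.trans (by gcongr)
    have ρ0 : 0 ≤ ρ ^ sp p := by positivity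
    have ρ1 : ρ ^ sp p ≤ 1 := Real.rpow_le_one hρ.le lN lN
    have w3 : 2 * π * cR κ ^ 2 - V ≤ 2 * π * (g * K ^ 3) + 2 * π * cR κ ^ 2 * (1 - ρ ^ sp p) := by
      have x1 : cR κ ^ 2 - |cR κ| ^ p ≤ g * K ^ 3 := k2.trans (by rw [hs]; gcongr)
      have x2 : |cR κ| ^ p * (1 - ρ ^ sp p) ≤ cR κ ^ 2 * (1 - ρ ^ sp p) := mul_le_mul_of_nonneg_right k1 lN
      have x3 := mL (add_le_add x1 x2) (show 0 ≤ 2 * π by positivity)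
      linarith
    have w4 := abs_le.1 u3
    have w5 : 0 ≤ 2 * π * (g * K ^ 3) := by positivity
    have w6 : 0 ≤ 2 * π * cR κ ^ 2 * (1 - ρ ^ sp p) := mul_nonneg pV lN
    rw [abs_le]; constructor <;> linarith
  · rw [hs]
    have := abs_le.1 u3
    have t1 : D ≤ W + (4 * W + 3 * C1) * g := by linarith
    have h1 : g ^ 2 * D ≤ g * (1 * D) := by rw [sq, mul_assoc]; gcongr; linarith
    have h2 : g * ((4 * W + 3 * C1) * g) ≤ 1 * (g * (4 * W + 3 * C1)) := by
      have h0 : 0 ≤ g * (4 * W + 3 * C1) := by linarith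
      have := mul_le_of_le_one_left h0 (show g ≤ 1 by linarith)
      linarith
    have h3 : g * D ≤ g * (W + (4 * W + 3 * C1) * g) := by gcongr
    linarith

set_option maxHeartbeats 1000000 in
lemma neck {Λ δ : ℝ} (hΛ0 : 0 ≤ Λ) (hδ : 0 < δ) {y : ℂ} {ρ q : ℝ} (hΛ : sp p * (∫ z, na J z ^ p) ≤ Λ) (hρ : 0 < ρ) (hq : 2 ≤ q)
    (hy : ‖y‖ + ρ * q ^ 6 < 9 / 10) (hA : ∀ z, ρ ≤ nb z y → nb z y ≤ ρ * q ^ 6 → z ∈ GS U) (hδq : δ ≤ sp p * Real.log q)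
    (hρ2 : 1 / 2 ≤ ρ ^ sp p) (hs : 2 - p ≤ 1 / 4) {K C : ℝ} (hK : K = 1 + Λ / δ)
    (hC : C = 13 * (2 * π * K ^ 2) + 5 * (2 / δ * (8 * π * (Λ / δ) + Λ + 2 * π * K ^ 2)) + 2 * π * K ^ 3) :
    ∃ (κ : ℤ) (r : ℝ), ρ < r ∧ 2 * r < ρ * q ^ 6 ∧ Deg J y ρ (ρ * q ^ 6) κ ∧ |cR κ| ≤ K ∧
      |sp p * Ie p J y r - 2 * π * cR κ ^ 2| ≤ C * Real.sqrt sp p + 2 * π * cR κ ^ 2 * (1 - ρ ^ sp p) ∧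
      sp p * De p J y r ≤ C * Real.sqrt sp p := by
  have p1 := d.p1
  have p2 := d.p2
  have pi3 := Real.pi_gt_three
  have s0 : 0 < 2 - p := by linarith
  have q0 : 0 < q := by linarith
  have lq : 0 < Real.log q := Real.log_pos lN
  have t0 : ∀ j : ℕ, 0 < ρ * q ^ j := fun j => by positivity
  have tS : ∀ j : ℕ, 2 * (ρ * q ^ j) ≤ ρ * q ^ (j + 1) := fun j => by rw [pow_succ]; nlinarith [t0 j]
  have tL : ∀ j : ℕ, Real.log (ρ * q ^ (j + 1)) - Real.log (ρ * q ^ j) = Real.log q := fun j => by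
    rw [pow_succ, ← mul_assoc, Real.log_mul (t0 j).ne' q0.ne']; ring
  have X0 : 0 ≤ Λ / δ := by positivity
  have mv : ∀ j : ℕ, ∃ r ∈ Ioo (ρ * q ^ j) (ρ * q ^ (j + 1)), De p J y r ≤ Λ / δ := fun j => by
    obtain ⟨r, hr, e⟩ := d.MVD y (t0 j) (show ρ * q ^ j < ρ * q ^ (j + 1) by linarith [tS j, t0 j])
    refine ⟨r, hr, ?_⟩
    rw [tL] at e
    have D0 := De_nonneg (p := p) (J := J) (y := y) (r := r)
    have i1 := d.Ie_le (y := y) (r := ρ * q ^ (j + 1))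
    have i2 := Ie_nonneg (p := p) (J := J) (y := y) (r := ρ * q ^ j)
    rw [le_div_iff₀ hδ]
    calc _ ≤ De p J y r * (sp p * Real.log q) := by gcongr
      _ = sp p * (De p J y r * Real.log q) := by ring
      _ ≤ sp p * ∫ z, na J z ^ p := by gcongr; linarith
      _ ≤ Λ := hΛ
  obtain ⟨r2, hr2, D2⟩ := mv 0
  obtain ⟨r1, hr1, D1⟩ := mv 4
  have T0 := tS 0
  have T1 := tS 1
  have T2 := tS 2
  have T3 := tS 3
  have T4 := tS 4
  have T5 := tS 5
  have u0 := t0 1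
  have u2 := t0 2
  have u3 := t0 3
  norm_num only [pow_zero, mul_one] at hr2 hr1 T0 T1 T2 T3 T4 T5
  obtain ⟨κ, hκ⟩ := d.degree hρ (show ρ < ρ * q ^ 6 by linarith) hA
  change Deg J y ρ (ρ * q ^ 6) κ at hκ
  have r20 : 0 < r2 := hρ.trans hr2.1
  have hκ2 : Deg J y r2 (2 * r1) κ := hκ.mono hr2.1.le (by linarith [hr1.2])
  have kK : |cR κ| ≤ K := by
    have b := d.degB r20 one_pos (hκ2.mono le_rfl (by linarith [hr1.1, hr2.2]))
    rw [Real.one_rpow, one_mul] at b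
    have : r2 ^ pm p ≤ 2 := by
      rw [show p - 2 = -sp p by ring, Real.rpow_neg r20.le]
      have : ρ ^ sp p ≤ r2 ^ sp p := Real.rpow_le_rpow hρ.le hr2.1.le s0.le
      rw [inv_le_comm₀ pV nU]; linarith
    have : r2 ^ pm p * De p J y r2 ≤ 2 * (Λ / δ) := mul_le_mul this D2 De_nonneg nU
    have k0 := abs_nonneg cR κ
    rw [hK]; by_contra hc
    have hc := not_le.1 hc
    nlinarith
  obtain ⟨r, hr, iQ, hQ⟩ := d.neckQ (a := ρ * q ^ 2) (b := ρ * q ^ 3) r20 (by linarith [hr2.2]) lN (by linarith [hr1.1]) (by linarith [hr1.2])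
    (fun z z1 z2 => hA z (by linarith [hr2.1]) (by linarith [hr1.2])) hκ2 hΛ
  have tL2 : Real.log (ρ * q ^ 3) - Real.log (ρ * q ^ 2) = Real.log q := tL 2
  rw [tL2] at hQ
  have sq : 2 - p = Real.sqrt sp p ^ 2 := (Real.sq_sqrt s0.le).symm
  have ny := norm_nonneg y
  obtain ⟨k1, k2, k3⟩ := kpow lN p2 kK
  have Q0 : 0 ≤ ∫ z, Pq y r z * ‖J z - bv κ y z‖ ^ p := integral_nonneg fun z => mul_nonneg (mul_nonneg Pc_nonneg pV) pV
  have hQ' : (∫ z, Pq y r z * ‖J z - bv κ y z‖ ^ p) ≤ Real.sqrt sp p ^ 2 * (2 / δ * (8 * π * (Λ / δ) + Λ + 2 * π * K ^ 2)) := by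
    rw [← sq]
    have a1 : 4 * π * (De p J y r1 + De p J y r2) ≤ 4 * π * (Λ / δ + Λ / δ) := by gcongr
    have a2 : 2 * π * |cR κ| ^ p ≤ 2 * π * K ^ 2 := by gcongr; exact k1.trans k3
    have a3 : (∫ z, Pq y r z * ‖J z - bv κ y z‖ ^ p) * δ ≤ sp p * (2 * (8 * π * (Λ / δ) + Λ + 2 * π * K ^ 2)) := by
      calc _ ≤ (∫ z, Pq y r z * ‖J z - bv κ y z‖ ^ p) * (sp p * Real.log q) := by gcongr
        _ = sp p * ((∫ z, Pq y r z * ‖J z - bv κ y z‖ ^ p) * Real.log q) := by ring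
        _ ≤ _ := mL lN s0.le
    rw [← le_div_iff₀ hδ] at a3
    refine a3.trans (le_of_eq (by ring))
  obtain ⟨c1, c2⟩ := d.neckR hρ (r := r) (by linarith [hr.1]) (by linarith [hr.2]) (by linarith [hr.2]) iQ (Real.sqrt_pos.2 s0)
    (by rw [Real.sqrt_le_left nU]; linarith) sq hQ' kK
  have K1 : 1 ≤ K := by rw [hK]; linarith
  set C1 := 2 / δ * (8 * π * (Λ / δ) + Λ + 2 * π * K ^ 2)
  have C0 : 0 ≤ C1 := by positivity
  set g := Real.sqrt sp p
  have g0 : 0 ≤ g := Real.sqrt_nonneg _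
  have z1 : 0 ≤ g * (2 * π * K ^ 2) := by positivity
  have z2 : 0 ≤ g * (2 * π * K ^ 3) := by positivity
  have z3 : 0 ≤ g * C1 := by positivity
  refine ⟨κ, r, by linarith [hr.1], by linarith [hr.2], hκ, kK, c1.trans ?_, c2.trans ?_⟩
  · rw [hC]; linarith
  · rw [hC]; linarith
end Dat
end

open MeasureTheory Metric Filter Topology Set
open scoped ENNReal NNReal Convolution
noncomputable section
open Complex (I)

def Ann : Set ℂ := {z | 1 / 32 ≤ ‖z‖ ∧ ‖z‖ ≤ 3 / 2}
lemma Ann_meas : MeasurableSet Ann :=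
  (measurableSet_le measurable_const measurable_norm).inter (measurableSet_le measurable_norm measurable_const)
def Sg (U : ℂ → ℂ) : Set ℂ := {y | ‖y‖ ≤ 1 / 2 ∧ y ∉ GS U}

section ZeG
variable {Y : Finset ℂ} {ρ : ℂ → ℝ} {T : ℝ} (hT : T ≤ 1 / 64) (hY : ∀ y ∈ Y, 0 < ρ y ∧ 2 * ρ y ≤ T ∧ ‖y‖ < 1 / 16)
  (hsep : ∀ y ∈ Y, ∀ y' ∈ Y, y ≠ y' → 4 * T ≤ ‖y - y'‖) {z : ℂ}
include hT hY hsep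
lemma Ze1 {y : ℂ} (hy : y ∈ Y) (hz : nb z y < 2 * ρ y) : Ze 0 (1 / 4) Y ρ z = 1 - Hc y (ρ y) z := by
  obtain ⟨h1, h2, h3⟩ := hY y hy
  rw [Ze, Hc_one nU (by have := norm_sub_norm_le z y; rw [sub_zero]; linarith), Finset.sum_eq_single y]
  · intro y' hy' hne
    obtain ⟨h1', h2', h3'⟩ := hY y' hy'
    have := hsep y hy y' hy' hne.symm
    have : ‖y - y'‖ ≤ nb y z + ‖z - y'‖ := norm_sub_le_norm_sub_add_norm_sub _ _ _
    rw [norm_sub_rev y z] at this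
    exact Hc_zero h1' lN
  · exact fun h => absurd hy h
lemma Ze2 : (∃ y ∈ Y, nb z y < 2 * ρ y) ∨ ((∀ y ∈ Y, 2 * ρ y ≤ nb z y) ∧ Ze 0 (1 / 4) Y ρ z = Hc 0 (1 / 4) z) := by
  by_cases h : ∃ y ∈ Y, nb z y < 2 * ρ y
  · exact Or.inl h
  · push Not at h
    refine Or.inr ⟨h, ?_⟩
    rw [Ze, Finset.sum_eq_zero fun y hy => Hc_zero (hY y hy).1 (h y hy), sub_zero]
lemma Ze_nonneg : 0 ≤ Ze 0 (1 / 4) Y ρ z := by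
  rcases Ze2 hT hY hsep (z := z) with ⟨y, hy, h⟩ | ⟨-, h⟩
  · rw [Ze1 hT hY hsep hy h]; linarith [Hc_le (y := y) (r := ρ y) (z := z)]
  · rw [h]; exact Hc_nonneg
lemma Ze_ts : tsupport (Ze 0 (1 / 4) Y ρ) ⊆ {z | ‖z‖ ≤ 1 / 2 ∧ ∀ y ∈ Y, ρ y ≤ nb z y} := by
  refine closure_minimal (fun z hz => ?_) ?_
  · rcases Ze2 hT hY hsep (z := z) with ⟨y, hy, h⟩ | ⟨h1, h⟩
    · obtain ⟨k1, k2, k3⟩ := hY y hy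
      refine ⟨by have := norm_sub_norm_le z y; linarith, fun y' hy' => ?_⟩
      by_cases e : y' = y
      · subst e
        by_contra hc
        exact hz (by rw [Ze1 hT hY hsep hy h, Hc_one k1 lN, sub_self])
      · obtain ⟨k1', k2', k3'⟩ := hY y' hy'
        have := hsep y hy y' hy' (Ne.symm e)
        have : ‖y - y'‖ ≤ nb y z + ‖z - y'‖ := norm_sub_le_norm_sub_add_norm_sub _ _ _
        rw [norm_sub_rev y z] at this
        linarith
    · refine ⟨?_, fun y hy => by linarith [h1 y hy, (hY y hy).1]⟩
      rw [Function.mem_support, h] at hz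
      have := Hc_lt nU hz
      rw [sub_zero] at this; linarith
  · rw [show {z : ℂ | ‖z‖ ≤ 1 / 2 ∧ ∀ y ∈ Y, ρ y ≤ nb z y} = {z | ‖z‖ ≤ 1 / 2} ∩ ⋂ y ∈ Y, {z | ρ y ≤ nb z y} by ext; simp]
    refine (isClosed_le continuous_norm continuous_const).inter (isClosed_biInter fun y _ => isClosed_le continuous_const fP)
end ZeG

namespace Dat
variable {p : ℝ} {U J : ℂ → ℂ} (d : Dat p U J)
include d

lemma ann_le {c : ℂ → ℝ} {A : ℝ} (hc : ∀ z, 0 ≤ c z) (hA : ∀ z, c z ≤ A) (hs : ∀ z, c z ≠ 0 → z ∈ Ann) :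
    ∫ z, c z * na J z ^ p ≤ A * ∫ z in Ann, na J z ^ p := by
  rw [← integral_indicator Ann_meas, ← integral_const_mul]
  have A0 : 0 ≤ A := (hc 0).trans (hA 0)
  refine integral_mono_of_nonneg (eF fun z => mul_nonneg (hc z) pV) ((d.iE.indicator Ann_meas).const_mul A)
    (eF fun z => ?_)
  simp only
  by_cases h : c z = 0
  · rw [h, zero_mul]; exact mul_nonneg A0 (indicator_nonneg (fun z _ => by positivity) z)
  · rw [indicator_of_mem (hs z h)]; exact mul_le_mul_of_nonneg_right (hA z) pV

lemma Sg_low {y : ℂ} {r : ℝ} (hy : y ∈ Sg U) (h0 : 0 < r) (h1 : r ≤ 1 / 4) (hs : 2 - p < 1 / 400) :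
    eps1 / 10 * r ^ sp p ≤ sp p * Ie p J y r := by
  have p2 := d.p2
  have : eps1 / 10 ≤ sp p * Th p J y r := by
    by_contra hc
    exact hy.2 (d.gap hy.1 h0 h1 hs (not_le.1 hc))
  rw [IeT y h0]
  calc _ ≤ sp p * Th p J y r * r ^ sp p := by gcongr
    _ = _ := by ring

lemma Sg_small {y : ℂ} {ω : ℝ} (hy : y ∈ Sg U) (hs : 2 - p < 1 / 400) (hω : sp p * (∫ z in Ann, na J z ^ p) ≤ ω) (h : ω < eps1 / 640) : ‖y‖ < 1 / 16 := by
  by_contra hc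
  have hc := not_lt.1 hc
  have p2 := d.p2
  have l := d.Sg_low hy (show zR < 1 / 64 by norm_num) nU hs
  have e : (1 / 64 : ℝ) ≤ (1 / 64) ^ sp p := by
    have := Real.rpow_le_rpow_of_exponent_ge (show zR < 1 / 64 by norm_num) nU (show 2 - p ≤ 1 by linarith)
    simpa using this
  have a := d.ann_le (c := Hc y (1 / 64)) (A := 1) (fun z => Hc_nonneg) (fun z => Hc_le) fun z hz => by
    have h1 := Hc_lt nU hz
    have h2 := norm_sub_norm_le z y
    have h3 := norm_sub_norm_le y z
    rw [norm_sub_rev] at h3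
    exact ⟨by linarith, by linarith [hy.1]⟩
  change Ie p J y (1 / 64) ≤ _ at a
  rw [one_mul] at a
  have a' := mL a (show 0 ≤ 2 - p by linarith)
  have := mL e (show 0 ≤ eps1 / 10 by linarith [eps1_pos])
  linarith

lemma Sg_pack {Y : Finset ℂ} {τ Λ : ℝ} (hY : ∀ y ∈ Y, y ∈ Sg U) (hτ : 0 < τ) (hτ1 : τ ≤ 1) (hτs : 1 / 2 ≤ τ ^ sp p) (hs : 2 - p < 1 / 400)
    (hsep : ∀ y ∈ Y, ∀ y' ∈ Y, y ≠ y' → τ ≤ ‖y - y'‖) (hΛ : sp p * (∫ z, na J z ^ p) ≤ Λ) : Y.card * (eps1 / 80) ≤ Λ := by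
  have p2 := d.p2
  have l : ∀ y ∈ Y, eps1 / 80 ≤ sp p * Ie p J y (τ / 4) := fun y hy => by
    refine le_trans ?_ (d.Sg_low (hY y hy) (show 0 < τ / 4 by linarith) lN hs)
    have e : (1 / 4 : ℝ) ≤ (1 / 4) ^ sp p := by
      have := Real.rpow_le_rpow_of_exponent_ge (show zR < 1 / 4 by norm_num) nU (show 2 - p ≤ 1 by linarith)
      simpa using this
    rw [show τ / 4 = 1 / 4 * τ by ring, Real.mul_rpow nU hτ.le]
    have ep := eps1_pos
    calc _ = eps1 / 10 * (1 / 4 * (1 / 2)) := by ring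
      _ ≤ _ := by gcongr
  have b : ∑ y ∈ Y, Ie p J y (τ / 4) ≤ ∫ z, na J z ^ p := by
    unfold Ie
    rw [← integral_finsetSum _ fun y _ => d.iH]
    refine integral_mono (integrable_finsetSum _ fun y _ => d.iH) d.iE fun z => ?_
    simp only
    rw [← Finset.sum_mul]
    refine mul_le_of_le_one_left pV ?_
    by_cases h : ∃ y ∈ Y, nb z y < τ / 2
    · obtain ⟨y, hy, hz⟩ := h
      rw [Finset.sum_eq_single y]
      · exact Hc_le
      · intro y' hy' hne
        have := hsep y hy y' hy' hne.symm
        have : ‖y - y'‖ ≤ nb y z + ‖z - y'‖ := norm_sub_le_norm_sub_add_norm_sub _ _ _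
        rw [norm_sub_rev y z] at this
        exact Hc_zero lN lN
      · exact fun h => absurd hy h
    · push Not at h
      rw [Finset.sum_eq_zero fun y hy => Hc_zero lN (by linarith [h y hy])]
      norm_num
  calc _ = ∑ y ∈ Y, eps1 / 80 := by rw [Finset.sum_const, nsmul_eq_mul]
    _ ≤ ∑ y ∈ Y, sp p * Ie p J y (τ / 4) := Finset.sum_le_sum l
    _ = sp p * ∑ y ∈ Y, Ie p J y (τ / 4) := by rw [Finset.mul_sum]
    _ ≤ sp p * ∫ z, na J z ^ p := by gcongr
    _ ≤ _ := hΛ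

lemma Sg_scale {M : ℕ} {τ : ℕ → ℝ} {Λ : ℝ} (hM : Λ < (M + 1 : ℕ) * (eps1 / 80)) (hτ : ∀ k, 0 < τ k) (hτ1 : ∀ k, τ k ≤ 1) (hd : ∀ k, τ (k + 1) ≤ τ k)
    (hτs : ∀ k ≤ M + 1, 1 / 2 ≤ τ k ^ sp p) (hs : 2 - p < 1 / 400) (hΛ : sp p * (∫ z, na J z ^ p) ≤ Λ) :
    ∃ k ≤ M, ∃ Y : Finset ℂ, Y.card ≤ M ∧ (∀ y ∈ Y, y ∈ Sg U) ∧ (∀ y ∈ Y, ∀ y' ∈ Y, y ≠ y' → τ k ≤ ‖y - y'‖) ∧ ∀ x ∈ Sg U, ∃ y ∈ Y, nb x y ≤ τ (k + 1) := by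
  by_contra hc
  push Not at hc
  have ind : ∀ k ≤ M + 1, ∃ Y : Finset ℂ, Y.card = k ∧ (∀ y ∈ Y, y ∈ Sg U) ∧ (∀ y ∈ Y, ∀ y' ∈ Y, y ≠ y' → τ k ≤ ‖y - y'‖) := by
    intro k
    induction k with
    | zero => exact fun _ => ⟨∅, by simp⟩
    | succ k ih =>
      intro hk
      obtain ⟨Y, h1, h2, h3⟩ := ih (by omega)
      obtain ⟨x, hx, hxY⟩ := hc k (by omega) Y (by omega) h2 h3
      refine ⟨insert x Y, ?_, ?_, ?_⟩
      · rw [Finset.card_insert_of_notMem, h1]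
        intro h; have := hxY x h; rw [sub_self, norm_zero] at this; linarith [hτ (k + 1)]
      · intro y hy
        rcases Finset.mem_insert.1 hy with rfl | hy
        exacts [hx, h2 y hy]
      · intro y hy y' hy' hne
        rcases Finset.mem_insert.1 hy with rfl | hyY <;> rcases Finset.mem_insert.1 hy' with rfl | hyY'
        · exact absurd rfl hne
        · exact (hxY y' hyY').le
        · rw [norm_sub_rev]; exact (hxY y hyY).le
        · exact (hd k).trans (h3 y hyY y' hyY' hne)
  obtain ⟨Y, h1, h2, h3⟩ := ind (M + 1) le_rfl
  have := d.Sg_pack h2 (hτ _) (hτ1 _) (hτs _ le_rfl) hs h3 hΛ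
  rw [h1] at this
  linarith

/-- smallness of the flux terms -/
lemma flux1 {y : ℂ} {ρ t Λ : ℝ} (hρ : 0 < ρ) (hρ1 : ρ ≤ 1 / 4) (t0 : 0 < t) (t1 : t ≤ 1) (hΛ : sp p * (∫ z, na J z ^ p) ≤ Λ) :
    sp p * (∫ z, (Hc y (1 / 4) z - Hc y ρ z) / max nb z y ρ * ‖Fl p J z‖) ≤ t ^ 2 * Λ + (t ^ 2)⁻¹ * (2 * π * (1 - ρ ^ sp p)) := by
  have p1 := d.p1
  have p2 := d.p2
  have q2 : 2 ≤ p / (p - 1) := by rw [le_div_iff₀ lN]; linarith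
  have m0 : ∀ z : ℂ, 0 < max nb z y ρ := fun z => hρ.trans_le (le_max_right _ _)
  have cm : Continuous fun z : ℂ => max nb z y ρ := by fun_prop
  have cp : Continuous fun z : ℂ => max nb z y ρ ^ (-p) := cm.rpow_const fun z => Or.inl (m0 z).ne'
  have i2 : Integrable fun z => (Hc y (1 / 4) z - Hc y ρ z) * max nb z y ρ ^ (-p) :=
    ((Hc_cont.sub Hc_cont).mul cp).integrable_of_hasCompactSupport (HasCompactSupport.mul_right ((Hc_cs nU).sub (Hc_cs hρ)))
  have χ0 : ∀ z, 0 ≤ Hc y (1 / 4) z - Hc y ρ z := fun z => sub_nonneg.2 (Hc_anti hρ hρ1)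
  have χ1 : ∀ z, Hc y (1 / 4) z - Hc y ρ z ≤ 1 := fun z => by linarith [Hc_le (y := y) (r := 1 / 4) (z := z), Hc_nonneg (y := y) (r := ρ) (z := z)]
  have b : ∫ z, (Hc y (1 / 4) z - Hc y ρ z) / max nb z y ρ * ‖Fl p J z‖ ≤
      ∫ z, (t ^ 2 * na J z ^ p + (t ^ 2)⁻¹ * ((Hc y (1 / 4) z - Hc y ρ z) * max nb z y ρ ^ (-p))) := by
    refine integral_mono_of_nonneg (eF fun z => mul_nonneg (div_nonneg (χ0 z) (m0 z).le) nN)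
      ((d.iE.const_mul _).add (i2.const_mul _)) (eF fun z => ?_)
    have m := m0 z
    have yg := young2 (p := p) (a := (t * max nb z y ρ)⁻¹) (b := t * ‖Fl p J z‖) lN pV pV
    rw [Real.mul_rpow t0.le nN, d.nFq, Real.inv_rpow pV, Real.mul_rpow t0.le m.le, mul_inv (t ^ p), ← Real.rpow_neg m.le] at yg
    have e : (t * max nb z y ρ)⁻¹ * (t * ‖Fl p J z‖) = (max nb z y ρ)⁻¹ * ‖Fl p J z‖ := by field_simp
    rw [e] at yg
    have t2 : t ^ pc p ≤ t ^ 2 := by rw [← Real.rpow_two]; exact Real.rpow_le_rpow_of_exponent_ge t0 t1 q2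
    have t3 : (t ^ p)⁻¹ ≤ (t ^ 2)⁻¹ := by
      rw [← Real.rpow_two]; exact inv_anti₀ pV (Real.rpow_le_rpow_of_exponent_ge t0 t1 p2.le)
    have := χ0 z
    calc _ = (Hc y (1 / 4) z - Hc y ρ z) * ((max nb z y ρ)⁻¹ * ‖Fl p J z‖) := by ring
      _ ≤ (Hc y (1 / 4) z - Hc y ρ z) * ((t ^ 2)⁻¹ * max nb z y ρ ^ (-p) + t ^ 2 * na J z ^ p) := by
        refine mL (yg.trans ?_) this
        gcongr
      _ = (Hc y (1 / 4) z - Hc y ρ z) * (t ^ 2 * na J z ^ p) + (t ^ 2)⁻¹ * ((Hc y (1 / 4) z - Hc y ρ z) * max nb z y ρ ^ (-p)) := by ring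
      _ ≤ _ := by
        exact add_le_add (mul_le_of_le_one_left pV (χ1 z)) le_rfl
  rw [integral_add (d.iE.const_mul _) (i2.const_mul _), integral_const_mul, integral_const_mul] at b
  have mi := mint (y := y) (p := p) p2 hρ hρ1 nU
  calc _ ≤ sp p * (t ^ 2 * (∫ z, na J z ^ p) + (t ^ 2)⁻¹ * ∫ z, (Hc y (1 / 4) z - Hc y ρ z) * max nb z y ρ ^ (-p)) := by gcongr
    _ = t ^ 2 * (sp p * ∫ z, na J z ^ p) + (t ^ 2)⁻¹ * (sp p * ∫ z, (Hc y (1 / 4) z - Hc y ρ z) * max nb z y ρ ^ (-p)) := by ring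
    _ ≤ _ := by gcongr

lemma flux2 {t Λ : ℝ} (t0 : 0 < t) (t1 : t ≤ 1) (hΛ : sp p * (∫ z, na J z ^ p) ≤ Λ) :
    sp p * (∫ z, ‖Fl p J z‖) ≤ t ^ 2 * Λ + (t ^ 2)⁻¹ * (sp p * (4 * π)) := by
  have p1 := d.p1
  have p2 := d.p2
  have q2 : 2 ≤ p / (p - 1) := by rw [le_div_iff₀ lN]; linarith
  have b : ∫ z, ‖Fl p J z‖ ≤ ∫ z, (t ^ 2 * na J z ^ p + (t ^ 2)⁻¹ * (ball zC 2).indicator (fun _ => (1 : ℝ)) z) := by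
    refine integral_mono_of_nonneg (eF fun z => norm_nonneg _)
      ((d.iE.const_mul _).add (iB.const_mul _)) (eF fun z => ?_)
    by_cases hz : z ∈ ball zC 2
    · have yg := young2 (p := p) (a := t⁻¹) (b := t * ‖Fl p J z‖) lN pV pV
      rw [Real.mul_rpow t0.le nN, d.nFq, Real.inv_rpow pV, inv_mul_cancel_left₀ t0.ne'] at yg
      have t2 : t ^ pc p ≤ t ^ 2 := by rw [← Real.rpow_two]; exact Real.rpow_le_rpow_of_exponent_ge t0 t1 q2
      have t3 : (t ^ p)⁻¹ ≤ (t ^ 2)⁻¹ := by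
        rw [← Real.rpow_two]; exact inv_anti₀ pV (Real.rpow_le_rpow_of_exponent_ge t0 t1 p2.le)
      simp only [indicator_of_mem hz, mul_one]
      have : t ^ pc p * na J z ^ p ≤ t ^ 2 * na J z ^ p := by gcongr
      linarith
    · have : Fl p J z = 0 := by rw [Fl, d.j0 z hz, smul_zero]
      simp only [this, norm_zero, indicator_of_notMem hz]; positivity
  have e : ∫ z, (ball zC 2).indicator (fun _ => (1 : ℝ)) z = 4 * π := by
    rw [integral_indicator measurableSet_ball]; simp [Measure.real, Complex.volume_ball]; ring
  rw [integral_add (d.iE.const_mul _) (iB.const_mul _), integral_const_mul, integral_const_mul, e] at b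
  calc _ ≤ sp p * (t ^ 2 * (∫ z, na J z ^ p) + (t ^ 2)⁻¹ * (4 * π)) := by gcongr
    _ = t ^ 2 * (sp p * ∫ z, na J z ^ p) + (t ^ 2)⁻¹ * (sp p * (4 * π)) := by ring
    _ ≤ _ := by gcongr
end Dat
end

open MeasureTheory Metric Filter Topology Set
open scoped ENNReal NNReal Convolution
noncomputable section
open Complex (I)

lemma sum_le_M {Y : Finset ℂ} {M : ℕ} (hM : Y.card ≤ M) {f : ℂ → ℝ} {a : ℝ} (ha : 0 ≤ a) (h : ∀ y ∈ Y, f y ≤ a) : ∑ y ∈ Y, f y ≤ M * a := by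
  refine (Finset.sum_le_card_nsmul Y f a h).trans ?_
  rw [nsmul_eq_mul]; gcongr

lemma scaleB {s δ σ q : ℝ} {M k : ℕ} (s0 : 0 < s) (hδ : 0 < δ) (hq : q = Real.exp (δ / s)) (hk : k ≤ M + 1) (h : 3 * s * (M + 2) + 6 * δ * (M + 1) ≤ σ) :
    1 - σ ≤ (1 / 16 * ((8 * q ^ 6)⁻¹) ^ k) ^ s := by
  have q0 : 0 < q := hq ▸ Real.exp_pos _
  have lq : Real.log q = δ / s := by rw [hq, Real.log_exp]
  have l2 := Real.log_two_lt_d9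
  have e1 : Real.log 16 = 4 * Real.log 2 := by rw [show (16 : ℝ) = 2 ^ 4 by norm_num, Real.log_pow]; norm_num
  have e2 : Real.log 8 = 3 * Real.log 2 := by rw [show (8 : ℝ) = 2 ^ 3 by norm_num, Real.log_pow]; norm_num
  have hk' : cR k ≤ M + 1 := by exact_mod_cast hk
  rw [Real.rpow_def_of_pos pV, Real.log_mul nU pV, Real.log_pow, Real.log_inv, Real.log_mul nU pV,
    Real.log_pow, lq, one_div, Real.log_inv, e1, e2]
  refine le_trans ?_ (Real.add_one_le_exp _)
  have e3 : (-(4 * Real.log 2) + cR k * -(3 * Real.log 2 + (6 : ℕ) * (δ / s))) * s = -(4 * Real.log 2 * s + k * (3 * Real.log 2 * s + 6 * δ)) := by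
    push_cast; field_simp; ring
  rw [e3]
  have f1 : 4 * Real.log 2 * s ≤ 3 * s := by gcongr; linarith
  have f2 : cR k * (3 * Real.log 2 * s + 6 * δ) ≤ (M + 1) * (3 * s + 6 * δ) := by
    have l0 : 0 < Real.log 2 := Real.log_pos nU
    gcongr; linarith
  linarith

namespace Dat
variable {p : ℝ} {U J : ℂ → ℂ} (d : Dat p U J)
include d

set_option maxHeartbeats 2000000 in
lemma claim1 {Λ δ t K C ω : ℝ} {M : ℕ} (hΛ0 : 0 ≤ Λ) (hM : Λ < (M + 1 : ℕ) * (eps1 / 80)) (t0 : 0 < t) (t1 : t ≤ 1 / 2) (hδ : 0 < δ)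
    (hδM : 6 * δ * (M + 1) ≤ t ^ 4 / 2) (hK : K = 1 + Λ / δ)
    (hC : C = 13 * (2 * π * K ^ 2) + 5 * (2 / δ * (8 * π * (Λ / δ) + Λ + 2 * π * K ^ 2)) + 2 * π * K ^ 3)
    (hs : 2 - p < 1 / 400) (hs1 : 3 * sp p * (M + 2) ≤ t ^ 4 / 2) (hs2 : 2 - p ≤ δ) (hs3 : 2 - p ≤ t ^ 4) (hs4 : C * Real.sqrt sp p ≤ 1)
    (hω : ω < eps1 / 640) (hΛ : sp p * (∫ z, na J z ^ p) ≤ Λ) (hA : sp p * (∫ z in Ann, na J z ^ p) ≤ ω) :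
    ∃ k : ℕ, |sp p * Ie p J 0 (1 / 4) - 2 * π * k| ≤ M * ((Λ + 1) * (t ^ 2 * (Λ + 2 * π) + Ck * (t ^ 2 * (Λ + 4 * π)))) +
      4 * π * (Ck * ω + M * (C * Real.sqrt sp p)) + M * (C * Real.sqrt sp p + 2 * π * (Λ + 1) * t ^ 4) := by
  have p1 := d.p1
  have p2 := d.p2
  have pi3 := Real.pi_gt_three
  have Ck0 := Ck_pos
  have s0 : 0 < 2 - p := by linarith
  obtain ⟨q, hq⟩ : ∃ q, q = Real.exp (δ / sp p) := ⟨_, rfl⟩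
  have q2 : 2 ≤ q := by
    have : 1 ≤ δ / sp p := by rw [le_div_iff₀ s0]; linarith
    rw [hq]; linarith [Real.add_one_le_exp (δ / sp p)]
  have lq : δ ≤ sp p * Real.log q := by rw [hq, Real.log_exp]; field_simp; exact le_rfl
  have t4 : t ^ 4 ≤ 1 / 2 := by
    calc t ^ 4 ≤ (1 / 2) ^ 4 := by gcongr
      _ ≤ _ := by norm_num
  have hQ : 1 ≤ 8 * q ^ 6 := by have : 1 ≤ q ^ 6 := one_le_pow₀ lN
                                linarith
  set τ : ℕ → ℝ := fun k => 1 / 16 * ((8 * q ^ 6)⁻¹) ^ k with hτ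
  have τ0 : ∀ k, 0 < τ k := fun k => by positivity
  have τS : ∀ k, τ (k + 1) * (8 * q ^ 6) = τ k := fun k => by
    simp only [hτ, pow_succ]; field_simp
  have τ1 : ∀ k, τ k ≤ 1 / 16 := fun k => by
    have : ((8 * q ^ 6)⁻¹) ^ k ≤ 1 := pow_le_one₀ pV (inv_le_one_of_one_le₀ hQ)
    simp only [hτ]; linarith
  have τs : ∀ k ≤ M + 1, 1 - t ^ 4 ≤ τ k ^ sp p := fun k hk => scaleB s0 hδ hq hk lN
  obtain ⟨k, hk, Y, cY, YS, sep, cov⟩ := d.Sg_scale hM τ0 (fun k => by linarith [τ1 k]) (fun k => by linarith [τS k, mL hQ (τ0 (k + 1)).le, τ0 (k + 1)])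
    (fun k hk => by linarith [τs k hk]) hs hΛ
  have small : ∀ y ∈ Sg U, ‖y‖ < 1 / 16 := fun y hy => d.Sg_small hy hs hA hω
  set ρ := 2 * τ (k + 1) with hρ
  have ρ0 : 0 < ρ := by have := τ0 (k + 1); linarith
  have ρq : ρ * q ^ 6 = τ k / 4 := by rw [← τS k]; ring
  have q61 : 64 ≤ q ^ 6 := by
    calc (64 : ℝ) = 2 ^ 6 := by norm_num
      _ ≤ _ := by gcongr
  have τkk : 64 * τ (k + 1) ≤ τ k := by rw [← τS k]; linarith [mL q61 (τ0 (k + 1)).le, τ0 (k + 1)]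
  have ρs : ∀ r, ρ ≤ r → 1 - t ^ 4 ≤ r ^ sp p := fun r hr => (τs (k + 1) (by omega)).trans
    (Real.rpow_le_rpow (τ0 _).le (by linarith [τ0 (k + 1)]) s0.le)
  have nk : ∀ y, ∃ (κ : ℤ) (r : ℝ), y ∈ Y → ρ < r ∧ 2 * r < τ k / 4 ∧ Deg J y ρ (τ k / 4) κ ∧
      |sp p * Ie p J y r - 2 * π * cR κ ^ 2| ≤ C * Real.sqrt sp p + 2 * π * cR κ ^ 2 * (1 - ρ ^ sp p) ∧
      sp p * De p J y r ≤ C * Real.sqrt sp p := fun y => by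
    by_cases hy : y ∈ Y
    · have ys := small y (YS y hy)
      obtain ⟨κ, r, h1, h2, h3, -, h4, h5⟩ := d.neck hΛ0 hδ (y := y) (ρ := ρ) hΛ ρ0 q2 (by rw [ρq]; linarith [τ1 k]) (fun z z1 z2 => by
        rw [ρq] at z2
        by_contra hz
        have zS : z ∈ Sg U := ⟨by have := norm_sub_norm_le z y; linarith [τ1 k], hz⟩
        obtain ⟨y', hy', hzy⟩ := cov z zS
        have hne : y ≠ y' := fun h => by rw [← h] at hzy; linarith [τ0 (k + 1)]
        have := sep y hy y' hy' hne
        have : ‖y - y'‖ ≤ nb y z + ‖z - y'‖ := norm_sub_le_norm_sub_add_norm_sub _ _ _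
        rw [norm_sub_rev y z] at this
        linarith [τ0 k]) lq (by linarith [ρs ρ le_rfl]) lN hK hC
      rw [ρq] at h2 h3
      exact ⟨κ, r, fun _ => ⟨h1, h2, h3, h4, h5⟩⟩
    · exact ⟨0, 0, fun h => absurd h hy⟩
  choose κ r hκr using nk
  have hYg : ∀ y ∈ Y, 0 < r y ∧ 2 * r y ≤ τ k / 4 ∧ ‖y‖ < 1 / 16 := fun y hy =>
    ⟨ρ0.trans (hκr y hy).1, (hκr y hy).2.1.le, small y (YS y hy)⟩
  have hsep4 : ∀ y ∈ Y, ∀ y' ∈ Y, y ≠ y' → 4 * (τ k / 4) ≤ ‖y - y'‖ := fun y hy y' hy' h => by linarith [sep y hy y' hy' h]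
  have hT : τ k / 4 ≤ 1 / 64 := by linarith [τ1 k]
  have hζ : tsupport (Ze 0 (1 / 4) Y r) ⊆ GS U := fun z hz => by
    obtain ⟨z1, z2⟩ := Ze_ts hT hYg hsep4 hz
    by_contra hb
    obtain ⟨y, hy, h⟩ := cov z ⟨z1, hb⟩
    linarith [z2 y hy, (hκr y hy).1, τ0 (k + 1)]
  obtain ⟨κ0, hκ0⟩ := d.degree (y := 0) (r1 := 1 / 4) (r2 := 2 * (1 / 4)) nU nU fun z z1 z2 => by
    rw [sub_zero] at z1 z2
    by_contra hb
    linarith [small z ⟨by linarith, hb⟩]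
  have out := d.outer (Y := Y) (ρ := r) (κ := κ) (κ0 := κ0) (fun y hy => ⟨(hYg y hy).1, by linarith [(hYg y hy).2.1], (hYg y hy).2.2.le,
    (hκr y hy).2.2.1.mono (hκr y hy).1.le (hYg y hy).2.1⟩) hκ0 hζ
  have kA : ∀ y ∈ Y, (κ y : ℝ) ^ 2 ≤ Λ + 1 := fun y hy => by
    have h1 := abs_le.1 (hκr y hy).2.2.2.1
    have h2 := mL (d.Ie_le (y := y) (r := r y)) s0.le
    have h3 : 2 * π * (κ y : ℝ) ^ 2 * (1 - ρ ^ sp p) ≤ 2 * π * (κ y : ℝ) ^ 2 * (1 / 2) := by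
      gcongr; linarith [ρs ρ le_rfl]
    have h4 : π * (κ y : ℝ) ^ 2 ≤ Λ + 1 := by linarith [h1.1]
    have h5 : 1 * (κ y : ℝ) ^ 2 ≤ π * (κ y : ℝ) ^ 2 := by gcongr; linarith
    linarith
  have kA1 : ∀ y ∈ Y, |(κ y : ℝ)| ≤ Λ + 1 := fun y hy => by
    refine le_trans ?_ (kA y hy)
    have : |κ y| ≤ (κ y) ^ 2 := by
      rw [← sq_abs]
      rcases eq_or_ne (κ y) 0 with h | h
      · simp [h]
      · nlinarith [Int.one_le_abs h]
    exact_mod_cast this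
  have f2 : sp p * (∫ z, ‖Fl p J z‖) ≤ t ^ 2 * (Λ + 4 * π) := by
    refine (d.flux2 t0 lN hΛ).trans ?_
    calc _ ≤ t ^ 2 * Λ + (t ^ 2)⁻¹ * (t ^ 4 * (4 * π)) := by gcongr
      _ = _ := by field_simp
  have f1 : ∀ y ∈ Y, sp p * (∫ z, (Hc y (1 / 4) z - Hc y (r y) z) / max nb z y (r y) * ‖Fl p J z‖) ≤ t ^ 2 * (Λ + 2 * π) := fun y hy => by
    refine (d.flux1 (hYg y hy).1 (by linarith [(hYg y hy).2.1]) t0 lN hΛ).trans ?_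
    calc _ ≤ t ^ 2 * Λ + (t ^ 2)⁻¹ * (2 * π * t ^ 4) := by gcongr; linarith [ρs (r y) (hκr y hy).1.le]
      _ = _ := by field_simp
  have f3 : sp p * De p J 0 (1 / 4) ≤ Ck * ω := by
    have := d.ann_le (c := fun z => Pc 0 (1 / 4) z * nb z 0 ^ 2) (A := Ck) (fun z => mul_nonneg Pc_nonneg pV) (fun z => Pc_mul_le nU)
      fun z hz => by
        have := Pc_supp nU (left_ne_zero_of_mul hz)
        rw [sub_zero] at this
        exact ⟨by linarith [this.1], by linarith [this.2]⟩
    change De p J 0 (1 / 4) ≤ _ at this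
    calc _ ≤ sp p * (Ck * ∫ z in Ann, na J z ^ p) := by gcongr
      _ = Ck * (sp p * ∫ z in Ann, na J z ^ p) := by ring
      _ ≤ _ := by gcongr
  have eZ : ∫ z, Ze 0 (1 / 4) Y r z * na J z ^ p = Ie p J 0 (1 / 4) - ∑ y ∈ Y, Ie p J y (r y) := by
    simp only [Ze, sub_mul, Finset.sum_mul]
    rw [integral_sub d.iH (integrable_finsetSum _ fun y _ => d.iH), integral_finsetSum _ fun y _ => d.iH]; rfl
  have Z0 : 0 ≤ ∫ z, Ze 0 (1 / 4) Y r z * na J z ^ p := integral_nonneg fun z => mul_nonneg (Ze_nonneg hT hYg hsep4) pV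
  rw [eZ] at out Z0
  have o2 := mL out s0.le
  have F0 : 0 ≤ ∫ z, ‖Fl p J z‖ := integral_nonneg fun z => norm_nonneg _
  have b1 : sp p * ∑ y ∈ Y, |(κ y : ℝ)| * ((∫ z, (Hc y (1 / 4) z - Hc y (r y) z) / max nb z y (r y) * ‖Fl p J z‖) + Ck * ∫ z, ‖Fl p J z‖) ≤
      M * ((Λ + 1) * (t ^ 2 * (Λ + 2 * π) + Ck * (t ^ 2 * (Λ + 4 * π)))) := by
    rw [Finset.mul_sum]
    refine sum_le_M cY pV fun y hy => ?_
    calc _ = |(κ y : ℝ)| * (sp p * (∫ z, (Hc y (1 / 4) z - Hc y (r y) z) / max nb z y (r y) * ‖Fl p J z‖) + Ck * (sp p * ∫ z, ‖Fl p J z‖)) := by ring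
      _ ≤ |(κ y : ℝ)| * (t ^ 2 * (Λ + 2 * π) + Ck * (t ^ 2 * (Λ + 4 * π))) :=
        mL (add_le_add (f1 y hy) (mL f2 Ck0.le)) (abs_nonneg _)
      _ ≤ _ := mul_le_mul_of_nonneg_right (kA1 y hy) pV
  have C0 : 0 ≤ C * Real.sqrt sp p := by
    have : 0 ≤ K := by rw [hK]; positivity
    rw [hC]; positivity
  have b2 : sp p * ∑ y ∈ Y, De p J y (r y) ≤ M * (C * Real.sqrt sp p) := by
    rw [Finset.mul_sum]; exact sum_le_M cY C0 fun y hy => (hκr y hy).2.2.2.2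
  have b3 : |sp p * ∑ y ∈ Y, Ie p J y (r y) - 2 * π * ∑ y ∈ Y, (κ y : ℝ) ^ 2| ≤ M * (C * Real.sqrt sp p + 2 * π * (Λ + 1) * t ^ 4) := by
    rw [Finset.mul_sum, Finset.mul_sum, ← Finset.sum_sub_distrib]
    refine (Finset.abs_sum_le_sum_abs _ _).trans (sum_le_M cY pV fun y hy => (hκr y hy).2.2.2.1.trans ?_)
    have h1 := ρs ρ le_rfl
    have h2 := kA y hy
    have h3 : 0 ≤ 1 - ρ ^ sp p := sub_nonneg.2 (Real.rpow_le_one ρ0.le (by linarith [τ1 k, τ0 (k + 1)]) s0.le)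
    gcongr
    linarith
  refine ⟨∑ y ∈ Y, (κ y).natAbs ^ 2, ?_⟩
  have ek : ((∑ y ∈ Y, (κ y).natAbs ^ 2 : ℕ) : ℝ) = ∑ y ∈ Y, (κ y : ℝ) ^ 2 := by
    push_cast
    refine Finset.sum_congr rfl fun y _ => ?_
    rw [Nat.cast_natAbs]; push_cast; exact sq_abs _
  rw [ek]
  have Z1 := mul_nonneg s0.le Z0
  have b4 := abs_le.1 b3
  have c3 : 4 * π * (sp p * De p J 0 (1 / 4) + sp p * ∑ y ∈ Y, De p J y (r y)) ≤ 4 * π * (Ck * ω + M * (C * Real.sqrt sp p)) := by gcongr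
  have n1 : 0 ≤ M * ((Λ + 1) * (t ^ 2 * (Λ + 2 * π) + Ck * (t ^ 2 * (Λ + 4 * π)))) := by positivity
  have n2 : 0 ≤ 4 * π * (Ck * ω + M * (C * Real.sqrt sp p)) := by
    have : 0 ≤ Ck * ω := (mul_nonneg s0.le De_nonneg).trans f3
    positivity
  rw [abs_le]; constructor <;> linarith [b4.1, b4.2]
end Dat

lemma claim {Λ ε : ℝ} (hΛ0 : 0 ≤ Λ) (hε : 0 < ε) : ∃ ω > 0, ∀ p U J, Dat p U J → 2 - p < ω → sp p * (∫ z, na J z ^ p) ≤ Λ →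
    sp p * (∫ z in Ann, na J z ^ p) ≤ ω → ∃ k : ℕ, |sp p * Ie p J 0 (1 / 4) - 2 * π * k| ≤ ε := by
  have ep := eps1_pos
  obtain ⟨M, hM⟩ := exists_nat_gt (Λ / (eps1 / 80))
  have hM' : Λ < (M + 1 : ℕ) * (eps1 / 80) := by
    rw [div_lt_iff₀ pV] at hM; push_cast; nlinarith
  have T1 : Tendsto (fun t : ℝ => M * ((Λ + 1) * (t ^ 2 * (Λ + 2 * π) + Ck * (t ^ 2 * (Λ + 4 * π)))) + M * (2 * π * (Λ + 1) * t ^ 4))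
      (𝓝[>] 0) (𝓝 0) := by
    refine tendsto_nhdsWithin_of_tendsto_nhds ?_
    exact Continuous.tendsto' fP _ _ (by simp)
  obtain ⟨t, ht, ⟨t0, t1⟩⟩ := ((T1.eventually_lt_const (show 0 < ε / 2 by positivity)).and (Ioc_mem_nhdsGT (show zR < 1 / 2 by norm_num))).exists
  set δ := t ^ 4 / (12 * (M + 1)) with hδ
  have δ0 : 0 < δ := by positivity
  obtain ⟨K, hK⟩ : ∃ K, K = 1 + Λ / δ := ⟨_, rfl⟩
  obtain ⟨C, hC⟩ : ∃ C, C = 13 * (2 * π * K ^ 2) + 5 * (2 / δ * (8 * π * (Λ / δ) + Λ + 2 * π * K ^ 2)) + 2 * π * K ^ 3 := ⟨_, rfl⟩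
  have C0 : 0 ≤ C := by have : 0 ≤ K := by rw [hK]; positivity
                        rw [hC]; positivity
  have T2 : Tendsto (fun w : ℝ => 4 * π * (Ck * w + M * (C * Real.sqrt w)) + M * (C * Real.sqrt w)) (𝓝[>] 0) (𝓝 0) := by
    refine tendsto_nhdsWithin_of_tendsto_nhds ?_
    exact Continuous.tendsto' fP _ _ (by simp)
  have T3 : Tendsto (fun w : ℝ => C * Real.sqrt w) (𝓝[>] 0) (𝓝 0) := tendsto_nhdsWithin_of_tendsto_nhds (Continuous.tendsto' fP _ _ (by simp))
  have T4 : Tendsto (fun w : ℝ => 3 * w * (M + 2)) (𝓝[>] 0) (𝓝 0) := tendsto_nhdsWithin_of_tendsto_nhds (Continuous.tendsto' fP _ _ (by simp))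
  obtain ⟨ω, ⟨⟨⟨h1, h2⟩, h3⟩, h4⟩, w0, w1⟩ := ((((T2.eventually_lt_const (show 0 < ε / 2 by positivity)).and (T3.eventually_lt_const one_pos)).and
    (T4.eventually_lt_const (show 0 < t ^ 4 / 2 by positivity))).and (Ioo_mem_nhdsGT (show 0 < min δ (t ^ 4) by positivity))).and
    (Ioo_mem_nhdsGT (show 0 < min (1 / 400) (eps1 / 640) by positivity)) |>.exists
  refine ⟨ω, w0, fun p U J d hs hΛ hA => ?_⟩
  have p2 := d.p2
  have s1 : Real.sqrt sp p ≤ Real.sqrt ω := Real.sqrt_le_sqrt hs.le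
  have s2 : C * Real.sqrt sp p ≤ C * Real.sqrt ω := by gcongr
  have s3 : 3 * sp p * (M + 2) ≤ 3 * ω * (M + 2) := by gcongr
  have w2 := w1.trans_le (min_le_left _ _)
  have w3 := h4.2.trans_le (min_le_left _ _)
  have w4 := h4.2.trans_le (min_le_right _ _)
  obtain ⟨k, hk⟩ := d.claim1 hΛ0 hM' t0 t1 δ0 (by rw [hδ]; field_simp; norm_num) hK hC lN lN lN lN lN
    (w1.trans_le (min_le_right _ _)) hΛ hA
  refine ⟨k, hk.trans ?_⟩
  have : 4 * π * (Ck * ω + M * (C * Real.sqrt sp p)) ≤ 4 * π * (Ck * ω + M * (C * Real.sqrt ω)) := by have := Real.pi_pos; gcongr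
  have : (M : ℝ) * (C * Real.sqrt sp p) ≤ M * (C * Real.sqrt ω) := by gcongr
  linarith
end

open MeasureTheory Metric Filter Topology Set
open scoped ENNReal NNReal Convolution
noncomputable section
open Complex (I)

def Jv (u : ℂ → ℂ) (du : ℂ → ℂ →L[ℝ] ℂ) (z : ℂ) : ℂ := ⟨jform u du z 1, jform u du z I⟩

lemma alg1 {a b : ℂ} (ha : ‖a‖ = 1) (h : ⟪a, b⟫ = 0) : b = I * a * ((((starRingEnd ℂ) a * b).im : ℝ) : ℂ) := by
  have h1 : a * (starRingEnd ℂ) a = 1 := by rw [Complex.mul_conj, Complex.normSq_eq_norm_sq, ha]; simp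
  have h2 : (starRingEnd ℂ) a * b = ((((starRingEnd ℂ) a * b).im : ℝ) : ℂ) * I := by
    rw [Complex.inner] at h
    apply Complex.ext
    · simpa [mul_comm] using h
    · simp
  calc b = a * ((starRingEnd ℂ) a * b) := by rw [← mul_assoc, h1, one_mul]
    _ = _ := by rw [h2]; simp; ring

lemma alg2 (T : ℂ →L[ℝ] ℂ) (w : ℂ) : T w = (w.re : ℂ) * T 1 + (w.im : ℂ) * T I := by
  conv_lhs => rw [show w = w.re • (1 : ℂ) + w.im • I by simp [Complex.re_add_im]]
  rw [map_add, map_smul, map_smul]; simp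

lemma alg2' (T : ℂ →L[ℝ] ℝ) (w : ℂ) : T w = w.re * T 1 + w.im * T I := by
  conv_lhs => rw [show w = w.re • (1 : ℂ) + w.im • I by simp [Complex.re_add_im]]
  rw [map_add, map_smul, map_smul]; simp

lemma alg3 (a w : ℂ) : ⟪a, w⟫ = a.re * w.re + a.im * w.im := by
  rw [Complex.inner]; simp; ring

lemma nrm_le {T : ℂ →L[ℝ] ℂ} (w : ℂ) : na T w ≤ 2 * ‖w‖ * hsNorm T := by
  have h1 : na T 1 ≤ hsNorm T := Real.le_sqrt_of_sq_le (by nlinarith [sq_nonneg na T I])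
  have h2 : na T I ≤ hsNorm T := Real.le_sqrt_of_sq_le (by nlinarith [sq_nonneg na T 1])
  rw [alg2 T w]
  refine (norm_add_le _ _).trans ?_
  rw [norm_mul, norm_mul, Complex.norm_real, Complex.norm_real, Real.norm_eq_abs, Real.norm_eq_abs]
  have := mul_le_mul (Complex.abs_re_le_norm w) h1 nN nN
  have := mul_le_mul (Complex.abs_im_le_norm w) h2 nN nN
  linarith

lemma mkDat {p : ℝ} (p1 : 3 / 2 < p) (p2 : p < 2) {u : ℂ → ℂ} {du : ℂ → ℂ →L[ℝ] ℂ}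
    (hW : MemW1pS1 p (ball 0 2) u du) (hS : StatPHarm p (ball 0 2) u du) :
    ∃ U J, Dat p U J ∧ ∀ᵐ z, z ∈ ball zC 2 → na J z = hsNorm (du z) := by
  obtain ⟨w1, w2, w3, w4, w5⟩ := hW
  have mb : MeasurableSet (ball zC 2) := measurableSet_ball
  have mw : ∀ w : ℂ, AEStronglyMeasurable (fun z => du z w) (volume.restrict (ball 0 2)) := fun w =>
    (ContinuousLinearMap.apply ℝ ℂ w).continuous.comp_aestronglyMeasurable w3
  set U : ℂ → ℂ := (ball zC 2).indicator u with hU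
  set J : ℂ → ℂ := (ball zC 2).indicator (Jv u du) with hJ
  have Ui : ∀ z ∈ ball zC 2, U z = u z := fun z hz => indicator_of_mem hz _
  have Ji : ∀ z ∈ ball zC 2, J z = Jv u du z := fun z hz => indicator_of_mem hz _
  have U0 : ∀ z, z ∉ ball zC 2 → U z = 0 := fun z hz => indicator_of_notMem hz _
  have J0 : ∀ z, z ∉ ball zC 2 → J z = 0 := fun z hz => indicator_of_notMem hz _
  have w1' : ∀ᵐ z, z ∈ ball zC 2 → na u z = 1 := (ae_restrict_iff' mb).1 w1
  have mU : AEStronglyMeasurable U := (aestronglyMeasurable_indicator_iff mb).2 w2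
  have iU : Integrable U := by
    rw [hU, integrable_indicator_iff mb]
    refine Integrable.mono' (g := fun _ => (1 : ℝ)) (integrableOn_const measure_ball_lt_top.ne) w2 ?_
    filter_upwards [w1] with z hz using hz.le
  have h0 : ∀ T, 0 ≤ hsNorm T := fun T => Real.sqrt_nonneg _
  have iV : ∀ w : ℂ, Integrable ((ball zC 2).indicator fun z => du z w) := fun w => by
    rw [integrable_indicator_iff mb]
    refine Integrable.mono' (g := fun z => 2 * ‖w‖ * (1 + hsNorm (du z) ^ p)) (((integrableOn_const measure_ball_lt_top.ne).add w4).const_mul _) (mw w) ?_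
    filter_upwards with z
    refine (nrm_le w).trans ?_
    gcongr
    rcases le_total (hsNorm (du z)) 1 with h | h
    · linarith [Real.rpow_nonneg (h0 (du z)) p]
    · have := Real.self_le_rpow_of_one_le h (by linarith : 1 ≤ p)
      linarith
  have full : ∀ {E : Type} [NormedAddCommGroup E] [NormedSpace ℝ E] (F G : ℂ → E), (∀ z, z ∉ ball zC 2 → G z = 0) →
      (∀ᵐ z, z ∈ ball zC 2 → F z = G z) → ∫ z in ball zC 2, F z = ∫ z, G z := by
    intro E _ _ F G hG hF
    rw [← setIntegral_eq_integral_of_forall_compl_eq_zero hG]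
    exact setIntegral_congr_ae mb hF
  have key : ∀ w : ℂ, ∀ᵐ z, z ∈ ball zC 2 → ⟪u z, du z w⟫ = 0 := fun w => by
    have := ortho (U := U) (V := (ball zC 2).indicator fun z => du z w) (w := w) iU (iV w) ?_ ?_ ?_
    · filter_upwards [this] with z hz hb
      have := hz hb
      rwa [Ui z hb, indicator_of_mem hb] at this
    · filter_upwards [w1'] with z hz
      by_cases hb : z ∈ ball zC 2
      · rw [Ui z hb, hz hb]
      · rw [U0 z hb]; simp
    · filter_upwards [w1'] with z hz hb
      rw [Ui z hb, hz hb]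
    · intro φ hφ
      have := w5 φ hφ w
      rw [full _ (fun z => fderiv ℝ φ z w • U z) (fun z hz => by simp [U0 z hz]) (by filter_upwards with z hb using by rw [Ui z hb]),
        full _ (fun z => φ z • (ball zC 2).indicator (fun z => du z w) z) (fun z hz => by rw [indicator_of_notMem hz, smul_zero])
          (by filter_upwards with z hb using by rw [indicator_of_mem hb])] at this
      exact this
  have rep : ∀ᵐ z, z ∈ ball zC 2 → na u z = 1 ∧ ∀ w, du z w = I * U z * ((⟪J z, w⟫ : ℝ) : ℂ) := by
    filter_upwards [w1', key 1, key I] with z a b c hb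
    refine ⟨a hb, fun w => ?_⟩
    have e1 := alg1 (a hb) (b hb)
    have e2 := alg1 (a hb) (c hb)
    rw [alg2, alg3, Ui z hb, Ji z hb]
    change _ = I * u z * (((jform u du z 1) * w.re + (jform u du z I) * w.im : ℝ) : ℂ)
    change _ = I * u z * ((jform u du z 1 : ℝ) : ℂ) at e1
    change _ = I * u z * ((jform u du z I : ℝ) : ℂ) at e2
    rw [e1, e2]; push_cast; ring
  have nrm : ∀ᵐ z, z ∈ ball zC 2 → na J z = hsNorm (du z) := by
    filter_upwards [rep] with z hz hb
    obtain ⟨a, b⟩ := hz hb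
    rw [hsNorm, b 1, b I, Complex.norm_def, Complex.normSq_apply]
    congr 1
    simp only [norm_mul, Complex.norm_I, Ui z hb, a, Complex.norm_real, alg3, Real.norm_eq_abs, one_mul, sq_abs]
    simp; ring
  have pz : zR ^ p = 0 := Real.zero_rpow lN
  refine ⟨U, J, ⟨p1, p2, mU, ?_, ?_, U0, J0, ?_, ?_, ?_, ?_⟩, nrm⟩
  · refine (aestronglyMeasurable_indicator_iff mb).2 ?_
    have mj : ∀ w : ℂ, AEStronglyMeasurable (fun z => jform u du z w) (volume.restrict (ball 0 2)) := fun w =>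
      Complex.continuous_im.comp_aestronglyMeasurable ((Complex.continuous_conj.comp_aestronglyMeasurable w2).mul (mw w))
    have := (Complex.continuous_ofReal.comp_aestronglyMeasurable (mj 1)).add
      ((Complex.continuous_ofReal.comp_aestronglyMeasurable (mj I)).mul_const I)
    have e : Jv u du = fun z => ((jform u du z 1 : ℝ) : ℂ) + ((jform u du z I : ℝ) : ℂ) * I := by
      funext z
      apply Complex.ext <;> simp [Jv]
    rw [e]; exact this
  · filter_upwards [w1'] with z hz hb
    rw [Ui z hb, hz hb]
  · have := (integrable_indicator_iff mb).2 w4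
    refine this.congr ?_
    filter_upwards [nrm] with z hz
    by_cases hb : z ∈ ball zC 2
    · rw [indicator_of_mem hb, hz hb]
    · rw [indicator_of_notMem hb, J0 z hb, norm_zero, pz]
  · intro φ hφ w
    have := w5 φ hφ w
    rw [full _ (fun z => fderiv ℝ φ z w • U z) (fun z hz => by simp [U0 z hz]) (by filter_upwards with z hb using by rw [Ui z hb]),
      full _ (fun z => φ z • (I * U z * ((⟪J z, w⟫ : ℝ) : ℂ))) (fun z hz => by simp [U0 z hz])
        (by filter_upwards [rep] with z hz hb using by rw [(hz hb).2])] at this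
    exact this
  · intro ψ hψ
    rw [← hS.1 ψ hψ]
    refine (full _ _ (fun z hz => by simp [J0 z hz]) ?_).symm
    filter_upwards [nrm] with z hz hb
    rw [hz hb, alg2' _ (J z), Fin.sum_univ_two, Ji z hb]
    rfl
  · intro X hX
    rw [← hS.2 X hX]
    refine (full _ _ (fun z hz => by simp [J0 z hz, pz]) ?_).symm
    filter_upwards [nrm, rep] with z hz hr hb
    obtain ⟨a, b⟩ := hr hb
    have ri : ∀ a b : ℂ, rinner a b = ⟪a, b⟫ := fun a b => by rw [rinner, alg3]; simp
    have rd : ∀ v w : ℂ, ⟪du z v, du z w⟫ = ⟪J z, v⟫ * ⟪J z, w⟫ := fun v w => by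
      have : (u z).re ^ 2 + (u z).im ^ 2 = 1 := by
        rw [← one_pow 2, ← a, ← Complex.normSq_eq_norm_sq, Complex.normSq_apply]; ring
      rw [b v, b w, Ui z hb, alg3 (I * _ * _)]
      simp
      linear_combination ((J z).re * v.re + (J z).im * v.im) * ((J z).re * w.re + (J z).im * w.im) * this
    simp only [Fin.sum_univ_two, ri, cb, rd, hz hb, Matrix.cons_val_zero, Matrix.cons_val_one]
    congr 2
    rw [alg2 (fderiv ℝ X z) (J z)]
    simp only [alg3]
    simp
    ring

def fan (z : ℂ) : ℝ := min 1 (32 * ‖z‖) * max 0 (min 1 (7 - 4 * ‖z‖))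

lemma closed_two_pi : IsClosed (range fun k : ℕ => 2 * π * cR k) :=
  ((Homeomorph.mulLeft₀ (2 * π) pV).isClosedEmbedding.comp
    Nat.isClosedEmbedding_coe_real).isClosed_range
end

/-- **Theorem 6.1** (quantization of the concentrated energy in dimension two). Let
`u_i ∈ W^{1,p_i}(D₂(0),S¹)` be stationary `p_i`-harmonic maps on the Euclidean disk
`D₂(0) ⊆ ℝ² ≃ ℂ`, with `p_i ↑ 2` and `E_{p_i}(u_i,D₂) ≤ Λ/(2-p_i)`, whose normalized
energy measures `μ_i = (2-p_i)|du_i|^{p_i} dz` converge weakly in `(C⁰(D₂(0)))^*` to a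
multiple `θ·δ₀` of the Dirac mass at the origin. Then `θ ∈ 2πℕ`. -/
theorem quantization_of_concentrated_energy
    (p : ℕ → ℝ) (hp : ∀ i, p i ∈ Set.Ioo (1 : ℝ) 2)
    (hp2 : Tendsto p atTop (𝓝 2))
    (u : ℕ → ℂ → ℂ) (du : ℕ → ℂ → ℂ →L[ℝ] ℂ)
    (hW : ∀ i, MemW1pS1 (p i) (ball (0 : ℂ) 2) (u i) (du i))
    (hstat : ∀ i, StatPHarm (p i) (ball (0 : ℂ) 2) (u i) (du i))
    (Λ : ℝ)
    (hE : ∀ i, (∫ z in ball (0 : ℂ) 2, hsNorm (du i z) ^ (p i)) ≤ Λ / (2 - p i))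
    (θ : ℝ)
    (hconv : ∀ f : ℂ → ℝ, Continuous f → tsupport f ⊆ ball (0 : ℂ) 2 →
      Tendsto (fun i => ∫ z in ball (0 : ℂ) 2, (2 - p i) * hsNorm (du i z) ^ (p i) * f z)
        atTop (𝓝 (θ * f 0))) :
    ∃ k : ℕ, θ = 2 * Real.pi * k := by
  have hb : MeasurableSet (ball zC 2) := measurableSet_ball
  have fc : Continuous fan := by unfold fan; fun_prop
  have f0 : ∀ z, 0 ≤ fan z := fun z => mul_nonneg pV (le_max_left _ _)
  have fts : tsupport fan ⊆ ball zC 2 := by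
    refine (closure_minimal (t := closedBall (0 : ℂ) (7 / 4)) (fun z hz => ?_) isClosed_closedBall).trans
      (closedBall_subset_ball nU)
    rw [mem_closedBall_zero_iff]
    by_contra! h
    refine hz ?_
    rw [fan, max_eq_left ((min_le_right _ _).trans lN), mul_zero]
  have fA : ∀ z ∈ Ann, fan z = 1 := fun z hz => by
    rw [fan, min_eq_left (by linarith [hz.1]), min_eq_left (by linarith [hz.2]), max_eq_right zero_le_one, one_mul]
  have fle : ∀ z, fan z ≤ 1 := fun z => by
    have : max 0 (min 1 (7 - 4 * ‖z‖)) ≤ 1 := max_le zero_le_one (min_le_left _ _)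
    exact mul_le_one₀ (min_le_left _ _) (le_max_left _ _) this
  have AB : Ann ⊆ ball zC 2 := fun z hz => by
    rw [mem_ball_zero_iff]; linarith [hz.2]
  have t1 := hconv fan fc fts
  have t2 := hconv (Hc 0 (1 / 4)) Hc_cont ((Hc_ts nU).trans (closedBall_subset_ball nU))
  rw [show fan 0 = 0 by simp [fan], mul_zero] at t1
  rw [Hc_one nU nU, mul_one] at t2
  have hΛ0 : 0 ≤ Λ := by
    have h := (setIntegral_nonneg hb fun z _ => Real.rpow_nonneg (Real.sqrt_nonneg _) (p 0)).trans (hE 0)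
    by_contra! hn
    exact absurd h (not_le.2 (div_neg_of_neg_of_pos hn (by linarith [(hp 0).2])))
  suffices h : θ ∈ range fun k : ℕ => 2 * π * cR k by
    obtain ⟨k, hk⟩ := h
    exact ⟨k, hk.symm⟩
  rw [← closed_two_pi.closure_eq, Metric.mem_closure_iff]
  intro ε hε
  obtain ⟨ω, ω0, hω⟩ := claim hΛ0 (half_pos hε)
  have e1 := hp2.eventually (Ioi_mem_nhds (show (3 / 2 : ℝ) < 2 by norm_num))
  have e2 := hp2.eventually (Ioi_mem_nhds (show 2 - ω < 2 by linarith))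
  have e3 := t1.eventually (Iio_mem_nhds ω0)
  have e4 := t2.eventually (Metric.ball_mem_nhds θ (half_pos hε))
  obtain ⟨i, a1, a2, a3, a4⟩ := (e1.and (e2.and (e3.and e4))).exists
  change 3 / 2 < p i at a1
  change 2 - ω < p i at a2
  change _ < ω at a3
  obtain ⟨U, J, d, nrm⟩ := mkDat a1 (hp i).2 (hW i) (hstat i)
  have s0 : 0 < 2 - p i := by linarith [(hp i).2]
  have pz : zR ^ p i = 0 := Real.zero_rpow lN
  have full : ∀ g : ℂ → ℝ, ∫ z in ball zC 2, (2 - p i) * hsNorm (du i z) ^ (p i) * g z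
      = (2 - p i) * ∫ z, g z * na J z ^ p i := fun g => by
    rw [← integral_const_mul, ← setIntegral_eq_integral_of_forall_compl_eq_zero (s := ball zC 2) (f := fun z => (2 - p i) * (g z * na J z ^ p i)) (fun z hz => by simp [d.j0 z hz, pz])]
    refine setIntegral_congr_ae hb ?_
    filter_upwards [nrm] with z hz h
    rw [hz h]; ring
  have b1 : (2 - p i) * (∫ z, na J z ^ p i) ≤ Λ := by
    have := full fun _ => 1
    simp only [mul_one, one_mul] at this
    rw [← this, integral_const_mul]
    have := mL (hE i) s0.le
    rwa [mul_div_cancel₀ _ s0.ne'] at this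
  have b2 : (2 - p i) * (∫ z in Ann, na J z ^ p i) ≤ ω := by
    rw [full] at a3
    refine le_trans (mL ?_ s0.le) a3.le
    rw [← integral_indicator Ann_meas]
    refine integral_mono (d.iE.indicator Ann_meas) ?_ fun z => ?_
    · refine d.iE.mono' (fc.aestronglyMeasurable.mul d.iE.1) (eF fun z => ?_)
      have := Real.rpow_nonneg (norm_nonneg (J z)) (p i)
      rw [Real.norm_of_nonneg (mul_nonneg (f0 z) this)]
      exact mul_le_of_le_one_left this (fle z)
    · have := Real.rpow_nonneg (norm_nonneg (J z)) (p i)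
      by_cases h : z ∈ Ann
      · simp [h, fA z h]
      · rw [indicator_of_notMem h]; exact mul_nonneg (f0 z) this
  obtain ⟨k, hk⟩ := hω (p i) U J d lN b1 b2
  refine ⟨_, ⟨k, rfl⟩, ?_⟩
  rw [full] at a4
  rw [Real.dist_eq, abs_sub_comm] at a4
  rw [Real.dist_eq]
  have := abs_sub_le θ ((2 - p i) * Ie (p i) J 0 (1 / 4)) (2 * π * k)
  change |θ - (2 - p i) * Ie (p i) J 0 (1 / 4)| < _ at a4
  linarith
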